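/- Let Ψ = Φ ∘ H be the composition of Haiman's bijection H : SYT(n×n) → SYT'(2n−1, 2n−3, …, 1) with the promotion-sequence bijection Φ : SYT'(2n−1, 2n−3, …, 1) → R(w_0). Then for every T ∈ SYT(n×n), the cyclic descent set of T equals the cyclic descent set of the word Ψ(T): D(T) = D(Ψ(T)). In particular maj(T) = maj(Ψ(T)). -/

import Mathlib

/-! ### Tableau machinery: fillings as functions `ℕ × ℕ → ℕ` (entry `0` = empty/absent cell) -/

/-- One jeu de taquin slide: starting from an empty box at position `c`, repeatedly swap the
empty box with the smaller of the entries directly to its right and directly below it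
(`0` denotes an empty/absent cell), until neither exists.  Returns the resulting filling
together with the final position of the empty box; `fuel` bounds the number of steps. -/
def jdtSlide : ℕ → ((ℕ × ℕ) → ℕ) → (ℕ × ℕ) → (((ℕ × ℕ) → ℕ) × (ℕ × ℕ))
  | 0, f, c => (f, c)
  | fuel+1, f, c =>
    let a := c.1
    let b := c.2
    let r := f (a, b+1)
    let d := f (a+1, b)
    if r = 0 ∧ d = 0 then (f, c)
    else if d = 0 ∨ (r ≠ 0 ∧ r < d) then
      jdtSlide fuel (Function.update (Function.update f (a, b+1) 0) (a, b) r) (a, b+1)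
    else
      jdtSlide fuel (Function.update (Function.update f (a+1, b) 0) (a, b) d) (a+1, b)

/-- Jeu de taquin promotion of a standard filling with `N` boxes: delete the entry `1`
(in the upper left corner `(0,0)`), decrease every other entry by `1`, slide the empty box
by jeu de taquin, and fill the final empty box with `N`. -/
def promote (N : ℕ) (f : (ℕ × ℕ) → ℕ) : (ℕ × ℕ) → ℕ :=
  let s := jdtSlide N (fun c => f c - 1) (0, 0)
  Function.update s.1 s.2 N

/-- The cells of the (straight-shape) Young diagram of a partition `lam`:
row `a` consists of the cells `(a, b)` with `b < lam a`. -/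
def strCell (lam : List ℕ) (c : ℕ × ℕ) : Prop := c.2 < lam.getD c.1 0

/-- The cells of the shifted Young diagram of a strict partition `lam`:
row `a` consists of the cells `(a, b)` with `a ≤ b < a + lam a`. -/
def shiftCell (lam : List ℕ) (c : ℕ × ℕ) : Prop :=
  c.1 ≤ c.2 ∧ c.2 < c.1 + lam.getD c.1 0

/-- `IsStdFilling cells N f` : `f` is a standard tableau on the cell set `cells` with
entries `1, …, N`: it vanishes off `cells`, restricts to a bijection `cells → {1, …, N}`,
and is strictly increasing along rows and columns. -/
def IsStdFilling (cells : ℕ × ℕ → Prop) (N : ℕ) (f : (ℕ × ℕ) → ℕ) : Prop :=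
  (∀ c, ¬ cells c → f c = 0) ∧
  (∀ c, cells c → 1 ≤ f c ∧ f c ≤ N) ∧
  (∀ c c', cells c → cells c' → f c = f c' → c = c') ∧
  (∀ v, 1 ≤ v → v ≤ N → ∃ c, cells c ∧ f c = v) ∧
  (∀ a b, cells (a, b) → cells (a, b+1) → f (a, b) < f (a, b+1)) ∧
  (∀ a b, cells (a, b) → cells (a+1, b) → f (a, b) < f (a+1, b))

/-- The rectangular partition with `b` rows and `n` columns. -/
def rectShape (b n : ℕ) : List ℕ := List.replicate b n

/-- The square partition with `n` rows and `n` columns. -/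
def sqShape (n : ℕ) : List ℕ := List.replicate n n

/-- The doubled staircase strict partition `(2n-1, 2n-3, …, 1)`. -/
def dblStair (n : ℕ) : List ℕ := (List.range n).map (fun i => 2*n - 1 - 2*i)

/-- The index of the row containing the entry `v` of a filling
(rows numbered `0, 1, 2, …` from the top). -/
noncomputable def rowOf (f : (ℕ × ℕ) → ℕ) (v : ℕ) : ℕ := sInf {a | ∃ b, f (a, b) = v}

/-! ### Insertion machinery: tableaux as lists of rows of naturals -/

/-- Set position `j` of the list `l` to `v`, padding with `0`s if necessary. -/
def padSet (l : List ℕ) (j v : ℕ) : List ℕ :=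
  if j < l.length then l.set j v else l ++ List.replicate (j - l.length) 0 ++ [v]

/-- Set the box in row `r`, (row-relative) position `j`, of the tableau `T` to `v`,
adding new rows if necessary. -/
def setBox (T : List (List ℕ)) (r j v : ℕ) : List (List ℕ) :=
  let T' := if r < T.length then T else T ++ List.replicate (r + 1 - T.length) ([] : List ℕ)
  T'.set r (padSet (T'.getD r []) j v)

/-- The number of boxes of a tableau. -/
def tsize (T : List (List ℕ)) : ℕ := (T.map List.length).sum

/-- RSK row insertion of a letter `x` into a tableau: `x` bumps the leftmost entry of the
first row that is strictly greater than `x`; the bumped entry is inserted into the next row,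
and so on; a letter bumping nothing is placed at the end of the row. -/
def rskInsert (x : ℕ) : List (List ℕ) → List (List ℕ)
  | [] => [[x]]
  | row :: rest =>
    match row.findIdx? (fun z => decide (x < z)) with
    | none => (row ++ [x]) :: rest
    | some j => row.set j x :: rskInsert (row.getD j 0) rest

/-- The (unique) cell where the shapes of the tableaux `T` and `T'` differ,
when `T'` is obtained from `T` by one insertion. -/
def newCell (T T' : List (List ℕ)) : ℕ × ℕ :=
  let r := (List.range T'.length).findIdx
    (fun r => decide ((T.getD r []).length ≠ (T'.getD r []).length))
  (r, (T.getD r []).length)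

/-- The RSK insertion tableau `P(w)` and recording tableau `Q(w)` of a word `w`. -/
def rskPQ (w : List ℕ) : List (List ℕ) × List (List ℕ) :=
  w.foldl
    (fun PQ x =>
      let P' := rskInsert x PQ.1
      let c := newCell PQ.1 P'
      (P', setBox PQ.2 c.1 c.2 (tsize PQ.2 + 1)))
    ([], [])

/-- The RSK insertion tableau `P(w)` of the word `w`. -/
def rskP (w : List ℕ) : List (List ℕ) := (rskPQ w).1

/-- The RSK recording tableau `Q(w)` of the word `w`. -/
def rskQ (w : List ℕ) : List (List ℕ) := (rskPQ w).2

/-! Shifted mixed insertion (Haiman; semistandard version of Serrano).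

A shifted tableau is stored as a list of rows, row `r` occupying the (absolute) columns
`r, r+1, …`.  Entries are encoded so that primed letters can be handled: the unprimed
letter `k` is stored as `2k` and the primed letter `k'` is stored as `2k - 1`; this
encoding is order-preserving for the alphabet `1' < 1 < 2' < 2 < ⋯`. -/

/-- The entry of a shifted tableau `T` in row `r` and (absolute) column `c`, with `0`
meaning that there is no such box. -/
def sEntry (T : List (List ℕ)) (r c : ℕ) : ℕ := (T.getD r []).getD (c - r) 0

/-- One step of shifted mixed insertion, with `fuel` bounding the bumping chain.
If `isRow = true`, the (unprimed) value `v` is inserted into row `i`, bumping the leftmost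
entry strictly greater than `v`; if `isRow = false`, the (primed) value `v` is inserted into
column `i`, bumping the topmost entry strictly greater than `v`; a value bumping nothing is
placed at the end of the row resp. the bottom of the column, ending the insertion.
An entry bumped from the main diagonal becomes primed.  A bumped unprimed entry is inserted
into the next row; a bumped primed entry is inserted into the next column.
Returns the new tableau and the cell `(row, column)` where the insertion terminated. -/
def mixedIns : ℕ → List (List ℕ) → Bool → ℕ → ℕ → List (List ℕ) × (ℕ × ℕ)
  | 0, T, _, _, _ => (T, (0, 0))
  | fuel+1, T, true, r, v =>
    let row := T.getD r []
    match row.findIdx? (fun z => decide (v < z)) with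
    | none => (setBox T r row.length v, (r, r + row.length))
    | some j =>
      let z := row.getD j 0
      let T' := T.set r (row.set j v)
      let z' := if j = 0 ∧ z % 2 = 0 then z - 1 else z
      if z' % 2 = 0 then mixedIns fuel T' true (r+1) z'
      else mixedIns fuel T' false (r + j + 1) z'
  | fuel+1, T, false, c, v =>
    match (List.range (c+1)).find? (fun r =>
        decide (c - r < (T.getD r []).length) && decide (v < sEntry T r c)) with
    | some r =>
      let z := sEntry T r c
      let T' := setBox T r (c - r) v
      let z' := if r = c ∧ z % 2 = 0 then z - 1 else z
      if z' % 2 = 0 then mixedIns fuel T' true (r+1) z'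
      else mixedIns fuel T' false (c+1) z'
    | none =>
      let r := (List.range (c+1)).findIdx (fun r => decide ((T.getD r []).length ≤ c - r))
      (setBox T r (c - r) v, (r, c))

/-- Shifted mixed insertion of the letter `x` into the shifted tableau `T`:
the new insertion tableau together with the new cell. -/
def mixedInsLetter (T : List (List ℕ)) (x : ℕ) : List (List ℕ) × (ℕ × ℕ) :=
  mixedIns (tsize T + 2) T true 0 (2 * x)

/-- The shifted mixed insertion tableau `P'(w)` (with primed entries encoded as above) and
the standard shifted recording tableau `Q'(w)` of a word `w`. -/
def mixedPQ (w : List ℕ) : List (List ℕ) × List (List ℕ) :=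
  w.foldl
    (fun PQ x =>
      let s := mixedInsLetter PQ.1 x
      (s.1, setBox PQ.2 s.2.1 (s.2.2 - s.2.1) (tsize PQ.2 + 1)))
    ([], [])

/-- The shifted mixed insertion tableau `P'(w)` of the word `w`. -/
def mixedP (w : List ℕ) : List (List ℕ) := (mixedPQ w).1

/-- The shifted mixed insertion recording tableau `Q'(w)` of the word `w`. -/
def mixedQ (w : List ℕ) : List (List ℕ) := (mixedPQ w).2

/-- View a straight-shape tableau (list of rows) as a filling `ℕ × ℕ → ℕ`. -/
def toFunStraight (T : List (List ℕ)) : (ℕ × ℕ) → ℕ := fun c => (T.getD c.1 []).getD c.2 0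

/-- View a shifted tableau (list of rows, row `r` starting in column `r`) as a filling
`ℕ × ℕ → ℕ`. -/
def toFunShifted (T : List (List ℕ)) : (ℕ × ℕ) → ℕ :=
  fun c => if c.1 ≤ c.2 then (T.getD c.1 []).getD (c.2 - c.1) 0 else 0

/-- The promotion sequence `Φ(T) = r₁ r₂ ⋯ r_(n²)` of a standard shifted tableau `T` with
`n²` boxes, where `rᵢ` is the row containing the largest entry `n²` of `pⁱ(T)`, rows being
counted from the bottom up.  A letter (subscript) `r ∈ {1, …, n}` (row `r` from the bottom,
i.e. row `a = n - r` from the top) is recorded as the index `n - r = a : Fin n`, matching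
Mathlib's Coxeter matrix `CoxeterMatrix.Bₙ`, whose `4`-bond joins the indices `n-1` and
`n-2` (so the special generator `s₁` is the index `n - 1`); the subscript of an index
`i : Fin n` is thus `n - i`. -/
noncomputable def phiWord (n : ℕ) (hn : 0 < n) (f : (ℕ × ℕ) → ℕ) : List (Fin n) :=
  (List.range (n ^ 2)).map
    (fun i => ⟨(rowOf ((promote (n ^ 2))^[i + 1] f) (n ^ 2)) % n, Nat.mod_lt _ hn⟩)

/-- The (reverse Yamanouchi) square word `w` of a standard `n × n` square tableau `f`:
`wᵢ = n + 1 - (1-based row of the entry `i` in `f`)`, i.e. `wᵢ = n - rowOf f i` with rows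
numbered from `0` at the top.  It is the unique square word with `Q(w) = f`. -/
noncomputable def sqWordOf (n : ℕ) (f : (ℕ × ℕ) → ℕ) : List ℕ :=
  (List.range (n ^ 2)).map (fun i => n - rowOf f (i + 1))

/-- Haiman's bijection `H` from standard `n × n` square Young tableaux to standard shifted
Young tableaux of doubled staircase shape `(2n-1, 2n-3, …, 1)`: `H(Q(w)) = Q'(w)` for any
square word `w` (equivalently, embed the square tableau into a shifted shape and rectify it
by jeu de taquin). -/
noncomputable def haimanH (n : ℕ) (f : (ℕ × ℕ) → ℕ) : (ℕ × ℕ) → ℕ :=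
  toFunShifted (mixedQ (sqWordOf n f))

/-- The cyclic descent set of a standard filling `f` with `N` boxes: all `i` with
`1 ≤ i ≤ N - 1` such that `i` appears in a row strictly above `i+1` in `f`, together with
`0` if `N-1` appears in a row strictly above `N` in `p(f)`, where `p` is promotion. -/
noncomputable def tabCycDes (N : ℕ) (f : (ℕ × ℕ) → ℕ) : Set ℕ :=
  {i | 1 ≤ i ∧ i < N ∧ rowOf f i < rowOf f (i + 1)} ∪
  {i | i = 0 ∧ rowOf (promote N f) (N - 1) < rowOf (promote N f) N}

/-- The cyclic descent set of a word `v = v₁ ⋯ v_l`: all positions `i` with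
`1 ≤ i ≤ l - 1` such that `vᵢ > v_(i+1)`, together with `0` if `v_l > v₁`. -/
def wordCycDes (v : List ℕ) : Set ℕ :=
  {i | 1 ≤ i ∧ i < v.length ∧ v.getD i 0 < v.getD (i - 1) 0} ∪
  {i | i = 0 ∧ v.getD 0 0 < v.getD (v.length - 1) 0}

namespace CD

abbrev Cell := ℕ × ℕ

/-- A shape in the shifted quadrant: exclusive row ends `R` and column heights `C`. -/
structure Sh where
  R : ℕ → ℕ
  C : ℕ → ℕ

def put (s : Sh) (c : Cell) : Sh :=
  ⟨fun a => if a = c.1 then c.2 + 1 else s.R a, fun b => if b = c.2 then c.1 + 1 else s.C b⟩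

structure Ok (s : Sh) : Prop where
  r_ge : ∀ a, a ≤ s.R a
  c_le : ∀ b, s.C b ≤ b + 1
  mem : ∀ a b, a ≤ b → (b < s.R a ↔ a < s.C b)

def Ad (s : Sh) (c : Cell) : Prop := s.R c.1 = c.2 ∧ s.C c.2 = c.1

def nxt (s : Sh) (p : Cell) (m : Bool) : Cell × Bool :=
  if m = true ∧ p.1 ≠ p.2 then ((p.1 + 1, s.R (p.1 + 1)), true)
  else ((s.C (p.2 + 1), p.2 + 1), false)

structure Lab where
  v : ℕ
  p : Cell
  m : Bool

def push : Sh → Cell → List Lab → List Lab × Cell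
  | _, c, [] => ([], c)
  | s, c, l :: L =>
    if c = l.p then
      (⟨l.v, (nxt (put s c) l.p l.m).1, (nxt (put s c) l.p l.m).2⟩ ::
        (push (put s l.p) (nxt (put s c) l.p l.m).1 L).1,
        (push (put s l.p) (nxt (put s c) l.p l.m).1 L).2)
    else (l :: (push (put s l.p) c L).1, (push (put s l.p) c L).2)

def stepW : Sh → ℕ → List Lab → List Lab × Cell
  | s, x, [] => ([⟨x, (0, s.R 0), true⟩], (0, s.R 0))
  | s, x, l :: L =>
    if l.v ≤ x then (l :: (stepW (put s l.p) x L).1, (stepW (put s l.p) x L).2)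
    else (⟨x, (0, s.R 0), true⟩ :: (push s (0, s.R 0) (l :: L)).1, (push s (0, s.R 0) (l :: L)).2)

def outs (s : Sh) : List Lab → List ℕ → List Cell
  | _, [] => []
  | L, x :: w => (stepW s x L).2 :: outs s (stepW s x L).1 w

def state (s : Sh) : List Lab → List ℕ → List Lab
  | L, [] => L
  | L, x :: w => state s (stepW s x L).1 w

def Pw (s : Sh) (w : List ℕ) : List Cell := outs s [] w

def adj (d c : Cell) : Prop := (c.1 = d.1 ∧ c.2 = d.2 + 1) ∨ (c.1 = d.1 + 1 ∧ c.2 = d.2)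

instance (d c : Cell) : Decidable (adj d c) := by unfold adj; infer_instance

def slide : Cell → List Cell → List Cell
  | _, [] => []
  | d, c :: l => if adj d c then d :: slide c l else c :: slide d l

def hole : Cell → List Cell → Cell
  | d, [] => d
  | d, c :: l => if adj d c then hole c l else hole d l

def Valid : Sh → List Cell → Prop
  | _, [] => True
  | s, c :: l => Ad s c ∧ Valid (put s c) l

def puts (s : Sh) (l : List Cell) : Sh := l.foldl put s

/-- validity of a list of labels over a base shape -/
def LV (s : Sh) (L : List Lab) : Prop := Valid s (L.map Lab.p)

/-! basic lemmas -/

theorem Ad.le {s : Sh} (h : Ok s) {c : Cell} (hc : Ad s c) : c.1 ≤ c.2 := by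
  have := h.r_ge c.1
  rw [hc.1] at this; exact this

theorem Ok.put {s : Sh} (h : Ok s) {c : Cell} (hc : Ad s c) : Ok (put s c) := by
  obtain ⟨a, b⟩ := c
  have hle := Ad.le h hc
  obtain ⟨h1, h2, h3⟩ := h
  obtain ⟨h4, h5⟩ := hc
  simp only at h4 h5 hle
  refine ⟨fun x => ?_, fun x => ?_, fun x y hxy => ?_⟩
  · simp only [CD.put]; have := h1 x; split <;> omega
  · simp only [CD.put]; have := h2 x; split <;> omega
  · simp only [CD.put]
    have h6 := h3 x y hxy
    split <;> split <;> subst_vars <;> omega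

theorem put_comm (s : Sh) {c d : Cell} (h1 : c.1 ≠ d.1) (h2 : c.2 ≠ d.2) :
    put (put s c) d = put (put s d) c := by
  simp only [put]
  congr 1
  · funext a; split <;> split <;> simp_all
  · funext a; split <;> split <;> simp_all

/-- next position in row mode is addable -/
theorem nxt_ad {s : Sh} (h : Ok s) {p : Cell} (hp : Ad s p) (m : Bool) :
    Ad (put s p) (nxt (put s p) p m).1 := by
  have hok := h.put hp
  obtain ⟨a, b⟩ := p
  have hle := Ad.le h hp
  obtain ⟨h1, h2, h3⟩ := h
  obtain ⟨h4, h5⟩ := hp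
  simp only at h4 h5 hle
  unfold nxt
  split
  · rename_i hm
    simp only [ne_eq] at hm
    have e1 : ((put s (a, b)).R (a+1)) = s.R (a+1) := by simp [put]
    refine ⟨rfl, ?_⟩
    simp only [e1]
    have := h3 (a+1) b (by omega)
    have h6 : s.R (a+1) ≤ b := by omega
    have := h1 (a+1)
    simp only [put]
    split
    · rfl
    · have := h3 (a+1) (s.R (a+1)) (by omega)
      have := h3 a (s.R (a+1)) (by omega)
      omega
  · have e1 : ((put s (a, b)).C (b+1)) = s.C (b+1) := by simp [put]
    refine ⟨?_, rfl⟩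
    simp only [e1]
    have := h3 a (b+1) (by omega)
    simp only [put]
    split
    · rfl
    · have := h3 (s.C (b+1)) (b+1) (by omega)
      have := h3 (s.C (b+1)) b (by omega)
      omega

theorem ad_zero {s : Sh} (h : Ok s) : Ad s (0, s.R 0) := by
  refine ⟨rfl, ?_⟩
  have := h.mem 0 (s.R 0) (by omega)
  simp only; omega

/-- two addable cells which differ -/
theorem ad_ne {s : Sh} {c d : Cell} (hc : Ad s c) (hd : Ad s d) (hne : c ≠ d) :
    c.1 ≠ d.1 ∧ c.2 ≠ d.2 := by
  obtain ⟨a, b⟩ := c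
  obtain ⟨a', b'⟩ := d
  obtain ⟨h1, h2⟩ := hc
  obtain ⟨h3, h4⟩ := hd
  simp only at *
  constructor
  · rintro rfl; apply hne; rw [← h1, ← h3]
  · rintro rfl; apply hne; rw [← h2, ← h4]

theorem ad_put {s : Sh} {c d : Cell} (hc : Ad s c) (hd : Ad s d) (hne : c ≠ d) :
    Ad (put s d) c := by
  have := ad_ne hc hd hne
  exact ⟨by simp [put, this.1, hc.1], by simp [put, this.2, hc.2]⟩

theorem push_valid (L : List Lab) : ∀ (s : Sh) (c : Cell), Ok s → Ad s c → LV s L →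
    LV (put s c) (push s c L).1 ∧ Ad (puts s (L.map Lab.p)) (push s c L).2 ∧
    puts (put s c) ((push s c L).1.map Lab.p) = put (puts s (L.map Lab.p)) (push s c L).2 := by
  induction L with
  | nil => intro s c h hc _; simp [push, LV, Valid, puts, hc]
  | cons l L ih =>
    intro s c h hc hL
    obtain ⟨h1, h2⟩ := hL
    simp only [push]
    split
    · rename_i he
      subst he
      have hn := nxt_ad h hc l.m
      have := ih (put s l.p) (nxt (put s l.p) l.p l.m).1 (h.put hc) hn h2
      exact ⟨⟨hn, this.1⟩, this.2.1, this.2.2⟩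
    · rename_i he
      have hc' := ad_put hc h1 he
      have := ih (put s l.p) c (h.put h1) hc' h2
      have hn := ad_ne hc h1 he
      rw [put_comm s hn.1.symm hn.2.symm] at this
      exact ⟨⟨ad_put h1 hc (Ne.symm he), this.1⟩, this.2.1, this.2.2⟩

theorem stepW_valid (x : ℕ) (L : List Lab) : ∀ (s : Sh), Ok s → LV s L →
    LV s (stepW s x L).1 ∧ Ad (puts s (L.map Lab.p)) (stepW s x L).2 ∧
    puts s ((stepW s x L).1.map Lab.p) = put (puts s (L.map Lab.p)) (stepW s x L).2 := by
  induction L with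
  | nil => intro s h _; simp [stepW, LV, Valid, puts, ad_zero h]
  | cons l L ih =>
    intro s h hL
    obtain ⟨h1, h2⟩ := hL
    simp only [stepW]
    split
    · have := ih (put s l.p) (h.put h1) h2
      exact ⟨⟨h1, this.1⟩, this.2.1, this.2.2⟩
    · have := push_valid (l :: L) s (0, s.R 0) h (ad_zero h) ⟨h1, h2⟩
      exact ⟨⟨ad_zero h, this.1⟩, this.2.1, this.2.2⟩

theorem Ok.puts {s : Sh} (l : List Cell) : ∀ {s : Sh}, Ok s → Valid s l → Ok (puts s l) := by
  induction l with
  | nil => intro s h _; exact h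
  | cons c l ih => intro s h hl; exact ih (h.put hl.1) hl.2

theorem outs_valid (w : List ℕ) : ∀ (s : Sh) (L : List Lab), Ok s → LV s L →
    Valid (puts s (L.map Lab.p)) (outs s L w) ∧ LV s (state s L w) ∧
    puts (puts s (L.map Lab.p)) (outs s L w) = puts s ((state s L w).map Lab.p) := by
  induction w with
  | nil => intro s L h hL; exact ⟨trivial, hL, rfl⟩
  | cons x w ih =>
    intro s L h hL
    have h1 := stepW_valid x L s h hL
    have := ih s _ h h1.1
    rw [h1.2.2] at this
    exact ⟨⟨h1.2.1, this.1⟩, this.2.1, this.2.2⟩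

theorem outs_length (w : List ℕ) : ∀ (s : Sh) (L : List Lab), (outs s L w).length = w.length := by
  induction w with
  | nil => intros; rfl
  | cons x w ih => intros; simp [outs, ih]

theorem outs_append (w w' : List ℕ) : ∀ (s : Sh) (L : List Lab),
    outs s L (w ++ w') = outs s L w ++ outs s (state s L w) w' := by
  induction w with
  | nil => intros; rfl
  | cons x w ih => intros; simp [outs, state, ih]

theorem state_append (w w' : List ℕ) : ∀ (s : Sh) (L : List Lab),
    state s L (w ++ w') = state s (state s L w) w' := by
  induction w with
  | nil => intros; rfl
  | cons x w ih => intros; simp [state, ih]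

/-! slides -/

theorem swap_valid {s : Sh} (h : Ok s) {c d : Cell} (hd : Ad s d) (hc : Ad (put s d) c)
    (hn : ¬ adj d c) : Ad s c ∧ Ad (put s c) d ∧ put (put s d) c = put (put s c) d := by
  obtain ⟨a, b⟩ := c
  obtain ⟨a', b'⟩ := d
  have hle := Ad.le h hd
  have hle2 := Ad.le (h.put hd) hc
  obtain ⟨h1, h2⟩ := hc
  obtain ⟨h3, h4⟩ := hd
  simp only [put, adj] at *
  have ha : a ≠ a' := by
    rintro rfl; simp at h1; apply hn; left; omega
  have hb : b ≠ b' := by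
    rintro rfl; simp at h2; apply hn; right; omega
  simp only [ha, hb, if_false] at h1 h2
  refine ⟨⟨h1, h2⟩, ⟨?_, ?_⟩, put_comm s (c := (a', b')) (d := (a, b)) (Ne.symm ha) (Ne.symm hb)⟩
  · simp [h3, Ne.symm ha]
  · simp [h4, Ne.symm hb]

theorem slide_valid (l : List Cell) : ∀ (s : Sh) (d : Cell), Ok s → Ad s d → Valid (put s d) l →
    Valid s (slide d l) ∧ Ad (puts s (slide d l)) (hole d l) ∧
    put (puts s (slide d l)) (hole d l) = puts (put s d) l := by
  induction l with
  | nil => intro s d h hd _; exact ⟨trivial, hd, rfl⟩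
  | cons c l ih =>
    intro s d h hd hl
    simp only [slide, hole]
    obtain ⟨hc, hl⟩ := hl
    split
    · have := ih (put s d) c (h.put hd) hc hl
      exact ⟨⟨hd, this.1⟩, this.2.1, this.2.2⟩
    · rename_i hn
      obtain ⟨h1, h2, h3⟩ := swap_valid h hd hc hn
      have := ih (put s c) d (h.put h1) h2 (by rw [← h3]; exact hl)
      rw [← h3] at this
      exact ⟨⟨h1, this.1⟩, this.2.1, this.2.2⟩

theorem slide_length (l : List Cell) : ∀ d, (slide d l).length = l.length := by
  induction l with
  | nil => intro d; rfl
  | cons c l ih => intro d; simp only [slide]; split <;> simp [ih]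

theorem slide_append (l l' : List Cell) : ∀ d,
    slide d (l ++ l') = slide d l ++ slide (hole d l) l' := by
  induction l with
  | nil => intro d; rfl
  | cons c l ih => intro d; simp only [slide, hole, List.cons_append]; split <;> simp [ih]

theorem hole_append (l l' : List Cell) : ∀ d,
    hole d (l ++ l') = hole (hole d l) l' := by
  induction l with
  | nil => intro d; rfl
  | cons c l ih => intro d; simp only [hole, List.cons_append]; split <;> simp [ih]

end CD

namespace CD

def sl (d c : Cell) : Cell × Cell := if adj d c then (d, c) else (c, d)

def Cfg (s : Sh) (d : Cell) (q : Cell) (m : Bool) (p : Cell) (m' : Bool) (D : Cell) : Prop :=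
  Ad s d ∧ ((p = q ∧ m = m' ∧ D = d ∧ Ad s q ∧ q ≠ d) ∨
    (p = d ∧ D = q ∧ Ad (put s d) q ∧
      ((m = true ∧ m' = true ∧ q.1 ≤ d.1 ∧ q.2 = d.2 + 1) ∨
       (m' = false ∧ (m = false ∨ q.1 = q.2) ∧ q.1 = d.1 + 1 ∧ q.2 ≤ d.2))))

/-- one label processes one event: new position, mode, and outgoing event -/
def lab1 (s : Sh) (c : Cell) (q : Cell) (m : Bool) : (Cell × Bool) × Cell :=
  if c = q then (nxt (put s c) q m, (nxt (put s c) q m).1) else ((q, m), c)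

theorem nadj_of_ne {q e : Cell} (h : q.1 ≠ e.1 ∧ q.2 ≠ e.2) : ¬ adj q e := by
  unfold adj; omega

theorem not_ad_put_self {s : Sh} {d : Cell} : ¬ Ad (put s d) d := by
  rintro ⟨h, _⟩; simp [put] at h

theorem local_same {s : Sh} (h : Ok s) {d q e : Cell} {m : Bool} (hd : Ad s d) (hq : Ad s q)
    (hne : q ≠ d) (he : Ad (put s d) e) :
    (lab1 s (sl d e).1 q m).2 = (sl d (lab1 (put s d) e q m).2).1 ∧
    Cfg (put s (sl d e).1) (sl d e).2 (lab1 (put s d) e q m).1.1 (lab1 (put s d) e q m).1.2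
      (lab1 s (sl d e).1 q m).1.1 (lab1 s (sl d e).1 q m).1.2
      (sl d (lab1 (put s d) e q m).2).2 := by
  have hqd := ad_ne hq hd hne
  have hqd' := ad_put hq hd hne
  by_cases hadj : adj d e
  · have heq : e ≠ q := by rintro rfl; exact nadj_of_ne ⟨hqd.1.symm, hqd.2.symm⟩ hadj
    simp only [sl, hadj, if_true, lab1, heq, if_false, Ne.symm hne, true_and]
    exact ⟨he, Or.inl ⟨rfl, rfl, rfl, hqd', heq.symm⟩⟩
  · obtain ⟨h1, h2, h3⟩ := swap_valid h hd he hadj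
    by_cases heq : e = q
    · subst heq
      have n1 := nxt_ad (h.put hd) he m
      have n2 := nxt_ad h h1 m
      rw [h3] at n1
      have hokd := h.put hd
      have hoke := h.put h1
      obtain ⟨a, b⟩ := e
      obtain ⟨a', b'⟩ := d
      simp only at hqd
      obtain ⟨ha, hb⟩ := hqd
      by_cases hm : m = true ∧ a ≠ b
      · have e1 : nxt (put (put s (a', b')) (a, b)) (a, b) m =
          ((a+1, (put (put s (a', b')) (a, b)).R (a+1)), true) := by
            unfold nxt; rw [if_pos hm]
        have e2 : nxt (put s (a, b)) (a, b) m = ((a+1, (put s (a, b)).R (a+1)), true) := by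
            unfold nxt; rw [if_pos hm]
        rw [← h3, e1] at n1
        rw [e2] at n2
        simp only [lab1, sl, hadj, if_false, if_true, e1, e2]
        by_cases hrow : a' = a + 1
        · subst hrow
          have x1 : (put s (a, b)).R (a+1) = b' := by
            simp only [put]; rw [if_neg (by omega)]; exact hd.1
          have x2 : (put (put s (a+1, b')) (a, b)).R (a+1) = b' + 1 := by
            simp [put]
          simp only [x1, x2] at n1 n2 ⊢
          have : adj (a+1, b') (a+1, b'+1) := Or.inl ⟨rfl, rfl⟩
          rw [if_pos this]
          refine ⟨rfl, h2, Or.inr ⟨rfl, rfl, ?_, ?_⟩⟩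
          · rw [← h3]; exact n1
          · left; simp
        · have x1 : (put (put s (a', b')) (a, b)).R (a+1) = (put s (a, b)).R (a+1) := by
            simp only [put]
            repeat rw [if_neg (by omega)]
          rw [x1] at n1 ⊢
          have : ¬ adj (a', b') (a+1, (put s (a, b)).R (a+1)) := by
            unfold adj; simp only; omega
          rw [if_neg this]
          refine ⟨rfl, h2, Or.inl ⟨rfl, rfl, rfl, n2, ?_⟩⟩
          intro hc; rw [Prod.mk.injEq] at hc; exact hrow hc.1.symm
      · have e1 : nxt (put (put s (a', b')) (a, b)) (a, b) m =
          (((put (put s (a', b')) (a, b)).C (b+1), b+1), false) := by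
            unfold nxt; rw [if_neg hm]
        have e2 : nxt (put s (a, b)) (a, b) m = (((put s (a, b)).C (b+1), b+1), false) := by
            unfold nxt; rw [if_neg hm]
        rw [← h3, e1] at n1
        rw [e2] at n2
        simp only [lab1, sl, hadj, if_false, if_true, e1, e2]
        by_cases hrow : b' = b + 1
        · subst hrow
          have x1 : (put s (a, b)).C (b+1) = a' := by
            simp only [put]; rw [if_neg (by omega)]; exact hd.2
          have x2 : (put (put s (a', b+1)) (a, b)).C (b+1) = a' + 1 := by
            simp [put]
          simp only [x1, x2] at n1 n2 ⊢
          have : adj (a', b+1) (a'+1, b+1) := Or.inr ⟨rfl, rfl⟩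
          rw [if_pos this]
          refine ⟨rfl, h2, Or.inr ⟨rfl, rfl, ?_, ?_⟩⟩
          · rw [← h3]; exact n1
          · right; simp
        · have x1 : (put (put s (a', b')) (a, b)).C (b+1) = (put s (a, b)).C (b+1) := by
            simp only [put]
            repeat rw [if_neg (by omega)]
          rw [x1] at n1 ⊢
          have : ¬ adj (a', b') ((put s (a, b)).C (b+1), b+1) := by
            unfold adj; simp only; omega
          rw [if_neg this]
          refine ⟨rfl, h2, Or.inl ⟨rfl, rfl, rfl, n2, ?_⟩⟩
          intro hc; rw [Prod.mk.injEq] at hc; exact hrow hc.2.symm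
    · simp only [sl, hadj, if_false, lab1, heq, true_and]
      exact ⟨h2, Or.inl ⟨rfl, rfl, rfl, ad_put hq h1 (Ne.symm heq), hne⟩⟩

theorem local_cross {s : Sh} (h : Ok s) {d q e : Cell} {m m' : Bool} (hd : Ad s d)
    (hq : Ad (put s d) q)
    (hc : (m = true ∧ m' = true ∧ q.1 ≤ d.1 ∧ q.2 = d.2 + 1) ∨
       (m' = false ∧ (m = false ∨ q.1 = q.2) ∧ q.1 = d.1 + 1 ∧ q.2 ≤ d.2))
    (he : Ad (put s d) e) :
    (lab1 s (sl d e).1 d m').2 = (sl q (lab1 (put s d) e q m).2).1 ∧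
    Cfg (put s (sl d e).1) (sl d e).2 (lab1 (put s d) e q m).1.1 (lab1 (put s d) e q m).1.2
      (lab1 s (sl d e).1 d m').1.1 (lab1 s (sl d e).1 d m').1.2
      (sl q (lab1 (put s d) e q m).2).2 := by
  have hled := Ad.le h hd
  have hleq := Ad.le (h.put hd) hq
  have hokd := h.put hd
  have hee : e ≠ d := by rintro rfl; exact not_ad_put_self he
  by_cases hadj : adj d e
  · by_cases heq : e = q
    · subst heq
      have n1 := nxt_ad hokd he m
      have n2 := nxt_ad h hd m'
      have hok2 := hokd.put he
      obtain ⟨a, b⟩ := e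
      obtain ⟨a', b'⟩ := d
      simp only [lab1, sl, hadj, if_true]
      have g1 := hokd.mem
      have g0 := h.mem
      have r0 := h.r_ge
      obtain ⟨p1, p2⟩ := he
      obtain ⟨d1, d2⟩ := hd
      simp only at *
      rcases hc with ⟨rfl, rfl, hc1, hc2⟩ | ⟨rfl, hm, hc1, hc2⟩
      · subst hc2
        have haa : a = a' := by
          unfold adj at hadj; simp only at hadj; omega
        subst haa
        have hm1 : (true = true ∧ (a, b'+1).1 ≠ (a, b'+1).2) := by simp; omega
        by_cases hdiag : a = b'
        · subst hdiag
          have e1 : nxt (put (put s (a, a)) (a, a+1)) (a, a+1) true = ((a+1, a+1), true) := by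
            unfold nxt; rw [if_pos hm1]
            have : s.R (a+1) = a+1 := by
              have := g0 (a+1) (a+1) le_rfl
              have := r0 (a+1)
              simp only [put] at p2
              rw [if_neg (by omega)] at p2
              omega
            simp [put, this]
          have e2 : nxt (put s (a, a)) (a, a) true = ((a, a+1), false) := by
            unfold nxt; rw [if_neg (by simp)]
            simp only [p2]
          rw [e1] at n1 ⊢
          rw [e2] at n2 ⊢
          have : adj (a, a+1) (a+1, a+1) := Or.inr ⟨rfl, rfl⟩
          rw [if_pos this]
          exact ⟨rfl, n2, Or.inr ⟨rfl, rfl, n1, by simp⟩⟩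
        · have hm2 : (true = true ∧ (a, b').1 ≠ (a, b').2) := by simp; omega
          have e1 : nxt (put (put s (a, b')) (a, b'+1)) (a, b'+1) true =
              ((a+1, s.R (a+1)), true) := by
            unfold nxt; rw [if_pos hm1]; simp [put]
          have e2 : nxt (put s (a, b')) (a, b') true = ((a+1, s.R (a+1)), true) := by
            unfold nxt; rw [if_pos hm2]; simp [put]
          rw [e1] at n1 ⊢
          rw [e2] at n2 ⊢
          have hb := g0 (a+1) b' (by omega)
          have : ¬ adj (a, b'+1) (a+1, s.R (a+1)) := by
            unfold adj; simp only; omega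
          rw [if_neg this]
          refine ⟨rfl, ⟨p1, p2⟩, Or.inl ⟨rfl, rfl, rfl, n2, ?_⟩⟩
          intro hc; rw [Prod.mk.injEq] at hc; omega
      · subst hc1
        have hbb : b = b' := by
          unfold adj at hadj; simp only at hadj; omega
        subst hbb
        have hm1 : ¬ (m = true ∧ (a'+1, b).1 ≠ (a'+1, b).2) := by
          rcases hm with rfl | hm
          · simp
          · simp [hm]
        have e1 : nxt (put (put s (a', b)) (a'+1, b)) (a'+1, b) m =
            ((s.C (b+1), b+1), false) := by
          unfold nxt; rw [if_neg hm1]; simp [put]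
        have e2 : nxt (put s (a', b)) (a', b) false = ((s.C (b+1), b+1), false) := by
          unfold nxt; rw [if_neg (by simp)]; simp [put]
        rw [e1] at n1 ⊢
        rw [e2] at n2 ⊢
        have hb := g0 a' (b+1) (by omega)
        have : ¬ adj (a'+1, b) (s.C (b+1), b+1) := by
          unfold adj; simp only; omega
        rw [if_neg this]
        refine ⟨rfl, ⟨p1, p2⟩, Or.inl ⟨rfl, rfl, rfl, n2, ?_⟩⟩
        intro hc; rw [Prod.mk.injEq] at hc; omega
    · have hne := ad_ne he hq heq
      have hnq : ¬ adj q e := nadj_of_ne ⟨hne.1.symm, hne.2.symm⟩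
      have n2 := nxt_ad h hd m'
      have hqe := ad_put hq he (Ne.symm heq)
      simp only [lab1, sl, hadj, heq, if_true, if_false, hnq]
      obtain ⟨a, b⟩ := e
      obtain ⟨a', b'⟩ := d
      have g0 := hokd.r_ge
      have he' := he
      obtain ⟨p1, p2⟩ := he
      simp only at *
      have key : nxt (put s (a', b')) (a', b') m' = ((a, b), m') := by
        rcases hc with ⟨rfl, rfl, hc1, hc2⟩ | ⟨rfl, hm, hc1, hc2⟩
        · have : a = a' + 1 ∧ b = b' := by
            unfold adj at hadj; simp only at hadj; omega
          obtain ⟨rfl, rfl⟩ := this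
          have := g0 (a'+1)
          unfold nxt; rw [if_pos (by simp; omega)]
          simp [p1]
        · have : a = a' ∧ b = b' + 1 := by
            unfold adj at hadj; simp only at hadj; omega
          obtain ⟨rfl, rfl⟩ := this
          unfold nxt; rw [if_neg (by simp)]
          simp [p2]
      rw [key]
      refine ⟨rfl, he', Or.inr ⟨rfl, rfl, hqe, ?_⟩⟩
      unfold adj at hadj
      simp only at *
      rcases hc with ⟨rfl, rfl, hc1, hc2⟩ | ⟨rfl, hm, hc1, hc2⟩
      · left; refine ⟨rfl, rfl, ?_, ?_⟩ <;> omega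
      · right; refine ⟨rfl, hm, ?_, ?_⟩ <;> omega
  · obtain ⟨h1, h2, h3⟩ := swap_valid h hd he hadj
    by_cases heq : e = q
    · subst heq
      have n1 := nxt_ad hokd he m
      have hok2 := hokd.put he
      have g2 := hok2.mem
      have g1 := hokd.mem
      simp only [lab1, sl, hadj, if_true, if_false, hee]
      obtain ⟨a, b⟩ := e
      obtain ⟨a', b'⟩ := d
      have he' := he
      obtain ⟨p1, p2⟩ := he
      unfold adj at hadj
      simp only at *
      rcases hc with ⟨rfl, rfl, hc1, hc2⟩ | ⟨rfl, hm, hc1, hc2⟩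
      · subst hc2
        have e1 : nxt (put (put s (a', b')) (a, b'+1)) (a, b'+1) true =
            ((a+1, b'+1), true) := by
          unfold nxt; rw [if_pos (by simp; omega)]
          simp only [Prod.mk.injEq, and_true, true_and]
          have x : (put (put s (a', b')) (a, b'+1)).R (a+1) = (put s (a', b')).R (a+1) := by
            simp [put]
          rw [x]
          have y1 := g1 (a+1) b' (by omega)
          have y2 := g1 (a+1) (b'+1) (by omega)
          have z : (put s (a', b')).C b' = a' + 1 := by simp [put]
          omega
        rw [e1] at n1 ⊢
        have : adj (a, b'+1) (a+1, b'+1) := Or.inr ⟨rfl, rfl⟩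
        rw [if_pos this]
        refine ⟨rfl, h2, Or.inr ⟨rfl, rfl, ?_, ?_⟩⟩
        · rw [← h3]; exact n1
        · left; simp; omega
      · subst hc1
        have hm1 : ¬ (m = true ∧ (a'+1, b).1 ≠ (a'+1, b).2) := by
          rcases hm with rfl | hm
          · simp
          · simp [hm]
        have e1 : nxt (put (put s (a', b')) (a'+1, b)) (a'+1, b) m =
            ((a'+1, b+1), false) := by
          unfold nxt; rw [if_neg hm1]
          simp only [Prod.mk.injEq, and_true]
          have x : (put (put s (a', b')) (a'+1, b)).C (b+1) = (put s (a', b')).C (b+1) := by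
            simp [put]
          rw [x]
          have y1 := g1 a' (b+1) (by omega)
          have y2 := g1 (a'+1) (b+1)
          have z : (put s (a', b')).R a' = b' + 1 := by simp [put]
          have hh := hokd.c_le (b+1)
          omega
        rw [e1] at n1 ⊢
        have : adj (a'+1, b) (a'+1, b+1) := Or.inl ⟨rfl, rfl⟩
        rw [if_pos this]
        refine ⟨rfl, h2, Or.inr ⟨rfl, rfl, ?_, ?_⟩⟩
        · rw [← h3]; exact n1
        · right; simp; omega
    · have hne := ad_ne he hq heq
      have hnq : ¬ adj q e := nadj_of_ne ⟨hne.1.symm, hne.2.symm⟩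
      simp only [lab1, sl, hadj, heq, hee, if_false, hnq, true_and]
      refine ⟨h2, Or.inr ⟨rfl, rfl, ?_, hc⟩⟩
      rw [← h3]; exact ad_put hq he (Ne.symm heq)

inductive Rel : Sh → Cell → List Lab → List Lab → Cell → Prop
  | nil {s d} : Ad s d → Rel s d [] [] d
  | cons {s d v q m p m' D L1 L2 E} : Cfg s d q m p m' D → Rel (put s p) D L1 L2 E →
      Rel s d (⟨v, q, m⟩ :: L1) (⟨v, p, m'⟩ :: L2) E

theorem push_cons (s : Sh) (c : Cell) (v : ℕ) (q : Cell) (m : Bool) (L : List Lab) :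
    push s c (⟨v, q, m⟩ :: L) =
      (⟨v, (lab1 s c q m).1.1, (lab1 s c q m).1.2⟩ :: (push (put s q) (lab1 s c q m).2 L).1,
       (push (put s q) (lab1 s c q m).2 L).2) := by
  simp only [push, lab1]
  split <;> simp

theorem Cfg.ad {s d q m p m' D} (h : Cfg s d q m p m' D) :
    Ad s d ∧ Ad s p ∧ Ad (put s d) q ∧ Ad (put s p) D ∧ put (put s p) D = put (put s d) q := by
  obtain ⟨hd, ⟨rfl, rfl, rfl, h1, h2⟩ | ⟨rfl, rfl, h1, h2⟩⟩ := h
  · have := ad_ne h1 hd h2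
    exact ⟨hd, h1, ad_put h1 hd h2, ad_put hd h1 h2.symm, put_comm s this.1 this.2⟩
  · exact ⟨hd, hd, h1, h1, rfl⟩

theorem cfg_step {s d q m p m' D} (h : Ok s) (hc : Cfg s d q m p m' D) {e : Cell}
    (he : Ad (put s d) e) :
    (lab1 s (sl d e).1 p m').2 = (sl D (lab1 (put s d) e q m).2).1 ∧
    Cfg (put s (sl d e).1) (sl d e).2 (lab1 (put s d) e q m).1.1 (lab1 (put s d) e q m).1.2
      (lab1 s (sl d e).1 p m').1.1 (lab1 s (sl d e).1 p m').1.2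
      (sl D (lab1 (put s d) e q m).2).2 := by
  obtain ⟨hd, ⟨rfl, rfl, rfl, h1, h2⟩ | ⟨rfl, rfl, h1, h2⟩⟩ := hc
  · exact local_same h hd h1 h2 he
  · exact local_cross h hd h1 h2 he

theorem lab1_ad {s : Sh} (h : Ok s) {c q : Cell} {m : Bool} (hc : Ad s c) (hq : Ad s q) :
    Ad (put s q) (lab1 s c q m).2 ∧ Ad (put s c) (lab1 s c q m).1.1 ∧
    put (put s c) (lab1 s c q m).1.1 = put (put s q) (lab1 s c q m).2 := by
  unfold lab1
  split
  · rename_i he; subst he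
    exact ⟨nxt_ad h hc m, nxt_ad h hc m, rfl⟩
  · rename_i he
    have := ad_ne hc hq he
    exact ⟨ad_put hc hq he, ad_put hq hc (Ne.symm he), put_comm s this.1 this.2⟩

theorem sl_ad {s : Sh} (h : Ok s) {d e : Cell} (hd : Ad s d) (he : Ad (put s d) e) :
    Ad s (sl d e).1 ∧ Ad (put s (sl d e).1) (sl d e).2 ∧
    put (put s (sl d e).1) (sl d e).2 = put (put s d) e := by
  unfold sl
  split
  · exact ⟨hd, he, rfl⟩
  · rename_i hn
    obtain ⟨h1, h2, h3⟩ := swap_valid h hd he hn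
    exact ⟨h1, h2, h3.symm⟩

theorem push_rel {L1 L2 : List Lab} {s : Sh} {d D : Cell} (hr : Rel s d L1 L2 D) :
    ∀ {e : Cell}, Ok s → Ad (put s d) e →
    Rel (put s (sl d e).1) (sl d e).2 (push (put s d) e L1).1 (push s (sl d e).1 L2).1
      (sl D (push (put s d) e L1).2).2 ∧
    (push s (sl d e).1 L2).2 = (sl D (push (put s d) e L1).2).1 := by
  induction hr with
  | nil hd =>
    intro e h he
    simp only [push, and_true]
    exact Rel.nil (sl_ad h hd he).2.1
  | @cons s d v q m p m' D L1 L2 E hcfg hrel ih =>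
    intro e h he
    rw [push_cons, push_cons]
    obtain ⟨a1, a2, a3, a4, a5⟩ := hcfg.ad
    obtain ⟨h1, h2⟩ := cfg_step h hcfg he
    have h3 := sl_ad h a1 he
    have h4 := lab1_ad (m := m) (h.put a1) he a3
    have h5 := lab1_ad (m := m') h h3.1 a2
    have := ih (e := (lab1 (put s d) e q m).2) (h.put a2) (by rw [a5]; exact h4.1)
    rw [a5, ← h1, ← h5.2.2] at this
    exact ⟨Rel.cons h2 this.1, this.2⟩

/-- Inserting a new letter on both sides. -/
theorem stepW_rel {L1 L2 : List Lab} {s : Sh} {d D : Cell} (x : ℕ) (hr : Rel s d L1 L2 D) :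
    Ok s → Rel s d (stepW (put s d) x L1).1 (stepW s x L2).1 (sl D (stepW (put s d) x L1).2).2 ∧
    (stepW s x L2).2 = (sl D (stepW (put s d) x L1).2).1 := by
  have new : ∀ {s : Sh} {d : Cell}, Ok s → Ad s d →
      Cfg s d (0, (put s d).R 0) true (0, s.R 0) true (sl d (0, (put s d).R 0)).2 ∧
      (0, s.R 0) = (sl d (0, (put s d).R 0)).1 := by
    intro s d h hd
    obtain ⟨a, b⟩ := d
    have h0 := ad_zero h
    have h0' := ad_zero (h.put hd)
    by_cases ha : a = 0
    · subst ha
      have hb : s.R 0 = b := hd.1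
      have x : (put s (0, b)).R 0 = b + 1 := by simp [put]
      rw [x] at h0' ⊢
      have : adj (0, b) (0, b+1) := Or.inl ⟨rfl, rfl⟩
      simp only [sl, this, if_true, hb, and_true]
      exact ⟨hd, Or.inr ⟨rfl, rfl, h0', by simp⟩⟩
    · have x : (put s (a, b)).R 0 = s.R 0 := by simp [put, Ne.symm ha]
      rw [x] at h0' ⊢
      have hb : s.R 0 ≠ b := by
        intro hb
        have := hd.2
        have := h0.2
        simp only [hb] at *
        omega
      have : ¬ adj (a, b) (0, s.R 0) := by unfold adj; simp only; omega
      simp only [sl, this, if_false, and_true]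
      refine ⟨hd, Or.inl ⟨rfl, rfl, rfl, h0, ?_⟩⟩
      intro hc; rw [Prod.mk.injEq] at hc; exact ha hc.1.symm
  induction hr with
  | @nil s d hd =>
    intro h
    simp only [stepW]
    have := new h hd
    exact ⟨Rel.cons this.1 (Rel.nil this.1.ad.2.2.2.1), this.2⟩
  | @cons s d v q m p m' D L1 L2 E hcfg hrel ih =>
    intro h
    obtain ⟨a1, a2, a3, a4, a5⟩ := hcfg.ad
    simp only [stepW]
    split
    · have := ih (h.put a2)
      rw [a5] at this
      exact ⟨Rel.cons hcfg this.1, this.2⟩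
    · have hn := new h a1
      have := push_rel (Rel.cons (v := v) hcfg hrel) h (ad_zero (h.put a1))
      rw [← hn.2] at this
      exact ⟨Rel.cons hn.1 this.1, this.2⟩

theorem slide_cons (d c : Cell) (l : List Cell) : slide d (c :: l) = (sl d c).1 :: slide (sl d c).2 l := by
  simp only [slide, sl]; split <;> rfl

theorem outs_rel (w : List ℕ) : ∀ {L1 L2 : List Lab} {s : Sh} {d D : Cell}, Rel s d L1 L2 D → Ok s →
    slide D (outs (put s d) L1 w) = outs s L2 w := by
  induction w with
  | nil => intros; rfl
  | cons x w ih =>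
    intro L1 L2 s d D hr h
    have := stepW_rel x hr h
    simp only [outs, slide_cons]
    rw [this.2, ih this.1 h]

theorem slide_Pw {s : Sh} {d : Cell} (h : Ok s) (hd : Ad s d) (w : List ℕ) :
    slide d (Pw (put s d) w) = Pw s w :=
  outs_rel w (Rel.nil hd) h

end CD

namespace CD

/-- Invariant of the distinguished first label. -/
def J (M : ℕ) (s : Sh) (q : Cell) (m : Bool) (k : ℕ) : Prop :=
  (q.1 = 0 ∧ (m = false ∨ q = (0, 0))) ∨
  (m = true ∧ q.2 = M ∧ q.1 + k < M ∧ ∀ a, M ≤ s.R a)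

theorem J.mono {M s q m k k'} (h : J M s q m k) (hk : k' ≤ k) : J M s q m k' := by
  rcases h with h | ⟨h1, h2, h3, h4⟩
  · exact Or.inl h
  · exact Or.inr ⟨h1, h2, by omega, h4⟩

theorem J.put {M s q m k c} (h : J M s q m k) (hc : Ad s c) : J M (put s c) q m k := by
  rcases h with h | ⟨h1, h2, h3, h4⟩
  · exact Or.inl h
  · refine Or.inr ⟨h1, h2, h3, fun a => ?_⟩
    have := h4 a
    have h5 := hc.1
    simp only [CD.put]
    split
    · rename_i e; subst e; omega
    · exact this

theorem J.step {M s q m k} (h : J M s q m (k+1)) (hok : Ok s) (hq : Ad s q) :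
    adj q (nxt (CD.put s q) q m).1 ∧
      J M (CD.put s q) (nxt (CD.put s q) q m).1 (nxt (CD.put s q) q m).2 k := by
  have hJ := h.put hq
  have hok' := hok.put hq
  obtain ⟨a, b⟩ := q
  rcases h with ⟨h1, h2⟩ | ⟨h1, h2, h3, h4⟩
  · simp only at h1; subst h1
    have hm : ¬ (m = true ∧ (0, b).1 ≠ (0, b).2) := by
      rcases h2 with rfl | h2
      · simp
      · rw [Prod.mk.injEq] at h2; simp [h2.2]
    have e : nxt (CD.put s (0, b)) (0, b) m = ((0, b+1), false) := by
      unfold nxt; rw [if_neg hm]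
      have : (CD.put s (0, b)).C (b+1) = 0 := by
        have := hok'.mem 0 (b+1) (by omega)
        have h5 : (CD.put s (0, b)).R 0 = b + 1 := by simp [CD.put]
        omega
      simp [this]
    rw [e]
    exact ⟨Or.inl ⟨rfl, rfl⟩, Or.inl ⟨rfl, Or.inl rfl⟩⟩
  · simp only at h2 h3; subst h2 h1
    have hm : (true = true ∧ (a, b).1 ≠ (a, b).2) := by simp; omega
    have e : nxt (CD.put s (a, b)) (a, b) true = ((a+1, b), true) := by
      unfold nxt; rw [if_pos hm]
      have : (CD.put s (a, b)).R (a+1) = b := by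
        have h6 := hok'.mem (a+1) b (by omega)
        have h5 : (CD.put s (a, b)).C b = a + 1 := by simp [CD.put]
        have h7 : (CD.put s (a, b)).R (a+1) = s.R (a+1) := by simp [CD.put]
        have := h4 (a+1)
        omega
      simp [this]
    rw [e]
    refine ⟨Or.inr ⟨rfl, rfl⟩, Or.inr ⟨rfl, rfl, by simp only; omega, ?_⟩⟩
    rcases hJ with ⟨h8, h9⟩ | h8
    · simp at h8 h9; intro z; have := h4 z; simp only [CD.put]; split <;> omega
    · exact h8.2.2.2

inductive RelF (M x k : ℕ) : Sh → List Lab → List Lab → Cell → Prop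
  | base {s q m B1 B2 D} : J M s q m k → Ad s q → Rel s q B1 B2 D → (∀ l ∈ B2, x ≤ l.v) →
      RelF M x k s (⟨x, q, m⟩ :: B1) B2 D
  | cons {s l L1 L2 D} : Ad s l.p → l.v ≤ x → RelF M x k (put s l.p) L1 L2 D →
      RelF M x k s (l :: L1) (l :: L2) D

theorem RelF.mono {M x k k' s L1 L2 D} (h : RelF M x k s L1 L2 D) (hk : k' ≤ k) :
    RelF M x k' s L1 L2 D := by
  induction h with
  | base h1 h2 h3 h4 => exact RelF.base (h1.mono hk) h2 h3 h4
  | cons h1 h2 _ ih => exact RelF.cons h1 h2 ih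

theorem push_vals (L : List Lab) : ∀ s c, (push s c L).1.map Lab.v = L.map Lab.v := by
  induction L with
  | nil => intros; rfl
  | cons l L ih => intro s c; obtain ⟨v, q, m⟩ := l; rw [push_cons]; simp [ih]

theorem stepW_vals (x : ℕ) (L : List Lab) : ∀ s v, v ∈ (stepW s x L).1.map Lab.v ↔
    v = x ∨ v ∈ L.map Lab.v := by
  induction L with
  | nil => intro s v; simp [stepW]
  | cons l L ih =>
    intro s v
    simp only [stepW]
    split
    · simp only [List.map_cons, List.mem_cons, ih]; tauto
    · simp only [List.map_cons, List.mem_cons, push_vals]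

theorem relF_push {M x k s L1 L2 D} (hr : RelF M x (k+1) s L1 L2 D) :
    ∀ {c}, Ok s → Ad s c →
    RelF M x k (put s c) (push s c L1).1 (push s c L2).1 (sl D (push s c L1).2).2 ∧
    (push s c L2).2 = (sl D (push s c L1).2).1 := by
  induction hr with
  | @base s q m B1 B2 D h1 h2 h3 h4 =>
    intro c h hc
    have hvals : ∀ l ∈ (push s c B2).1, x ≤ l.v := by
      intro l hl
      have : l.v ∈ (push s c B2).1.map Lab.v := List.mem_map_of_mem hl
      rw [push_vals] at this
      obtain ⟨l', hl', e⟩ := List.mem_map.1 this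
      rw [← e]; exact h4 l' hl'
    rw [push_cons]
    have hl := lab1_ad (m := m) h hc h2
    have key : sl q (lab1 s c q m).2 = (c, (lab1 s c q m).1.1) ∧
        J M (put s c) (lab1 s c q m).1.1 (lab1 s c q m).1.2 k := by
      unfold lab1
      split
      · rename_i e; subst e
        have := h1.step h hc
        simp only [sl, this.1, if_true]
        exact ⟨trivial, this.2⟩
      · rename_i e
        have := ad_ne h2 hc (Ne.symm e)
        simp only [sl, nadj_of_ne this, if_false]
        exact ⟨trivial, (h1.put hc).mono (by omega)⟩
    have := push_rel h3 (e := (lab1 s c q m).2) h hl.1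
    rw [key.1] at this
    simp only at this
    exact ⟨RelF.base key.2 hl.2.1 this.1 hvals, this.2⟩
  | @cons s l L1 L2 D h1 h2 h3 ih =>
    intro c h hc
    obtain ⟨v, q, m⟩ := l
    rw [push_cons, push_cons]
    have hl := lab1_ad (m := m) h hc h1
    have := ih (h.put h1) hl.1
    simp only at this
    rw [← hl.2.2] at this
    exact ⟨RelF.cons hl.2.1 h2 this.1, this.2⟩

theorem relF_stepW {M x k s L1 L2 D} (y : ℕ) (hr : RelF M x (k+1) s L1 L2 D) (h : Ok s) :
    RelF M x k s (stepW s y L1).1 (stepW s y L2).1 (sl D (stepW s y L1).2).2 ∧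
    (stepW s y L2).2 = (sl D (stepW s y L1).2).1 := by
  induction hr with
  | @base s q m B1 B2 D h1 h2 h3 h4 =>
    have hb := RelF.base h1 h2 h3 h4
    simp only [stepW]
    split
    · rename_i hxy
      have := stepW_rel y h3 h
      refine ⟨RelF.base (h1.mono (by omega)) h2 this.1 ?_, this.2⟩
      intro l hl
      have : l.v ∈ (stepW s y B2).1.map Lab.v := List.mem_map_of_mem hl
      rw [stepW_vals] at this
      rcases this with e | this
      · omega
      · obtain ⟨l', hl', e⟩ := List.mem_map.1 this
        rw [← e]; exact h4 l' hl'
    · rename_i hxy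
      have e2 : stepW s y B2 = (⟨y, (0, s.R 0), true⟩ :: (push s (0, s.R 0) B2).1,
          (push s (0, s.R 0) B2).2) := by
        cases B2 with
        | nil => simp [stepW, push]
        | cons l B2 =>
          have := h4 l (by simp)
          simp only [stepW]; rw [if_neg (by omega)]
      rw [e2]
      have := relF_push hb h (ad_zero h)
      exact ⟨RelF.cons (ad_zero h) (by simp only; omega) this.1, this.2⟩
  | @cons s l L1 L2 D h1 h2 h3 ih =>
    simp only [stepW]
    split
    · have := ih (h.put h1)
      exact ⟨RelF.cons h1 h2 this.1, this.2⟩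
    · have := relF_push (RelF.cons h1 h2 h3) h (ad_zero h)
      exact ⟨RelF.cons (ad_zero h) (by simp only; omega) this.1, this.2⟩

theorem outs_relF (w : List ℕ) : ∀ {M x s L1 L2 D}, RelF M x w.length s L1 L2 D → Ok s →
    slide D (outs s L1 w) = outs s L2 w := by
  induction w with
  | nil => intros; rfl
  | cons y w ih =>
    intro M x s L1 L2 D hr h
    have := relF_stepW y hr h
    simp only [outs, slide_cons]
    rw [this.2, ih this.1 h]

theorem Pw_cons (s : Sh) (x : ℕ) (w : List ℕ) :
    Pw s (x :: w) = (0, s.R 0) :: outs s [⟨x, (0, s.R 0), true⟩] w := by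
  simp [Pw, outs, stepW]

theorem slide_first {M s} (h : Ok s) (x : ℕ) (w : List ℕ) (hJ : J M s (0, s.R 0) true w.length) :
    slide (0, s.R 0) (outs s [⟨x, (0, s.R 0), true⟩] w) = Pw s w :=
  outs_relF w (M := M) (x := x)
    (RelF.base hJ (ad_zero h) (Rel.nil (ad_zero h)) (by simp)) h

/-- empty shape -/
def em : Sh := ⟨fun a => a, fun _ => 0⟩

theorem em_ok : Ok em := ⟨fun a => le_rfl, fun b => by simp [em], fun a b h => by simp [em]; omega⟩

def dl (M : ℕ) : Sh := ⟨fun a => max M a, fun b => if b < M then b + 1 else 0⟩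

theorem dl_ok (M : ℕ) : Ok (dl M) := by
  refine ⟨fun a => by simp [dl], fun b => ?_, fun a b h => ?_⟩
  · simp only [dl]; split <;> omega
  · simp only [dl]; split <;> omega

theorem slide_first_em (x : ℕ) (w : List ℕ) :
    slide (0, 0) (outs em [⟨x, (0, 0), true⟩] w) = Pw em w :=
  slide_first (M := 0) em_ok x w (Or.inl ⟨rfl, Or.inr rfl⟩)

theorem slide_first_dl (M x : ℕ) (w : List ℕ) (hw : w.length < M) :
    slide (0, M) (outs (dl M) [⟨x, (0, M), true⟩] w) = Pw (dl M) w := by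
  have h0 : (dl M).R 0 = M := by simp [dl]
  have := slide_first (M := M) (dl_ok M) x w (Or.inr ⟨rfl, h0, by simpa using hw, by simp [dl]⟩)
  rwa [h0] at this

end CD

namespace CD

/-- relation between labels of equal value -/
def Bx (p : Cell) (m : Bool) (p' : Cell) (m' : Bool) : Prop :=
  (m = true ∧ m' = true ∧ p.2 < p'.2 ∧ p'.1 ≤ p.1) ∨
  (m = false ∧ m' = false ∧ p.1 < p'.1 ∧ p'.2 ≤ p.2) ∨
  (m = false ∧ m' = true)

def RB (l l' : Lab) : Prop := l.v < l'.v ∨ (l.v = l'.v ∧ Bx l.p l.m l'.p l'.m)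

theorem Bx.trans {p m p' m' p'' m''} (h : Bx p m p' m') (h' : Bx p' m' p'' m'') :
    Bx p m p'' m'' := by
  unfold Bx at *
  rcases h with ⟨rfl, rfl, h⟩ | ⟨rfl, rfl, h⟩ | ⟨rfl, rfl⟩ <;>
  rcases h' with ⟨h1, rfl, h'⟩ | ⟨h1, rfl, h'⟩ | ⟨h1, rfl⟩ <;> simp_all <;> omega

theorem RB.trans {l l' l'' : Lab} (h : RB l l') (h' : RB l' l'') : RB l l'' := by
  rcases h with h | ⟨h, h1⟩ <;> rcases h' with h' | ⟨h', h1'⟩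
  · left; omega
  · left; omega
  · left; omega
  · right; exact ⟨by omega, h1.trans h1'⟩

theorem nxt_row {s : Sh} {a b : ℕ} (h : a ≠ b) :
    nxt s (a, b) true = ((a+1, s.R (a+1)), true) := by
  unfold nxt; rw [if_pos ⟨rfl, h⟩]
theorem nxt_diag {s : Sh} {a : ℕ} (m : Bool) :
    nxt s (a, a) m = ((s.C (a+1), a+1), false) := by
  unfold nxt; rw [if_neg (by simp)]
theorem nxt_col {s : Sh} {p : Cell} :
    nxt s p false = ((s.C (p.2+1), p.2+1), false) := by
  unfold nxt; rw [if_neg (by simp)]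

theorem put_R_self (s : Sh) (c : Cell) : (put s c).R c.1 = c.2 + 1 := by simp [put]
theorem put_C_self (s : Sh) (c : Cell) : (put s c).C c.2 = c.1 + 1 := by simp [put]
theorem put_R_ne (s : Sh) {c : Cell} {a : ℕ} (h : a ≠ c.1) : (put s c).R a = s.R a := by
  simp [put, h]
theorem put_C_ne (s : Sh) {c : Cell} {a : ℕ} (h : a ≠ c.2) : (put s c).C a = s.C a := by
  simp [put, h]

/-- rows of `Ok` shapes are antitone in the relevant sense -/
theorem Ok.anti {s : Sh} (h : Ok s) {a a' b : ℕ} (h1 : a ≤ a') (h2 : a' ≤ b) (h3 : b < s.R a') :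
    b < s.R a := by
  have := h.mem a b (by omega)
  have := h.mem a' b (by omega)
  omega

/-- hit label row: bounds for the new cell -/
theorem row_le {s : Sh} (h : Ok s) {a b : ℕ} (hp : Ad s (a, b)) (hne : a ≠ b) :
    s.R (a+1) ≤ b := by
  have h1 := h.mem (a+1) b
  have h2 := Ad.le h hp
  obtain ⟨h3, h4⟩ := hp
  simp only at *
  have := h1 (by omega); omega

theorem col_le {s : Sh} (h : Ok s) {a b : ℕ} (hp : Ad s (a, b)) : s.C (b+1) ≤ a := by
  have h1 := h.mem a (b+1)
  have h2 := Ad.le h hp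
  obtain ⟨h3, h4⟩ := hp
  simp only at *
  have := h1 (by omega); omega

theorem box_local {s : Sh} (h : Ok s) {c p p' : Cell} {m m' : Bool} (hc : Ad s c) (hp : Ad s p)
    (hp' : Ad (put s p) p') (hB : Bx p m p' m') :
    Bx (lab1 s c p m).1.1 (lab1 s c p m).1.2
      (lab1 (put s p) (lab1 s c p m).2 p' m').1.1 (lab1 (put s p) (lab1 s c p m).2 p' m').1.2 := by
  have hok := h.put hp
  by_cases hcp : c = p
  · subst hcp
    obtain ⟨a, b⟩ := c
    obtain ⟨a', b'⟩ := p'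
    have hle := Ad.le h hp
    have hle' := Ad.le hok hp'
    have hcl := col_le h hp
    have eC : (put s (a, b)).C (b+1) = s.C (b+1) := put_C_ne _ (by simp)
    have eR : (put s (a, b)).R (a+1) = s.R (a+1) := put_R_ne _ (by simp)
    simp only at hle hle'
    rcases hB with ⟨rfl, rfl, h1, h2⟩ | ⟨rfl, rfl, h1, h2⟩ | ⟨rfl, rfl⟩
    · simp only at h1 h2
      by_cases hd : a = b
      · subst hd
        simp only [lab1, if_true, nxt_diag]
        split
        · rename_i e; rw [Prod.mk.injEq] at e
          rw [nxt_row (by omega)]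
          right; right; simp
        · right; right; simp
      · have hrl := row_le h hp hd
        simp only [lab1, if_true, nxt_row hd]
        rw [if_neg (by simp only [Prod.mk.injEq]; omega)]
        left; simp only [eR, true_and]; omega
    · simp only at h1 h2
      simp only [lab1, if_true, nxt_col]
      rw [if_neg (by simp only [Prod.mk.injEq]; omega)]
      right; left; simp only [eC, true_and]; omega
    · simp only [lab1, if_true, nxt_col]
      split
      · rename_i e; rw [Prod.mk.injEq] at e
        rw [nxt_row (by omega)]
        right; right; simp
      · right; right; simp
  · have hne := ad_ne hc hp hcp
    have hbase : lab1 s c p m = ((p, m), c) := by simp [lab1, hcp]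
    simp only [hbase]
    by_cases hcp' : c = p'
    · subst hcp'
      have hok2 := hok.put hp'
      obtain ⟨a, b⟩ := p
      obtain ⟨a', b'⟩ := c
      have hle := Ad.le h hp
      have hle' := Ad.le hok hp'
      simp only at hle hle' hne
      simp only [lab1, if_true]
      rcases hB with ⟨rfl, rfl, h1, h2⟩ | ⟨rfl, rfl, h1, h2⟩ | ⟨rfl, rfl⟩
      · simp only at h1 h2
        rw [nxt_row (by omega)]
        left; simp only [true_and]
        refine ⟨?_, by omega⟩
        rw [put_R_ne _ (by simp)]
        have hR : (put s (a, b)).R a = b + 1 := put_R_self s (a, b)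
        exact hok.anti (a := a'+1) (a' := a) (by omega) (by omega) (by omega)
      · simp only at h1 h2
        rw [nxt_col]
        right; left; simp only [true_and]
        refine ⟨?_, by omega⟩
        rw [put_C_ne _ (by simp)]
        have hR : (put s (a, b)).R a = b + 1 := put_R_self s (a, b)
        have := (hok.mem a (b'+1) (by omega)).1 (by omega)
        exact this
      · by_cases hd : a' = b'
        · subst hd
          rw [nxt_diag]
          right; left; simp only [true_and]
          have hR : (put s (a, b)).R a = b + 1 := put_R_self s (a, b)
          obtain ⟨c1, c2⟩ := hc
          obtain ⟨d1, d2⟩ := hp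
          simp only at c1 c2 d1 d2
          have k1 := h.mem a' b
          have k2 := h.mem a' a'  le_rfl
          have k3 := h.mem a b hle
          have k4 := h.mem a a'
          have k6 := h.mem b a'
          have k7 := h.mem b b le_rfl
          have hab : a < a' ∧ a' < b := by
            by_contra hcon
            by_cases hba : b < a'
            · have := k6 (by omega); omega
            · have := k1 (by omega)
              omega
          refine ⟨?_, by omega⟩
          rw [put_C_ne _ (by simp)]
          have := (hok.mem a (a'+1) (by omega)).1 (by omega)
          exact this
        · rw [nxt_row hd]
          right; right; simp
    · simp only [lab1, hcp', if_false]
      exact hB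

theorem push_box (L : List Lab) : ∀ {s : Sh} {c : Cell}, Ok s → Ad s c → LV s L →
    L.IsChain RB → (push s c L).1.IsChain RB := by
  induction L with
  | nil => intros; simp [push]
  | cons l L ih =>
    intro s c h hc hL hB
    obtain ⟨v, q, m⟩ := l
    have hq : Ad s q := hL.1
    have hl := lab1_ad (m := m) h hc hq
    rw [push_cons]
    have ih' := ih (h.put hq) hl.1 hL.2 hB.tail
    cases L with
    | nil => simp [push]
    | cons l' L =>
      obtain ⟨v', q', m'⟩ := l'
      rw [push_cons] at ih' ⊢
      simp only at ih' ⊢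
      refine List.IsChain.cons_cons ?_ ih'
      have h1 : RB ⟨v, q, m⟩ ⟨v', q', m'⟩ := by
        rw [List.isChain_cons_cons] at hB; exact hB.1
      rcases h1 with h1 | ⟨h1, h2⟩
      · left; exact h1
      · right; exact ⟨h1, box_local h hc hq hL.2.1 h2⟩

theorem zero_col {s : Sh} (h : Ok s) {p : Cell} (hp : Ad s p) : p.2 < (put s p).R 0 := by
  have hok := h.put hp
  have hR : (put s p).R p.1 = p.2 + 1 := put_R_self s p
  exact hok.anti (a' := p.1) (by omega) (Ad.le h hp) (by omega)

theorem stepW_box (x : ℕ) (L : List Lab) : ∀ {s : Sh}, Ok s → LV s L →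
    L.IsChain RB → (stepW s x L).1.IsChain RB := by
  induction L with
  | nil => intros; simp [stepW]
  | cons l L ih =>
    intro s h hL hB
    have hl : Ad s l.p := hL.1
    simp only [stepW]
    split
    · rename_i hlx
      have ih' := ih (h.put hl) hL.2 hB.tail
      have hnew : ∀ l'' : Lab, l'' = ⟨x, (0, (put s l.p).R 0), true⟩ → RB l l'' := by
        rintro l'' rfl
        rcases Nat.lt_or_ge l.v x with h1 | h1
        · left; exact h1
        · right; refine ⟨by simp only; omega, ?_⟩
          have := zero_col h hl
          cases hm : l.m
          · right; right; simp
          · left; simp [this]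
      cases L with
      | nil =>
        simp only [stepW] at ih' ⊢
        exact List.IsChain.cons_cons (hnew _ rfl) ih'
      | cons l' L =>
        simp only [stepW] at ih' ⊢
        split at ih'
        · rename_i h1
          rw [if_pos h1] 
          rw [List.isChain_cons_cons] at hB
          exact List.IsChain.cons_cons hB.1 ih'
        · rename_i h1
          rw [if_neg h1] 
          exact List.IsChain.cons_cons (hnew _ rfl) ih'
    · rename_i hlx
      have h1 := push_box (l :: L) h (ad_zero h) hL hB
      obtain ⟨v, q, m⟩ := l
      rw [push_cons] at h1 ⊢
      refine List.IsChain.cons_cons ?_ h1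
      left; simp only at hlx ⊢; omega

instance : IsTrans Lab RB := ⟨fun _ _ _ => RB.trans⟩

theorem state_box (w : List ℕ) : ∀ {s : Sh} {L : List Lab}, Ok s → LV s L →
    L.IsChain RB → (state s L w).IsChain RB := by
  induction w with
  | nil => intro s L _ _ h; exact h
  | cons x w ih =>
    intro s L h hL hB
    exact ih h (stepW_valid x L s h hL).1 (stepW_box x L h hL hB)

end CD

namespace CD

def dropS (s : Sh) : Sh := ⟨fun a => s.R (a+1) - 1, fun b => s.C (b+1) - 1⟩
def dropC (c : Cell) : Cell := (c.1 - 1, c.2 - 1)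
def dropLab (l : Lab) : Option Lab := if l.p.1 = 0 then none else some ⟨l.v, dropC l.p, l.m⟩
def dropL (L : List Lab) : List Lab := L.filterMap dropLab

theorem dropL_cons0 {l : Lab} {L : List Lab} (h : l.p.1 = 0) : dropL (l :: L) = dropL L := by
  simp [dropL, dropLab, h]
theorem dropL_cons1 {l : Lab} {L : List Lab} (h : 1 ≤ l.p.1) :
    dropL (l :: L) = ⟨l.v, dropC l.p, l.m⟩ :: dropL L := by
  have : l.p.1 ≠ 0 := by omega
  simp [dropL, dropLab, this]

theorem dropS_put0 {s : Sh} {c : Cell} (hc : Ad s c) (h0 : c.1 = 0) : dropS (put s c) = dropS s := by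
  obtain ⟨a, b⟩ := c
  simp only at h0; subst h0
  have h2 : s.C b = 0 := hc.2
  simp only [dropS, put]
  congr 1
  funext x
  split
  · rename_i e; subst e; omega
  · rfl

theorem dropS_put1 {s : Sh} {c : Cell} (h0 : 1 ≤ c.1) (h1 : c.1 ≤ c.2) :
    dropS (put s c) = put (dropS s) (dropC c) := by
  obtain ⟨a, b⟩ := c
  simp only at h0 h1
  simp only [dropS, put]
  congr 1
  · funext x
    by_cases e : x + 1 = a
    · subst e; simp [dropC]; omega
    · have e' : ¬ x = a - 1 := by omega
      simp only [dropC, e, e', if_false]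
  · funext x
    by_cases e : x + 1 = b
    · subst e; simp [dropC]; omega
    · have e' : ¬ x = b - 1 := by omega
      simp only [dropC, e, e', if_false]

theorem dropS_ad {s : Sh} {c : Cell} (hc : Ad s c) (h0 : 1 ≤ c.1) (h1 : c.1 ≤ c.2) :
    Ad (dropS s) (dropC c) := by
  obtain ⟨a, b⟩ := c
  obtain ⟨h2, h3⟩ := hc
  simp only at *
  simp only [Ad, dropS, dropC]
  rw [show a - 1 + 1 = a by omega, show b - 1 + 1 = b by omega]
  omega

theorem dropS_ok {s : Sh} (h : Ok s) : Ok (dropS s) := by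
  refine ⟨fun a => ?_, fun b => ?_, fun a b hab => ?_⟩
  · have := h.r_ge (a+1); simp only [dropS]; omega
  · have := h.c_le (b+1); simp only [dropS]; omega
  · have := h.mem (a+1) (b+1) (by omega); simp only [dropS]; omega

theorem nxt_drop {s : Sh} {p : Cell} (m : Bool) (h0 : 1 ≤ p.1) (h1 : p.1 ≤ p.2)
    (h2 : 1 ≤ (nxt s p m).1.1) : nxt (dropS s) (dropC p) m = (dropC (nxt s p m).1, (nxt s p m).2) := by
  obtain ⟨a, b⟩ := p
  simp only at *
  unfold nxt at *
  by_cases hm : m = true ∧ a ≠ b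
  · rw [if_pos (by simp [dropC]; exact ⟨hm.1, by omega⟩), if_pos hm]
    simp only [dropC, dropS]
    rw [show a - 1 + 1 = a by omega]; rfl
  · rw [if_neg (by simp only [dropC]; rintro ⟨h, h'⟩; exact hm ⟨h, by omega⟩), if_neg hm]
    simp only [dropC, dropS]
    rw [show b - 1 + 1 = b by omega]; rfl

theorem dropC_inj {c d : Cell} (h1 : 1 ≤ c.1) (h2 : c.1 ≤ c.2) (h3 : 1 ≤ d.1) (h4 : d.1 ≤ d.2)
    (h : dropC c = dropC d) : c = d := by
  obtain ⟨a, b⟩ := c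
  obtain ⟨a', b'⟩ := d
  simp only [dropC, Prod.mk.injEq] at *
  omega

def NoRet : Sh → Cell → List Lab → Prop
  | _, _, [] => True
  | s, c, l :: L => 1 ≤ (lab1 s c l.p l.m).2.1 ∧ NoRet (put s l.p) (lab1 s c l.p l.m).2 L

theorem push_drop (L : List Lab) : ∀ {s : Sh} {c : Cell}, Ok s → LV s L → Ad s c → 1 ≤ c.1 →
    NoRet s c L → dropL (push s c L).1 = (push (dropS s) (dropC c) (dropL L)).1 ∧
      dropC (push s c L).2 = (push (dropS s) (dropC c) (dropL L)).2 ∧ 1 ≤ (push s c L).2.1 := by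
  induction L with
  | nil => intro s c _ _ _ hc _; exact ⟨rfl, rfl, hc⟩
  | cons l L ih =>
    intro s c h hL hc hc1 hN
    obtain ⟨v, q, m⟩ := l
    have hq : Ad s q := hL.1
    obtain ⟨hN1, hN2⟩ := hN
    have hl := lab1_ad (m := m) h hc hq
    have := ih (h.put hq) hL.2 hl.1 hN1 hN2
    rw [push_cons]
    simp only at hN1 this ⊢
    have hcle := Ad.le h hc
    have hqle := Ad.le h hq
    by_cases h0 : q.1 = 0
    · have hcq : c ≠ q := by rintro rfl; omega
      have e : lab1 s c q m = ((q, m), c) := by simp [lab1, hcq]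
      rw [e] at this ⊢
      rw [dropL_cons0 (l := ⟨v, q, m⟩) h0, dropL_cons0 (l := ⟨v, q, m⟩) h0, ← dropS_put0 hq h0]
      exact this
    · have h1 : 1 ≤ q.1 := by omega
      rw [dropL_cons1 (l := ⟨v, q, m⟩) h1, push_cons]
      rw [dropS_put1 h1 hqle] at this
      by_cases hcq : c = q
      · subst hcq
        have e : lab1 s c c m = (nxt (put s c) c m, (nxt (put s c) c m).1) := by simp [lab1]
        have e2 : lab1 (dropS s) (dropC c) (dropC c) m = (nxt (put (dropS s) (dropC c)) (dropC c) m,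
          (nxt (put (dropS s) (dropC c)) (dropC c) m).1) := by simp [lab1]
        rw [e] at this hN1
        have e3 := nxt_drop (s := put s c) m h1 hqle hN1
        rw [dropS_put1 h1 hqle] at e3
        rw [e, e2, e3, dropL_cons1 (by exact hN1)]
        simp only at this ⊢
        rw [this.1, this.2.1]
        exact ⟨rfl, rfl, this.2.2⟩
      · have hcq' : dropC c ≠ dropC q := fun hh => hcq (dropC_inj hc1 hcle h1 hqle hh)
        have e : lab1 s c q m = ((q, m), c) := by simp [lab1, hcq]
        have e2 : lab1 (dropS s) (dropC c) (dropC q) m = ((dropC q, m), dropC c) := by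
          simp [lab1, hcq']
        rw [e] at this
        rw [e, e2, dropL_cons1 (by exact h1)]
        simp only at this ⊢
        rw [this.1, this.2.1]
        exact ⟨rfl, rfl, this.2.2⟩

/-- a row-`0` label that drops when hit -/
def Free (l : Lab) : Prop := l.p.1 = 0 ∧ l.m = true ∧ l.p.2 ≠ 0

instance (l : Lab) : Decidable (Free l) := by unfold Free; infer_instance

def emit (x : ℕ) : List Lab → Option ℕ
  | [] => none
  | l :: L => if x < l.v ∧ Free l then some l.v else emit x L

def NR : Sh → List Lab → Prop
  | _, [] => True
  | s, l :: L => (Free l → ∀ e, Ad (put s l.p) e → 1 ≤ e.1 → NoRet (put s l.p) e L) ∧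
      NR (put s l.p) L

def EmitSpec (s : Sh) (L : List Lab) (r : List Lab × Cell) : Option ℕ → Prop
  | none => dropL r.1 = dropL L ∧ r.2.1 = 0
  | some v => dropL r.1 = (stepW (dropS s) v (dropL L)).1 ∧
      dropC r.2 = (stepW (dropS s) v (dropL L)).2 ∧ 1 ≤ r.2.1

theorem emit_lt {x v : ℕ} {L : List Lab} : emit x L = some v → ∃ l ∈ L, l.v = v ∧ x < v ∧ Free l := by
  induction L with
  | nil => simp [emit]
  | cons l L ih =>
    simp only [emit]
    split
    · rename_i h; intro e; simp at e; exact ⟨l, by simp, e, by omega, h.2⟩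
    · intro e; obtain ⟨l', h1, h2⟩ := ih e; exact ⟨l', by simp [h1], h2⟩

theorem emit_none {x : ℕ} {L : List Lab} : emit x L = none → ∀ l ∈ L, x < l.v → ¬ Free l := by
  induction L with
  | nil => simp
  | cons l L ih =>
    simp only [emit]
    split
    · simp
    · rename_i h; intro e l' hl'
      rcases List.mem_cons.1 hl' with rfl | hl'
      · tauto
      · exact ih e l' hl'

theorem push_row0 (x : ℕ) (L : List Lab) : ∀ {s : Sh}, Ok s → LV s L → L.IsChain RB → NR s L →
    (∀ l ∈ L, x < l.v) → EmitSpec s L (push s (0, s.R 0) L) (emit x L) := by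
  induction L with
  | nil => intro s _ _ _ _ _; exact ⟨rfl, rfl⟩
  | cons l L ih =>
    intro s h hL hB hN hx
    obtain ⟨v, q, m⟩ := l
    have hq : Ad s q := hL.1
    have hqle := Ad.le h hq
    have hxv : x < v := hx _ List.mem_cons_self
    have hpw := (List.isChain_iff_pairwise.1 hB)
    rw [List.pairwise_cons] at hpw
    have ih' := ih (h.put hq) hL.2 hB.tail hN.2 (fun l hl => hx l (List.mem_cons_of_mem _ hl))
    rw [push_cons]
    by_cases h0 : q.1 = 0
    · have hq' : q = (0, s.R 0) := by
        obtain ⟨a, b⟩ := q; simp only at h0; subst h0; have h9 : s.R 0 = b := hq.1; rw [h9]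
      have e : lab1 s (0, s.R 0) q m = (nxt (put s q) q m, (nxt (put s q) q m).1) := by
        simp [lab1, ← hq']
      rw [e]
      by_cases hf : Free ⟨v, q, m⟩
      · have e2 : nxt (put s q) q m = ((1, (put s q).R 1), true) := by
          obtain ⟨_, hf2, hf3⟩ := hf
          obtain ⟨a, b⟩ := q
          simp only at h0 hf2 hf3; subst h0 hf2
          rw [nxt_row (Ne.symm hf3)]
        have e3 : emit x (⟨v, q, m⟩ :: L) = some v := by
          simp only [emit]; rw [if_pos ⟨hxv, hf⟩]
        have had := nxt_ad h hq m
        rw [e2] at had ⊢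
        rw [e3]
        have hN' := hN.1 hf _ had le_rfl
        have hp := push_drop L (h.put hq) hL.2 had le_rfl hN'
        rw [dropS_put0 hq h0] at hp
        have hd : dropL (⟨v, q, m⟩ :: L) = dropL L := dropL_cons0 h0
        have hc : dropC (1, (put s q).R 1) = (0, (dropS s).R 0) := by
          rw [← dropS_put0 hq h0]; simp [dropC, dropS]
        have hs : stepW (dropS s) v (dropL L) = (⟨v, (0, (dropS s).R 0), true⟩ ::
            (push (dropS s) (0, (dropS s).R 0) (dropL L)).1,
            (push (dropS s) (0, (dropS s).R 0) (dropL L)).2) := by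
          have hgt : ∀ l ∈ dropL L, v < l.v := by
            intro l hl
            obtain ⟨l', hl', e'⟩ := List.mem_filterMap.1 hl
            unfold dropLab at e'
            split at e'
            · simp at e'
            · rename_i hl0
              simp only [Option.some.injEq] at e'
              subst e'
              simp only
              rcases hpw.1 l' hl' with h1 | ⟨h1, h2⟩
              · exact h1
              · exfalso
                obtain ⟨_, hf2, _⟩ := hf
                simp only at hf2
                subst hf2
                simp [Bx] at h2
                omega
          cases hdl : dropL L with
          | nil => simp [stepW, push]
          | cons l' L' =>
            have := hgt l' (by rw [hdl]; simp)
            simp only [stepW]; rw [if_neg (by omega)]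
        simp only [EmitSpec]
        rw [hd, hs, dropL_cons1 (l := ⟨v, (1, (put s q).R 1), true⟩) le_rfl]
        simp only
        rw [hp.1, hp.2.1, hc]
        exact ⟨rfl, rfl, hp.2.2⟩
      · have e2 : nxt (put s q) q m = ((0, (put s q).R 0), false) := by
          obtain ⟨a, b⟩ := q
          simp only at h0; subst h0
          have hR : (put s (0, b)).R 0 = b + 1 := put_R_self s (0, b)
          have hC : (put s (0, b)).C (b+1) = 0 := by
            have := (h.put hq).mem 0 (b+1) (by omega); omega
          unfold nxt; rw [if_neg]
          · simp only [hC, hR]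
          · rintro ⟨hm, hb⟩; exact hf ⟨rfl, hm, fun hh => hb hh.symm⟩
        have e3 : emit x (⟨v, q, m⟩ :: L) = emit x L := by
          simp only [emit]; rw [if_neg (fun hh => hf hh.2)]
        rw [e2, e3]
        have hd : dropL (⟨v, q, m⟩ :: L) = dropL L := dropL_cons0 h0
        cases hem : emit x L with
        | none =>
          rw [hem] at ih'
          simp only [EmitSpec] at ih' ⊢
          rw [hd, dropL_cons0 rfl]; exact ih'
        | some u =>
          rw [hem] at ih'
          simp only [EmitSpec] at ih' ⊢
          rw [hd, dropL_cons0 rfl, ← dropS_put0 hq h0]; exact ih'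
    · have hcq : (0, s.R 0) ≠ q := by rintro rfl; exact h0 rfl
      have e : lab1 s (0, s.R 0) q m = ((q, m), (0, s.R 0)) := by simp [lab1, hcq]
      have e3 : emit x (⟨v, q, m⟩ :: L) = emit x L := by
        simp only [emit]; rw [if_neg (fun hh => h0 hh.2.1)]
      have hR : (put s q).R 0 = s.R 0 := put_R_ne _ (Ne.symm h0)
      have h1 : 1 ≤ q.1 := by omega
      rw [e, e3]
      rw [hR] at ih'
      have hd : ∀ L', dropL (⟨v, q, m⟩ :: L') = ⟨v, dropC q, m⟩ :: dropL L' :=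
        fun L' => dropL_cons1 h1
      cases hem : emit x L with
      | none =>
        rw [hem] at ih'
        simp only [EmitSpec] at ih' ⊢
        rw [hd, hd, ih'.1]; exact ⟨rfl, ih'.2⟩
      | some u =>
        rw [hem] at ih'
        simp only [EmitSpec] at ih' ⊢
        obtain ⟨l', hl', rfl, _⟩ := emit_lt hem
        have hle : v ≤ l'.v := by
          rcases hpw.1 l' hl' with h1 | ⟨h1, _⟩
          · exact le_of_lt h1
          · exact le_of_eq h1
        rw [hd, hd]
        simp only [stepW]
        rw [if_pos hle, ← dropS_put1 h1 hqle, ih'.1]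
        exact ⟨rfl, ih'.2⟩

theorem stepW_row0 (x : ℕ) (L : List Lab) : ∀ {s : Sh}, Ok s → LV s L → L.IsChain RB → NR s L →
    EmitSpec s L (stepW s x L) (emit x L) := by
  induction L with
  | nil => intro s _ _ _ _; exact ⟨by simp [stepW, dropL, dropLab], rfl⟩
  | cons l L ih =>
    intro s h hL hB hN
    have hq : Ad s l.p := hL.1
    have hpw := (List.isChain_iff_pairwise.1 hB)
    rw [List.pairwise_cons] at hpw
    have hmono : ∀ l' ∈ L, l.v ≤ l'.v := by
      intro l' hl'
      rcases hpw.1 l' hl' with h1 | ⟨h1, _⟩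
      · exact le_of_lt h1
      · exact le_of_eq h1
    simp only [stepW]
    split
    · rename_i hlx
      have ih' := ih (h.put hq) hL.2 hB.tail hN.2
      have e3 : emit x (l :: L) = emit x L := by
        simp only [emit]; rw [if_neg (by omega)]
      rw [e3]
      by_cases h0 : l.p.1 = 0
      · have hd : ∀ L', dropL (l :: L') = dropL L' := fun L' => dropL_cons0 h0
        cases hem : emit x L with
        | none =>
          rw [hem] at ih'
          simp only [EmitSpec] at ih' ⊢
          rw [hd, hd]; exact ih'
        | some u =>
          rw [hem] at ih'
          simp only [EmitSpec] at ih' ⊢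
          rw [hd, hd, ← dropS_put0 hq h0]; exact ih'
      · have h1 : 1 ≤ l.p.1 := by omega
        have hd : ∀ L', dropL (l :: L') = ⟨l.v, dropC l.p, l.m⟩ :: dropL L' :=
          fun L' => dropL_cons1 h1
        cases hem : emit x L with
        | none =>
          rw [hem] at ih'
          simp only [EmitSpec] at ih' ⊢
          rw [hd, hd, ih'.1]; exact ⟨rfl, ih'.2⟩
        | some u =>
          rw [hem] at ih'
          simp only [EmitSpec] at ih' ⊢
          obtain ⟨l', hl', rfl, hh⟩ := emit_lt hem
          rw [hd, hd]
          simp only [stepW]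
          rw [if_pos (by omega), ← dropS_put1 h1 (Ad.le h hq), ih'.1]
          exact ⟨rfl, ih'.2⟩
    · rename_i hlx
      have := push_row0 x (l :: L) h hL hB hN (by
        intro l' hl'
        rcases List.mem_cons.1 hl' with rfl | hl'
        · omega
        · have := hmono l' hl'; omega)
      cases hem : emit x (l :: L) with
      | none =>
        rw [hem] at this
        simp only [EmitSpec] at this ⊢
        rw [dropL_cons0 rfl]; exact this
      | some u =>
        rw [hem] at this
        simp only [EmitSpec] at this ⊢
        rw [dropL_cons0 rfl]; exact this

def emits (s : Sh) : List Lab → List ℕ → List ℕ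
  | _, [] => []
  | L, x :: w => (emit x L).toList ++ emits s (stepW s x L).1 w

def dropO (c : Cell) : Option Cell := if c.1 = 0 then none else some (dropC c)

theorem run_drop (w : List ℕ) : ∀ {s : Sh} {L : List Lab}, Ok s → LV s L → L.IsChain RB →
    (∀ u v, w = u ++ v → NR s (state s L u)) →
    dropL (state s L w) = state (dropS s) (dropL L) (emits s L w) ∧
    (outs s L w).filterMap dropO = outs (dropS s) (dropL L) (emits s L w) := by
  induction w with
  | nil => intro s L _ _ _ _; exact ⟨rfl, rfl⟩
  | cons x w ih =>
    intro s L h hL hB hN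
    have h1 := stepW_row0 x L h hL hB (hN [] _ rfl)
    have ih' := ih h (stepW_valid x L s h hL).1 (stepW_box x L h hL hB)
      (fun u v e => hN (x :: u) v (by rw [e]; rfl))
    simp only [state, outs, emits, List.filterMap_cons]
    cases hem : emit x L with
    | none =>
      rw [hem] at h1
      simp only [EmitSpec] at h1
      rw [h1.1] at ih'
      simp only [dropO, h1.2, if_true, Option.toList, List.nil_append]
      exact ih'
    | some u =>
      rw [hem] at h1
      simp only [EmitSpec] at h1
      rw [h1.1] at ih'
      have : (stepW s x L).2.1 ≠ 0 := by omega
      simp only [dropO, this, if_false, Option.toList, List.cons_append, List.nil_append, state, outs]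
      refine ⟨ih'.1, ?_⟩
      rw [h1.2.1]
      congr 1
      exact ih'.2

end CD

namespace CD

/-! delta case -/

def Dk (M k : ℕ) (s : Sh) : Prop := (∀ a, M ≤ s.R a) ∧ ∀ b, M ≤ b → s.C b ≤ k

theorem Dk.put {M k s c} (h : Dk M k s) (hc : Ad s c) : Dk M (k+1) (put s c) := by
  obtain ⟨h1, h2⟩ := h
  obtain ⟨h3, h4⟩ := hc
  have h5 := h1 c.1
  have h6 := h2 c.2 (by omega)
  refine ⟨fun a => ?_, fun b hb => ?_⟩
  · have := h1 a; simp only [CD.put]; split <;> omega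
  · have := h2 b hb; simp only [CD.put]; split <;> omega

theorem dk_dl (M : ℕ) : Dk M 0 (dl M) := by
  refine ⟨fun a => by simp [dl], fun b hb => ?_⟩
  simp only [dl]; rw [if_neg (by omega)]

theorem dk_nd {M : ℕ} (L : List Cell) : ∀ {k s}, Dk M k s → Valid s L → k + L.length ≤ M →
    ∀ c ∈ L, c.1 < M ∧ M ≤ c.2 := by
  induction L with
  | nil => simp
  | cons d L ih =>
    intro k s h hL hk c hc
    simp only [List.length_cons] at hk
    rcases List.mem_cons.1 hc with rfl | hc
    · have h1 := h.1 c.1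
      obtain ⟨h3, h4⟩ := hL.1
      have h2 := h.2 c.2 (by omega)
      omega
    · exact ih (h.put hL.1) hL.2 (by omega) c hc

theorem push_true (L : List Lab) : ∀ {s c}, (∀ l ∈ L, l.m = true ∧ l.p.1 ≠ l.p.2) →
    ∀ l ∈ (push s c L).1, l.m = true := by
  induction L with
  | nil => simp [push]
  | cons l L ih =>
    intro s c h l' hl'
    obtain ⟨v, ⟨a, b⟩, m⟩ := l
    obtain ⟨h1, h2⟩ := h _ List.mem_cons_self
    simp only at h1 h2; subst h1
    rw [push_cons] at hl'
    rcases List.mem_cons.1 hl' with rfl | hl'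
    · simp only [lab1]
      split
      · rw [nxt_row h2]
      · rfl
    · exact ih (fun l hl => h l (List.mem_cons_of_mem _ hl)) l' hl'

theorem stepW_true (x : ℕ) (L : List Lab) : ∀ {s}, (∀ l ∈ L, l.m = true ∧ l.p.1 ≠ l.p.2) →
    ∀ l ∈ (stepW s x L).1, l.m = true := by
  induction L with
  | nil => simp [stepW]
  | cons l L ih =>
    intro s h l' hl'
    simp only [stepW] at hl'
    split at hl'
    · rcases List.mem_cons.1 hl' with rfl | hl'
      · exact (h _ List.mem_cons_self).1
      · exact ih (fun l hl => h l (List.mem_cons_of_mem _ hl)) l' hl'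
    · rcases List.mem_cons.1 hl' with rfl | hl'
      · rfl
      · exact push_true _ h l' hl'

theorem noRet_true (L : List Lab) : ∀ {s c}, (∀ l ∈ L, l.m = true ∧ l.p.1 ≠ l.p.2) → 1 ≤ c.1 →
    NoRet s c L := by
  induction L with
  | nil => intros; trivial
  | cons l L ih =>
    intro s c h hc
    obtain ⟨v, ⟨a, b⟩, m⟩ := l
    obtain ⟨h1, h2⟩ := h _ List.mem_cons_self
    simp only at h1 h2; subst h1
    have : 1 ≤ (lab1 s c (a,b) true).2.1 := by
      unfold lab1; split
      · rw [nxt_row h2]; simp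
      · exact hc
    exact ⟨this, ih (fun l hl => h l (List.mem_cons_of_mem _ hl)) this⟩

theorem nr_true (L : List Lab) : ∀ {s}, (∀ l ∈ L, l.m = true ∧ l.p.1 ≠ l.p.2) → NR s L := by
  induction L with
  | nil => intros; trivial
  | cons l L ih =>
    intro s h
    have h' := fun l hl => h l (List.mem_cons_of_mem _ hl)
    exact ⟨fun _ e _ he => noRet_true L h' he, ih h'⟩

theorem stepW_count (x y : ℕ) (L : List Lab) : ∀ s, ((stepW s x L).1.map Lab.v).count y =
    (L.map Lab.v).count y + (if x = y then 1 else 0) := by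
  induction L with
  | nil => intro s; simp [stepW, List.count_singleton]
  | cons l L ih =>
    intro s
    simp only [stepW]
    split
    · simp only [List.map_cons, List.count_cons, ih]; omega
    · simp only [List.map_cons, List.count_cons, push_vals]; simp

theorem state_count (y : ℕ) (w : List ℕ) : ∀ s L, ((state s L w).map Lab.v).count y =
    (L.map Lab.v).count y + w.count y := by
  induction w with
  | nil => intros; simp [state]
  | cons x w ih =>
    intro s L
    simp only [state, ih, stepW_count, List.count_cons]
    simp; omega

theorem push_len (L : List Lab) : ∀ s c, (push s c L).1.length = L.length := by
  intro s c
  have := congrArg List.length (push_vals L s c)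
  simpa using this

theorem stepW_len (x : ℕ) (L : List Lab) : ∀ s, (stepW s x L).1.length = L.length + 1 := by
  induction L with
  | nil => intro s; simp [stepW]
  | cons l L ih =>
    intro s
    simp only [stepW]
    split
    · simp [ih]
    · simp [push_len]

theorem state_len (w : List ℕ) : ∀ s L, (state s L w).length = L.length + w.length := by
  induction w with
  | nil => intros; simp [state]
  | cons x w ih => intro s L; simp only [state, ih, stepW_len, List.length_cons]; omega

theorem state_snoc (s : Sh) (L : List Lab) (w : List ℕ) (x : ℕ) :
    state s L (w ++ [x]) = (stepW s x (state s L w)).1 := by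
  rw [state_append]; rfl

theorem state_lv {s : Sh} (h : Ok s) (w : List ℕ) : LV s (state s [] w) :=
  (outs_valid w s [] h trivial).2.1

theorem state_chain {s : Sh} (h : Ok s) (w : List ℕ) : (state s [] w).IsChain RB :=
  state_box w h trivial List.IsChain.nil

theorem dl_nd {M : ℕ} {w : List ℕ} (hw : w.length ≤ M) :
    ∀ l ∈ state (dl M) [] w, l.p.1 < M ∧ M ≤ l.p.2 := by
  intro l hl
  refine dk_nd _ (dk_dl M) (state_lv (dl_ok M) w) ?_ _ (List.mem_map_of_mem hl)
  simp [state_len, hw]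

theorem dl_true {M : ℕ} (w : List ℕ) : w.length ≤ M → ∀ l ∈ state (dl M) [] w, l.m = true := by
  induction w using List.reverseRecOn with
  | nil => intro _ l hl; simp [state] at hl
  | append_singleton w x ih =>
    intro hw
    simp only [List.length_append, List.length_singleton] at hw
    rw [state_snoc]
    refine stepW_true _ _ (fun l hl => ⟨ih (by omega) l hl, ?_⟩)
    have := dl_nd (by omega) l hl; omega

theorem dl_nr {M : ℕ} {w : List ℕ} (hw : w.length ≤ M) : NR (dl M) (state (dl M) [] w) :=
  nr_true _ fun l hl => ⟨dl_true w hw l hl, by have := dl_nd hw l hl; omega⟩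

/-! counts -/

def fc (y : ℕ) (L : List Lab) : ℕ := L.countP (fun l => decide (l.v = y ∧ Free l))
def xc (y : ℕ) (L : List Lab) : ℕ := L.countP (fun l => decide (l.v = y ∧ l.p.1 = 0 ∧ ¬ Free l))

theorem fc_cons (y : ℕ) (l : Lab) (L : List Lab) :
    fc y (l :: L) = fc y L + if l.v = y ∧ Free l then 1 else 0 := by
  simp only [fc, List.countP_cons, decide_eq_true_eq]

theorem xc_cons (y : ℕ) (l : Lab) (L : List Lab) :
    xc y (l :: L) = xc y L + if l.v = y ∧ l.p.1 = 0 ∧ ¬ Free l then 1 else 0 := by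
  simp only [xc, List.countP_cons, decide_eq_true_eq]

theorem count_split (y : ℕ) (L : List Lab) : (L.map Lab.v).count y =
    fc y L + xc y L + ((dropL L).map Lab.v).count y := by
  induction L with
  | nil => simp [fc, xc, dropL]
  | cons l L ih =>
    simp only [List.map_cons, List.count_cons, ih, fc_cons, xc_cons]
    by_cases h0 : l.p.1 = 0
    · rw [dropL_cons0 h0]
      by_cases hv : l.v = y <;> by_cases hf : Free l <;> simp [h0, hv, hf] <;> omega
    · have hf : ¬ Free l := fun h => h0 h.1
      rw [dropL_cons1 (by omega)]
      simp only [h0, hf, List.map_cons, List.count_cons]; simp; omega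

theorem RB.le {l l' : Lab} (h : RB l l') : l.v ≤ l'.v := by
  rcases h with h | h <;> omega

theorem emit_ex {x y : ℕ} (L : List Lab) (hL : L.Pairwise RB) (hxy : x < y) (h : 0 < fc y L) :
    ∃ v, emit x L = some v ∧ v ≤ y := by
  induction L with
  | nil => simp [fc] at h
  | cons l L ih =>
    rw [List.pairwise_cons] at hL
    simp only [emit]
    rw [fc_cons] at h
    split
    · rename_i hh
      refine ⟨_, rfl, ?_⟩
      by_cases e : l.v = y
      · omega
      · rw [if_neg (fun hh => e hh.1)] at h
        obtain ⟨l', hl', e'⟩ := List.countP_pos_iff.1 h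
        have := (hL.1 l' hl').le
        simp at e'; omega
    · rename_i hh
      apply ih hL.2
      by_cases e : l.v = y
      · have : ¬ Free l := fun hf => hh ⟨by omega, hf⟩
        rwa [if_neg (fun hh => this hh.2)] at h
      · rwa [if_neg (fun hh => e hh.1)] at h

theorem fc_of_emit {x v : ℕ} {L : List Lab} (h : emit x L = some v) : x < v ∧ 0 < fc v L := by
  obtain ⟨l, hl, h1, h2, h3⟩ := emit_lt h
  exact ⟨h2, List.countP_pos_iff.2 ⟨l, hl, by simp [h1, h3]⟩⟩

theorem emit_next {x : ℕ} {L : List Lab} (hL : L.IsChain RB) (h : 0 < fc (x+1) L) :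
    emit x L = some (x+1) := by
  obtain ⟨v, h1, h2⟩ := emit_ex L (List.isChain_iff_pairwise.1 hL) (Nat.lt_succ_self x) h
  have := (fc_of_emit h1).1
  rw [h1]; congr 1; omega

theorem emits_snoc (s : Sh) (w : List ℕ) : ∀ L x, emits s L (w ++ [x]) =
    emits s L w ++ (emit x (state s L w)).toList := by
  induction w with
  | nil => intros; simp [emits, state]
  | cons y w ih => intros; simp [emits, state, ih]

theorem emits_append (s : Sh) (w w' : List ℕ) : ∀ L, emits s L (w ++ w') =
    emits s L w ++ emits s (state s L w) w' := by
  induction w with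
  | nil => intros; simp [emits, state]
  | cons y w ih => intros; simp [emits, state, ih]

/-- all prefixes have no returns -/
def NRs (s : Sh) (w : List ℕ) : Prop := ∀ u v, w = u ++ v → NR s (state s [] u)

theorem NRs.pre {s w u v} (h : NRs s w) (e : w = u ++ v) : NRs s u :=
  fun u' v' e' => h u' (v' ++ v) (by rw [e, e', List.append_assoc])

theorem cons_law {s : Sh} (h : Ok s) {w : List ℕ} (hN : NRs s w) (y : ℕ) :
    w.count y = fc y (state s [] w) + xc y (state s [] w) + (emits s [] w).count y := by
  have h1 := (run_drop w h (L := []) trivial List.IsChain.nil hN).1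
  have h2 := count_split y (state s [] w)
  rw [h1, state_count, state_count] at h2
  simpa [dropL] using h2

theorem dl_nrs {M : ℕ} {w : List ℕ} (hw : w.length ≤ M) : NRs (dl M) w := by
  intro u v e
  apply dl_nr
  rw [e, List.length_append] at hw; omega

theorem dropS_dl (M : ℕ) : dropS (dl M) = dl (M - 1) := by
  simp only [dropS, dl]
  congr 1
  · funext a; omega
  · funext b; split <;> split <;> omega

theorem dropS_em : dropS em = em := by simp [dropS, em]

theorem dl_xc {M : ℕ} {w : List ℕ} (hw : w.length ≤ M) (y : ℕ) :
    xc y (state (dl M) [] w) = 0 := by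
  unfold xc
  rw [List.countP_eq_zero]
  intro l hl
  have h1 := dl_true w hw l hl
  have h2 := dl_nd hw l hl
  simp only [decide_eq_true_eq, not_and, not_not]
  intro _ h0
  exact ⟨h0, h1, by omega⟩

theorem emits_len {s : Sh} (h : Ok s) {w : List ℕ} (hN : NRs s w) :
    (emits s [] w).length + (Pw s w).countP (fun c => decide (c.1 = 0)) = w.length := by
  have h1 := (run_drop w h (L := []) trivial List.IsChain.nil hN).2
  have h2 := congrArg List.length h1
  rw [outs_length, ← outs_length w s []] at *
  rw [← h2]
  unfold Pw
  generalize outs s [] w = l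
  induction l with
  | nil => rfl
  | cons c l ih =>
    by_cases hc : c.1 = 0
    · simp only [List.filterMap_cons, dropO, hc, if_true, List.countP_cons, List.length_cons] at ih ⊢
      simp; omega
    · simp only [List.filterMap_cons, dropO, hc, if_false, List.countP_cons, List.length_cons] at ih ⊢
      simp; omega

theorem emits_row {s : Sh} (h : Ok s) {w : List ℕ} (hN : NRs s w) (a : ℕ) :
    (Pw s w).countP (fun c => decide (c.1 = a + 1)) =
    (Pw (dropS s) (emits s [] w)).countP (fun c => decide (c.1 = a)) := by
  have h1 := (run_drop w h (L := []) trivial List.IsChain.nil hN).2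
  have h2 : dropL [] = [] := rfl
  rw [h2] at h1
  unfold Pw
  rw [← h1]
  generalize outs s [] w = l
  induction l with
  | nil => rfl
  | cons c l ih =>
    by_cases hc : c.1 = 0
    · simp only [List.countP_cons, ih, List.filterMap_cons, dropO, hc, if_true]
      simp
    · simp only [List.countP_cons, ih, List.filterMap_cons, dropO, hc, if_false]
      congr 1
      have hd : (dropC c).1 = c.1 - 1 := rfl
      simp only [decide_eq_true_eq]
      by_cases e : c.1 = a + 1
      · rw [if_pos e, if_pos (by omega)]
      · rw [if_neg e, if_neg (by omega)]

end CD

namespace CD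

def Dom (lo n : ℕ) (w : List ℕ) : Prop :=
  (∀ x ∈ w, lo < x ∧ x ≤ n) ∧ ∀ u v, w = u ++ v → ∀ y, y < n → u.count y ≤ u.count (y+1)

theorem Dom.pre {lo n u v} (h : Dom lo n (u ++ v)) : Dom lo n u :=
  ⟨fun x hx => h.1 x (List.mem_append_left _ hx),
   fun u' v' e y hy => h.2 u' (v' ++ v) (by rw [e, List.append_assoc]) y hy⟩

theorem emit_mem {s : Sh} {w : List ℕ} {x v : ℕ} (h : emit x (state s [] w) = some v) : v ∈ w := by
  obtain ⟨l, hl, h1, _⟩ := emit_lt h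
  have h2 := state_count v w s []
  have : 0 < ((state s [] w).map Lab.v).count v := by
    apply List.count_pos_iff.2; rw [← h1]; exact List.mem_map_of_mem hl
  rw [h2] at this
  simp only [List.map_nil, List.count_nil, zero_add] at this
  exact List.count_pos_iff.1 this

theorem count_mf (n y : ℕ) (w : List ℕ) (hy : y < n) :
    ((w.filter (fun x => decide (x < n))).map (· + 1)).count (y+1) = w.count y := by
  have h1 := List.count_map_of_injective (w.filter (fun x => decide (x < n))) (fun x : ℕ => x + 1)
    (fun a b h => by simpa using h) y
  rw [h1, List.count_filter (by simpa using hy)]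

theorem dom_emits {lo n M : ℕ} (w : List ℕ) : Dom lo n w → w.length ≤ M →
    emits (dl M) [] w = (w.filter (fun x => decide (x < n))).map (· + 1) := by
  induction w using List.reverseRecOn with
  | nil => intros; rfl
  | append_singleton w x ih =>
    intro h hM
    simp only [List.length_append, List.length_singleton] at hM
    have ih' := ih h.pre (by omega)
    rw [emits_snoc, ih', List.filter_append, List.map_append]
    congr 1
    have hx := h.1 x (by simp)
    by_cases hxn : x < n
    · have e1 : ([x].filter (fun x => decide (x < n))).map (· + 1) = [x+1] := by simp [hxn]
      rw [e1]
      have h1 := h.2 (w ++ [x]) [] (by simp) x hxn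
      have h2 := cons_law (dl_ok M) (dl_nrs (w := w) (by omega)) (x+1)
      rw [dl_xc (by omega), ih', count_mf n x w hxn] at h2
      simp at h1
      rw [emit_next (state_chain (dl_ok M) w) (by omega)]
      rfl
    · have e1 : ([x].filter (fun x => decide (x < n))).map (· + 1) = [] := by simp [hxn]
      rw [e1]
      cases he : emit x (state (dl M) [] w) with
      | none => rfl
      | some v =>
        have h1 := (fc_of_emit he).1
        have h2 := h.1 v (List.mem_append_left _ (emit_mem he))
        omega

theorem Dom.next {lo n : ℕ} {w : List ℕ} (h : Dom lo n w) :
    Dom (lo+1) n ((w.filter (fun x => decide (x < n))).map (· + 1)) := by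
  refine ⟨fun x hx => ?_, fun u' v' e y hy => ?_⟩
  · simp only [List.mem_map, List.mem_filter, decide_eq_true_eq] at hx
    obtain ⟨z, ⟨hz, hz'⟩, rfl⟩ := hx
    have := h.1 z hz
    omega
  · obtain ⟨a, b, e1, rfl, rfl⟩ := List.map_eq_append_iff.1 e
    obtain ⟨u, v, e2, rfl, rfl⟩ := List.filter_eq_append_iff.1 e1
    rw [count_mf n y u hy]
    cases y with
    | zero =>
      have : ((u.filter (fun x => decide (x < n))).map (· + 1)).count 0 = 0 := by
        rw [List.count_eq_zero]; simp
      omega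
    | succ y => rw [count_mf n y u (by omega)]; exact h.2 u v e2 y (by omega)

theorem dom_row {n : ℕ} (k : ℕ) : ∀ {lo M : ℕ} {w : List ℕ} {x : ℕ}, Dom lo n (w ++ [x]) →
    lo + k = n → w.length + 1 + k ≤ M → (stepW (dl M) x (state (dl M) [] w)).2.1 = n - x := by
  induction k with
  | zero =>
    intro lo M w x h hk _
    have := h.1 x (by simp); omega
  | succ k ih =>
    intro lo M w x h hk hM
    have hs := stepW_row0 x (state (dl M) [] w) (dl_ok M) (state_lv (dl_ok M) w)
      (state_chain (dl_ok M) w) (dl_nr (by omega))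
    have hx := h.1 x (by simp)
    have hE := dom_emits (w ++ [x]) (M := M) h (by simp; omega)
    have hE' := dom_emits w (M := M) h.pre (by omega)
    have hD := h.next
    rw [← hE, emits_snoc] at hD
    rw [emits_snoc, hE', List.filter_append, List.map_append] at hE
    have hE2 := List.append_cancel_left hE
    by_cases hxn : x < n
    · have e1 : ([x].filter (fun x => decide (x < n))).map (· + 1) = [x+1] := by simp [hxn]
      rw [e1] at hE2
      cases he : emit x (state (dl M) [] w) with
      | none => rw [he] at hE2; simp at hE2
      | some v =>
        rw [he] at hE2 hs hD
        simp only [Option.toList, List.cons.injEq, and_true] at hE2 hD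
        subst hE2
        simp only [EmitSpec] at hs
        rw [(run_drop w (dl_ok M) (L := []) trivial List.IsChain.nil (dl_nrs (by omega))).1,
          dropS_dl] at hs
        have hlen : (emits (dl M) [] w).length ≤ w.length := by
          rw [hE', List.length_map]; exact List.length_filter_le _ _
        have := ih hD (by omega) (M := M - 1) (by omega)
        rw [show dropL [] = [] from rfl] at hs
        rw [← hs.2.1] at this
        simp only [dropC] at this
        omega
    · have e1 : ([x].filter (fun x => decide (x < n))).map (· + 1) = [] := by simp [hxn]
      rw [e1] at hE2
      cases he : emit x (state (dl M) [] w) with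
      | none => rw [he] at hs; simp only [EmitSpec] at hs; omega
      | some v => rw [he] at hE2; simp at hE2

/-- Application A: insertion of a dominated word over the staircase. -/
theorem dom_rows {n M : ℕ} (w : List ℕ) : Dom 0 n w → w.length + n ≤ M →
    (Pw (dl M) w).map Prod.fst = w.map (fun x => n - x) := by
  induction w using List.reverseRecOn with
  | nil => intros; rfl
  | append_singleton w x ih =>
    intro h hM
    simp only [List.length_append, List.length_singleton] at hM
    have ih' := ih h.pre (by omega)
    have := dom_row n h (M := M) (by omega) (by omega)
    simp only [Pw] at ih' ⊢
    rw [outs_append, List.map_append, ih', List.map_append]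
    simp [outs, this]

/-! suffix lattice words -/

def Lat (lo : ℕ) (w : List ℕ) : Prop :=
  (∀ x ∈ w, lo < x) ∧ ∀ u v, w = u ++ v → ∀ y, lo < y → v.count (y+1) ≤ v.count y

theorem emits_split {s : Sh} (w : List ℕ) : ∀ {L u' v'}, emits s L w = u' ++ v' →
    ∃ u v, w = u ++ v ∧ emits s L u = u' ∧ emits s (state s L u) v = v' := by
  induction w with
  | nil =>
    intro L u' v' h
    simp only [emits, List.nil_eq_append_iff] at h
    exact ⟨[], [], rfl, h.1.symm, h.2.symm⟩
  | cons x w ih =>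
    intro L u' v' h
    simp only [emits] at h
    cases he : emit x L with
    | none =>
      rw [he] at h
      obtain ⟨u, v, h1, h2, h3⟩ := ih (by simpa using h)
      exact ⟨x :: u, v, by rw [h1]; rfl, by simp [emits, he, h2], by simpa [state] using h3⟩
    | some z =>
      rw [he] at h
      cases u' with
      | nil => exact ⟨[], x :: w, rfl, rfl, by simp [emits, state, he]; simpa using h⟩
      | cons z' u' =>
        simp only [Option.toList, List.cons_append, List.nil_append, List.cons.injEq] at h
        obtain ⟨u, v, h1, h2, h3⟩ := ih h.2
        exact ⟨x :: u, v, by rw [h1]; rfl, by simp [emits, he, h2, h.1], by simpa [state] using h3⟩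

/-- monotonicity of fixed row-0 labels along the run -/
def XM (s : Sh) (w : List ℕ) : Prop := ∀ u x v, w = u ++ x :: v →
  ∀ y, xc y (state s [] u) ≤ xc y (state s [] (u ++ [x]))

theorem lat_inv {s : Sh} (h : Ok s) {lo : ℕ} {w : List ℕ} (hw : Lat lo w) (hN : NRs s w)
    (hX : XM s w) (u : List ℕ) : ∀ v, w = u ++ v → ∀ y, lo < y →
    fc (y+1) (state s [] u) + v.count (y+1) ≤ v.count y := by
  induction u using List.reverseRecOn with
  | nil =>
    intro v e y hy
    have := hw.2 [] v e y hy
    simpa [state, fc] using this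
  | append_singleton u x ih =>
    intro v e y hy
    have e' : w = u ++ x :: v := by rw [e]; simp
    have ih' := ih (x :: v) e' y hy
    have h1 := cons_law h (hN.pre e) (y+1)
    have h2 := cons_law h (hN.pre e') (y+1)
    have h3 := hX u x v e' (y+1)
    have h4 := hw.2 (u ++ [x]) v e y hy
    rw [emits_snoc] at h1
    simp only [List.count_append, List.count_cons, List.count_nil] at h1 ih'
    by_cases hxy : x = y
    · subst hxy
      by_cases hf : 0 < fc (x+1) (state s [] u)
      · rw [emit_next (state_chain h u) hf] at h1
        simp at h1 ih'
        omega
      · simp at h1 ih'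
        omega
    · simp [hxy] at h1 ih'
      omega

theorem lat_end {s : Sh} (h : Ok s) {lo : ℕ} {w : List ℕ} (hw : Lat lo w) (hN : NRs s w)
    (hX : XM s w) {y : ℕ} (hy : lo < y) :
    w.count (y+1) = xc (y+1) (state s [] w) + (emits s [] w).count (y+1) := by
  have h1 := lat_inv h hw hN hX w [] (by simp) y hy
  have h2 := cons_law h hN (y+1)
  simp at h1; omega

theorem emits_gt {s : Sh} {lo : ℕ} (w : List ℕ) : ∀ {L}, (∀ x ∈ w, lo < x) →
    ∀ x ∈ emits s L w, lo + 1 < x := by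
  induction w with
  | nil => intro L _ x hx; simp [emits] at hx
  | cons z w ih =>
    intro L h x hx
    simp only [emits, List.mem_append] at hx
    rcases hx with hx | hx
    · simp only [Option.mem_toList, Option.mem_def] at hx
      have := (fc_of_emit hx).1
      have := h z (by simp); omega
    · exact ih (fun x hx => h x (List.mem_cons_of_mem _ hx)) x hx

theorem dl_xm {M : ℕ} {w : List ℕ} (hw : w.length ≤ M) : XM (dl M) w := by
  intro u x v e y
  rw [dl_xc]; · omega
  rw [e] at hw; simp at hw; omega

theorem lat_next {lo M : ℕ} {w : List ℕ} (hw : Lat lo w) (hM : w.length ≤ M) :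
    Lat (lo+1) (emits (dl M) [] w) ∧
    ∀ y, lo + 1 < y → (emits (dl M) [] w).count y = w.count y := by
  have hend : ∀ y, lo + 1 < y → (emits (dl M) [] w).count y = w.count y := by
    intro y hy
    obtain ⟨y, rfl⟩ : ∃ z, y = z + 1 := ⟨y - 1, by omega⟩
    have := lat_end (dl_ok M) hw (dl_nrs hM) (dl_xm hM) (y := y) (by omega)
    rw [dl_xc hM] at this; omega
  refine ⟨⟨emits_gt w hw.1, fun u' v' e y hy => ?_⟩, hend⟩
  obtain ⟨u, v, h1, h2, h3⟩ := emits_split w e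
  have hNu := (dl_nrs hM).pre h1
  have hlu : u.length ≤ M := by rw [h1] at hM; simp at hM; omega
  have key : ∀ y, lo + 1 < y → v'.count y = v.count y + fc y (state (dl M) [] u) := by
    intro y hy
    have h4 := hend y hy
    rw [e, h1, List.count_append, List.count_append] at h4
    have h5 := cons_law (dl_ok M) hNu y
    rw [dl_xc hlu, h2] at h5
    omega
  rw [key _ hy, key _ (by omega)]
  have := lat_inv (dl_ok M) hw (dl_nrs hM) (dl_xm hM) u v h1 y (by omega)
  omega

/-- Application B -/
theorem lat_rows (a : ℕ) : ∀ {lo M : ℕ} {w : List ℕ}, Lat lo w → w.length + a ≤ M →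
    (Pw (dl M) w).countP (fun c => decide (c.1 = a)) = w.count (lo + 1 + a) := by
  induction a with
  | zero =>
    intro lo M w hw hM
    have hM' : w.length ≤ M := by omega
    obtain ⟨h1, h2⟩ := lat_next hw hM'
    have h3 := emits_len (dl_ok M) (dl_nrs hM')
    have hp : (w.filter (fun x => decide (x ≠ lo + 1))).Perm (emits (dl M) [] w) := by
      rw [List.perm_iff_count]
      intro y
      by_cases hy : lo + 1 < y
      · rw [h2 y hy, List.count_filter (by simp; omega)]
      · have e1 : (emits (dl M) [] w).count y = 0 := by
          rw [List.count_eq_zero]; intro hh; exact hy (h1.1 y hh)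
        rw [e1, List.count_eq_zero]
        simp only [List.mem_filter, decide_eq_true_eq, not_and, not_not]
        intro hh; have := hw.1 y hh; omega
    have h4 := hp.length_eq
    have h5 := List.length_eq_countP_add_countP (fun x => decide (x ≠ lo + 1)) (l := w)
    rw [← List.countP_eq_length_filter] at h4
    have h6 : w.count (lo + 1) = List.countP (fun a => ! decide (a ≠ lo + 1)) w := by
      rw [List.count]
      apply List.countP_congr
      intro x _
      simp
    simp only [add_zero]
    rw [h6]
    simp at h4 h5 h3 ⊢
    omega
  | succ a ih =>
    intro lo M w hw hM
    have hM' : w.length ≤ M := by omega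
    obtain ⟨h1, h2⟩ := lat_next hw hM'
    rw [emits_row (dl_ok M) (dl_nrs hM') a, dropS_dl]
    have h3 := emits_len (dl_ok M) (dl_nrs hM')
    rw [ih h1 (by omega), h2 _ (by omega)]
    congr 1; omega

end CD

namespace CD

/-- the first label of every block is pinned to row `0` -/
def M1 : ℕ → List Lab → Prop
  | _, [] => True
  | pv, l :: L => (l.v ≠ pv → l.p.1 = 0 ∧ (l.m = false ∨ l.p.2 = 0)) ∧ M1 l.v L

theorem nxt_pin {s : Sh} (h : Ok s) {q : Cell} {m : Bool} (hq : Ad s q) (h0 : q.1 = 0)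
    (hm : m = false ∨ q.2 = 0) : nxt (put s q) q m = ((0, q.2 + 1), false) := by
  obtain ⟨a, b⟩ := q
  simp only at h0; subst h0
  have hR : (put s (0, b)).R 0 = b + 1 := put_R_self s (0, b)
  have hC : (put s (0, b)).C (b+1) = 0 := by
    have := (h.put hq).mem 0 (b+1) (by omega); omega
  unfold nxt; rw [if_neg]
  · simp only [hC]
  · rintro ⟨hm', hb⟩
    rcases hm with hm | hm
    · rw [hm] at hm'; simp at hm'
    · simp only at hm hb; omega

theorem push_M1 (L : List Lab) : ∀ {s c pv}, Ok s → LV s L → Ad s c → M1 pv L →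
    M1 pv (push s c L).1 := by
  induction L with
  | nil => intros; trivial
  | cons l L ih =>
    intro s c pv h hL hc hM
    obtain ⟨v, q, m⟩ := l
    have hq : Ad s q := hL.1
    have hl := lab1_ad (m := m) h hc hq
    rw [push_cons]
    refine ⟨fun hv => ?_, ih (h.put hq) hL.2 hl.1 hM.2⟩
    have hh := hM.1 hv
    simp only at hh ⊢
    unfold lab1
    split
    · rename_i e; subst e
      rw [nxt_pin h hq hh.1 hh.2]; simp
    · exact hh

theorem M1.change {pv x : ℕ} {L : List Lab} (h : M1 pv L) (hL : ∀ l ∈ L, l.v ≠ pv) : M1 x L := by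
  cases L with
  | nil => trivial
  | cons l L => exact ⟨fun _ => h.1 (hL l (by simp)), h.2⟩

theorem stepW_M1 (x : ℕ) (L : List Lab) : ∀ {s pv}, Ok s → LV s L → L.Pairwise RB → M1 pv L →
    (∀ l ∈ L, pv ≤ l.v) → pv ≤ x →
    (x = pv ∨ x ∈ L.map Lab.v ∨ (s.R 0 = 0 ∧ (∀ l ∈ L, x < l.v))) →
    M1 pv (stepW s x L).1 := by
  induction L with
  | nil =>
    intro s pv h _ _ _ _ _ hx
    refine ⟨fun hv => ⟨rfl, ?_⟩, trivial⟩
    simp only at hv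
    rcases hx with hx | hx | hx
    · exact absurd hx hv
    · simp at hx
    · right; exact hx.1
  | cons l L ih =>
    intro s pv h hL hP hM hpv hpx hx
    have hq : Ad s l.p := hL.1
    have hP' := List.pairwise_cons.1 hP
    simp only [stepW]
    split
    · rename_i hlx
      refine ⟨hM.1, ih (h.put hq) hL.2 hP'.2 hM.2 (fun l' hl' => (hP'.1 l' hl').le) hlx ?_⟩
      rcases hx with hx | hx | hx
      · left; have := hpv l (by simp); omega
      · rcases List.mem_cons.1 hx with hx | hx
        · left; exact hx
        · right; left; exact hx
      · have := hx.2 l (by simp); omega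
    · rename_i hlx
      have hgt : ∀ l' ∈ l :: L, x < l'.v := by
        intro l' hl'
        rcases List.mem_cons.1 hl' with rfl | hl'
        · omega
        · have := (hP'.1 l' hl').le; omega
      refine ⟨fun hv => ⟨rfl, ?_⟩, ?_⟩
      · simp only at hv
        rcases hx with hx | hx | hx
        · exact absurd hx hv
        · obtain ⟨l', hl', e⟩ := List.mem_map.1 hx
          have := hgt l' hl'; omega
        · right; exact hx.1
      · refine push_M1 (l :: L) h hL (ad_zero h) ?_
        refine M1.change hM ?_
        intro l' hl'
        have := hgt l' hl'; omega

theorem noRet_em (L : List Lab) : ∀ {s e pv}, Ok s → LV s L → Ad s e → 1 ≤ e.1 → L.Pairwise RB →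
    M1 pv L → (e.2 + 2 ≤ s.R 0 ∨
      ∀ l ∈ L, l.v = pv → e = l.p → l.m = true ∧ l.p.1 ≠ l.p.2) → NoRet s e L := by
  induction L with
  | nil => intros; trivial
  | cons l L ih =>
    intro s e pv h hL he he1 hP hM hF
    obtain ⟨v, q, m⟩ := l
    have hq : Ad s q := hL.1
    have hl := lab1_ad (m := m) h he hq
    have hP' := List.pairwise_cons.1 hP
    have heR : e.2 < s.R 0 := by
      have h1 := Ad.le h he
      have h2 := h.mem 0 e.2 (by omega)
      have h3 := he.2
      omega
    have hR : s.R 0 ≤ (put s q).R 0 := by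
      by_cases h0 : q.1 = 0
      · have h1 := put_R_self s q; rw [h0] at h1
        have h2 := hq.1; rw [h0] at h2; omega
      · rw [put_R_ne s (Ne.symm h0)]
    by_cases hv : v = pv
    · by_cases hh : e = q
      · subst hh
        have e1 : lab1 s e e m = (nxt (put s e) e m, (nxt (put s e) e m).1) := by simp [lab1]
        simp only [NoRet]
        rw [e1] at hl ⊢
        obtain ⟨a, b⟩ := e
        by_cases hm : m = true ∧ a ≠ b
        · obtain ⟨rfl, hab⟩ := hm
          have hle := row_le h he hab
          have e2 : (put s (a,b)).R (a+1) = s.R (a+1) := put_R_ne s (by simp)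
          rw [nxt_row hab] at hl ⊢
          refine ⟨by simp, ih (h.put he) hL.2 hl.1 (by simp) hP'.2 hM.2 ?_⟩
          simp only [e2]
          rcases hF with hF | hF
          · left; simp only at hF; omega
          · right
            intro l' hl' hv' ep
            exfalso
            rcases hP'.1 l' hl' with h5 | ⟨_, h5⟩
            · simp only at h5; omega
            · simp [Bx] at h5
              have := congrArg Prod.snd ep
              simp only at this
              omega
        · have hF' : b + 2 ≤ s.R 0 := by
            rcases hF with hF | hF
            · exact hF
            · exact absurd (hF _ List.mem_cons_self hv rfl) hm
          have hle := col_le h he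
          have e2 : (put s (a,b)).C (b+1) = s.C (b+1) := put_C_ne s (by simp)
          have hab := Ad.le h he
          have e3 : nxt (put s (a,b)) (a,b) m = ((s.C (b+1), b+1), false) := by
            unfold nxt; rw [if_neg hm, e2]
          rw [e3] at hl ⊢
          have h1 : 1 ≤ s.C (b+1) := by have := h.mem 0 (b+1) (by omega); omega
          refine ⟨h1, ih (h.put he) hL.2 hl.1 h1 hP'.2 hM.2 (Or.inr ?_)⟩
          intro l' hl' hv' ep
          simp only at hab hv'
          have ep1 := congrArg Prod.fst ep
          have ep2 := congrArg Prod.snd ep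
          simp only at ep1 ep2
          refine ⟨?_, by omega⟩
          rcases hP'.1 l' hl' with h5 | ⟨_, h5⟩
          · simp only at h5; omega
          · rcases h5 with h5 | h5 | h5
            · exact h5.2.1
            · simp only at h5; omega
            · exact h5.2
      · have e1 : lab1 s e q m = ((q, m), e) := by simp [lab1, hh]
        simp only [NoRet]
        rw [e1] at hl ⊢
        refine ⟨he1, ih (h.put hq) hL.2 hl.1 he1 hP'.2 hM.2 ?_⟩
        rcases hF with hF | hF
        · left; simp only; omega
        · right; intro l' hl' hv' ep
          exact hF l' (List.mem_cons_of_mem _ hl') (by simp only at hv'; omega) ep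
    · have h0 := (hM.1 hv).1
      simp only at h0
      have hh : e ≠ q := by rintro rfl; omega
      have e1 : lab1 s e q m = ((q, m), e) := by simp [lab1, hh]
      simp only [NoRet]
      rw [e1] at hl ⊢
      refine ⟨he1, ih (h.put hq) hL.2 hl.1 he1 hP'.2 hM.2 (Or.inl ?_)⟩
      have h1 := put_R_self s q; rw [h0] at h1
      have h2 := hq.1; rw [h0] at h2; simp only; omega

theorem nr_em (L : List Lab) : ∀ {s pv}, Ok s → LV s L → L.Pairwise RB → M1 pv L → NR s L := by
  induction L with
  | nil => intros; trivial
  | cons l L ih =>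
    intro s pv h hL hP hM
    have hP' := List.pairwise_cons.1 hP
    refine ⟨fun hf e he he1 => ?_, ih (h.put hL.1) hL.2 hP'.2 hM.2⟩
    refine noRet_em L (h.put hL.1) hL.2 he he1 hP'.2 hM.2 (Or.inr ?_)
    intro l' hl' hv ep
    exfalso
    obtain ⟨f1, f2, f3⟩ := hf
    rcases hP'.1 l' hl' with h5 | ⟨_, h5⟩
    · omega
    · simp [Bx, f2] at h5
      have := congrArg Prod.fst ep
      omega

theorem row0_pos (L : List Cell) : ∀ {s}, Valid s L → 1 ≤ s.R 0 → ∀ c ∈ L, c.1 = 0 → c.2 ≠ 0 := by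
  induction L with
  | nil => simp
  | cons d L ih =>
    intro s hL h1 c hc h0
    have hR : 1 ≤ (put s d).R 0 := by
      simp only [put]; split <;> omega
    rcases List.mem_cons.1 hc with rfl | hc
    · have := hL.1.1; rw [h0] at this; omega
    · exact ih hL.2 hR c hc h0

theorem xc_M1 (y : ℕ) (L : List Lab) : ∀ {s pv}, LV s L → L.Pairwise RB → M1 pv L → (∀ l ∈ L, pv ≤ l.v) →
    (∀ l ∈ L, l.v = pv → l.p.1 = 0 → Free l) →
    xc y L = if y ≠ pv ∧ y ∈ L.map Lab.v then 1 else 0 := by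
  induction L with
  | nil => intros; simp [xc]
  | cons l L ih =>
    intro s pv hL hP hM hpv hF
    have hP' := List.pairwise_cons.1 hP
    have hle : ∀ l' ∈ L, l.v ≤ l'.v := fun l' hl' => (hP'.1 l' hl').le
    rw [xc_cons]
    by_cases hv : l.v = pv
    · rw [ih (pv := pv) hL.2 hP'.2 (hv ▸ hM.2) (fun l' hl' => hpv l' (List.mem_cons_of_mem _ hl'))
        (fun l' hl' => hF l' (List.mem_cons_of_mem _ hl'))]
      rw [if_neg (c := l.v = y ∧ l.p.1 = 0 ∧ ¬ Free l) (fun hh => hh.2.2 (hF l (by simp) hv hh.2.1)),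
        add_zero]
      congr 1
      simp only [List.map_cons, List.mem_cons, eq_iff_iff]
      constructor
      · rintro ⟨h1, h2⟩; exact ⟨h1, Or.inr h2⟩
      · rintro ⟨h1, h2 | h2⟩
        · omega
        · exact ⟨h1, h2⟩
    · obtain ⟨h1, h2⟩ := hM.1 hv
      have hnf : ¬ Free l := by
        rintro ⟨_, f2, f3⟩
        rcases h2 with h2 | h2
        · rw [h2] at f2; simp at f2
        · exact f3 h2
      rw [ih hL.2 hP'.2 hM.2 hle]
      · have hlt : pv < l.v := by have := hpv l (by simp); omega
        have hy : ∀ z ∈ L.map Lab.v, l.v ≤ z := by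
          intro z hz
          obtain ⟨l', hl', rfl⟩ := List.mem_map.1 hz
          exact hle l' hl'
        simp only [h1, hnf, not_false_eq_true, and_true, List.map_cons, List.mem_cons]
        by_cases e1 : l.v = y
        · subst e1
          have : l.v ≠ pv := hv
          simp [this]
        · by_cases e2 : y ∈ L.map Lab.v
          · have := hy y e2
            have e3 : y ≠ pv := by omega
            rw [if_pos ⟨fun hh => e1 hh.symm, e2⟩, if_neg e1, if_pos ⟨e3, Or.inr e2⟩]
          · rw [if_neg (fun hh => e2 hh.2), if_neg e1,
              if_neg (fun hh => hh.2.elim (fun h => e1 h.symm) e2)]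
      · intro l' hl' hv' h0
        rcases hP'.1 l' hl' with h5 | ⟨_, h5⟩
        · omega
        · rcases h5 with ⟨g1, g2, g3, g4⟩ | ⟨g1, g2, g3, g4⟩ | ⟨g1, g2⟩
          · exact ⟨h0, g2, by omega⟩
          · omega
          · refine ⟨h0, g2, ?_⟩
            refine row0_pos _ hL.2 ?_ _ (List.mem_map_of_mem hl') h0
            have := put_R_self s l.p
            rw [h1] at this; omega

structure Sq (lo k : ℕ) (w : List ℕ) : Prop where
  mem : ∀ x ∈ w, lo < x ∧ x ≤ lo + k
  cnt : ∀ y, lo < y → y ≤ lo + k → w.count y = k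
  lat : Lat lo w

theorem Lat.mono {lo : ℕ} {u v : List ℕ} (h : Lat lo (u ++ v)) {y : ℕ} (hy : lo < y) (d : ℕ) :
    v.count (y + d) ≤ v.count y := by
  induction d with
  | zero => simp
  | succ d ih =>
    have := h.2 u v rfl (y + d) (by omega)
    rw [show y + (d + 1) = y + d + 1 by omega]; omega

theorem Sq.fresh {lo k : ℕ} {w u v : List ℕ} {x : ℕ} (h : Sq lo k w) (e : w = u ++ x :: v)
    (hx : x ∉ u) : ∀ z ∈ u, x < z := by
  intro z hz
  by_contra hc
  have hzx : z ≠ x := fun hh => hx (hh ▸ hz)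
  have h1 := h.mem z (by rw [e]; simp [hz])
  have h2 := h.mem x (by rw [e]; simp)
  have hl := h.lat
  rw [e] at hl
  have h3 := hl.mono h1.1 (x - z)
  rw [show z + (x - z) = x by omega] at h3
  have h4 := h.cnt x h2.1 h2.2
  have h5 := h.cnt z h1.1 h1.2
  rw [e, List.count_append] at h4 h5
  have h6 : 0 < u.count z := List.count_pos_iff.2 hz
  have h7 : u.count x = 0 := List.count_eq_zero.2 hx
  omega

theorem state_mem {s : Sh} {w : List ℕ} {y : ℕ} : y ∈ (state s [] w).map Lab.v ↔ y ∈ w := by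
  rw [← List.count_pos_iff, state_count, ← List.count_pos_iff]; simp

theorem sq_M1 {lo k : ℕ} {w : List ℕ} (h : Sq lo k w) (u : List ℕ) : ∀ v, w = u ++ v →
    M1 0 (state em [] u) := by
  induction u using List.reverseRecOn with
  | nil => intros; trivial
  | append_singleton u x ih =>
    intro v e
    have e' : w = u ++ x :: v := by rw [e]; simp
    rw [state_snoc]
    refine stepW_M1 x _ em_ok (state_lv em_ok u)
      (List.isChain_iff_pairwise.1 (state_chain em_ok u)) (ih _ e') (by simp) (by simp) ?_
    by_cases hx : x ∈ u
    · right; left; exact state_mem.2 hx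
    · right; right
      refine ⟨rfl, fun l hl => ?_⟩
      exact h.fresh e' hx l.v (state_mem.1 (List.mem_map_of_mem hl))

theorem sq_nrs {lo k : ℕ} {w : List ℕ} (h : Sq lo k w) : NRs em w := fun u v e =>
  nr_em _ em_ok (state_lv em_ok u) (List.isChain_iff_pairwise.1 (state_chain em_ok u)) (sq_M1 h u v e)

theorem sq_xc {lo k : ℕ} {w u v : List ℕ} (h : Sq lo k w) (e : w = u ++ v) (y : ℕ) :
    xc y (state em [] u) = if y ∈ u then 1 else 0 := by
  have hpos : ∀ x ∈ u, x ≠ 0 := fun x hx => by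
    have := h.mem x (by rw [e]; simp [hx]); omega
  rw [xc_M1 y _ (state_lv em_ok u) (List.isChain_iff_pairwise.1 (state_chain em_ok u)) (sq_M1 h u v e)
    (by simp)]
  · simp only [state_mem]
    congr 1
    simp only [eq_iff_iff, and_iff_right_iff_imp]
    exact hpos y
  · intro l hl hv
    exact absurd hv (hpos l.v (state_mem.1 (List.mem_map_of_mem hl)))

theorem sq_xm {lo k : ℕ} {w : List ℕ} (h : Sq lo k w) : XM em w := by
  intro u x v e y
  rw [sq_xc h e, sq_xc (v := v) h (by rw [e]; simp)]
  split <;> split <;> simp_all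

theorem sq_next {lo k : ℕ} {w : List ℕ} (h : Sq lo (k+1) w) : Sq (lo+1) k (emits em [] w) := by
  have hg := emits_gt (s := em) w (L := []) (fun x hx => (h.mem x hx).1)
  have hsub : ∀ x ∈ emits em [] w, x ∈ w := by
    intro x hx
    have h1 := cons_law em_ok (sq_nrs h) x
    have h2 := List.count_pos_iff.2 hx
    exact List.count_pos_iff.1 (by omega)
  have hcnt : ∀ y, lo + 1 < y → y ≤ lo + 1 + k → (emits em [] w).count y = k := by
    intro y h1 h2
    obtain ⟨y, rfl⟩ : ∃ z, y = z + 1 := ⟨y - 1, by omega⟩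
    have h3 := lat_end em_ok h.lat (sq_nrs h) (sq_xm h) (y := y) (by omega)
    have h4 := h.cnt (y+1) (by omega) (by omega)
    have h5 : y + 1 ∈ w := List.count_pos_iff.1 (by omega)
    rw [sq_xc (v := []) h (by simp), if_pos h5] at h3
    omega
  refine ⟨fun x hx => ⟨hg x hx, ?_⟩, hcnt, hg, fun u' v' e y hy => ?_⟩
  · have := h.mem x (hsub x hx); omega
  · by_cases hyk : y + 1 ≤ lo + 1 + k
    · obtain ⟨u, v, h1, h2, h3⟩ := emits_split w e
      have key : ∀ y, lo + 1 < y → y ≤ lo + 1 + k →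
          v'.count y + 1 = v.count y + fc y (state em [] u) + (if y ∈ u then 1 else 0) ∧
          fc y (state em [] u) + (if y ∈ u then 1 else 0) ≤ u.count y ∧
          u.count y + v.count y = k + 1 := by
        intro y hy hy'
        have h4 := hcnt y hy hy'
        have h5 := h.cnt y (by omega) (by omega)
        have h6 := cons_law em_ok ((sq_nrs h).pre h1) y
        rw [sq_xc h h1, h2] at h6
        rw [e, List.count_append] at h4
        rw [h1, List.count_append] at h5
        omega
      have k1 := key (y+1) (by omega) hyk
      have k2 := key y hy (by omega)
      have k3 := lat_inv em_ok h.lat (sq_nrs h) (sq_xm h) u v h1 y (by omega)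
      by_cases hyu : y ∈ u
      · rw [if_pos hyu] at k2
        split at k1 <;> omega
      · rw [if_neg hyu] at k2
        have : u.count y = 0 := List.count_eq_zero.2 hyu
        omega
    · have : (emits em [] w).count (y+1) = 0 := by
        rw [List.count_eq_zero]
        intro hh
        have := h.mem _ (hsub _ hh); omega
      rw [e, List.count_append] at this; omega

theorem sq_len {lo k : ℕ} {w : List ℕ} (h : Sq lo k w) : w.length = k * k := by
  have h1 : w.length = ∑ y ∈ Finset.Ioc lo (lo + k), w.count y := by
    rw [← List.sum_toFinset_count_eq_length]
    apply Finset.sum_subset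
    · intro x hx; have := h.mem x (List.mem_toFinset.1 hx); simp; omega
    · intro x _ hx
      exact List.count_eq_zero.2 (fun hh => hx (List.mem_toFinset.2 hh))
  rw [h1, Finset.sum_congr rfl (fun y hy => h.cnt y (Finset.mem_Ioc.1 hy).1 (Finset.mem_Ioc.1 hy).2)]
  simp

/-- Application C -/
theorem sq_rows (a : ℕ) : ∀ {lo k : ℕ} {w : List ℕ}, Sq lo k w →
    (Pw em w).countP (fun c => decide (c.1 = a)) = 2 * k - 1 - 2 * a := by
  induction a with
  | zero =>
    intro lo k w h
    have h1 := emits_len em_ok (sq_nrs h)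
    cases k with
    | zero => have := sq_len h; simp at this; simp [this, Pw, outs]
    | succ k =>
      have h2 := sq_len (sq_next h)
      have h3 := sq_len h
      rw [h2, h3] at h1
      have : (k+1)*(k+1) = k * k + 2 * k + 1 := by ring
      omega
  | succ a ih =>
    intro lo k w h
    cases k with
    | zero => have := sq_len h; simp at this; simp [this, Pw, outs]
    | succ k =>
      rw [emits_row em_ok (sq_nrs h) a, dropS_em, ih (sq_next h)]
      omega

end CD

namespace CD

theorem sl_des {s : Sh} (h : Ok s) {d x y : Cell} (hd : Ad s d) (hx : Ad (put s d) x)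
    (hy : Ad (put (put s d) x) y)
    (hex : ¬ (d.1 = d.2 ∧ y = (d.1 + 1, d.1 + 1))) :
    (x.1 < y.1 ↔ (sl d x).1.1 < (sl (sl d x).2 y).1.1) := by
  obtain ⟨a, b⟩ := d
  obtain ⟨xa, xb⟩ := x
  obtain ⟨ya, yb⟩ := y
  have hab := Ad.le h hd
  have h1 := h.put hd
  have hxle := Ad.le h1 hx
  have hyle := Ad.le (h1.put hx) hy
  have m1 := h.mem (a+1) b
  have m2 := h.mem a (b+1)
  have c1 := h.c_le b
  obtain ⟨d1, d2⟩ := hd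
  obtain ⟨x1, x2⟩ := hx
  obtain ⟨y1, y2⟩ := hy
  simp only [put] at *
  simp only [Prod.mk.injEq] at hex
  by_cases e1 : adj (a,b) (xa, xb)
  · have e1' := e1
    simp only [sl, e1, if_true]
    simp only [adj] at e1'
    rcases e1' with ⟨rfl, rfl⟩ | ⟨rfl, rfl⟩
    · by_cases e2 : adj (xa, b+1) (ya, yb)
      · have e2' := e2
        simp only [e2, if_true]
        simp only [adj] at e2'
        rcases e2' with ⟨rfl, rfl⟩ | ⟨rfl, rfl⟩
        · simp
        · exfalso
          simp at x1 x2 y1 y2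
          by_cases hh : xa = b
          · exact hex ⟨hh, rfl, by omega⟩
          · have := m1 (by omega); omega
      · simp [e2]
    · by_cases e2 : adj (a+1, xb) (ya, yb)
      · have e2' := e2
        simp only [e2, if_true]
        simp only [adj] at e2'
        rcases e2' with ⟨rfl, rfl⟩ | ⟨rfl, rfl⟩
        · exfalso
          simp at x1 x2 y1 y2
          have := m2 (by omega); omega
        · simp
      · simp only [e2, if_false]
        simp only [adj] at e2
        by_cases hh : ya = a + 1
        · subst hh
          simp at y1
          omega
        · omega
  · simp only [sl, e1, if_false]
    by_cases e2 : adj (a, b) (ya, yb)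
    · have e2' := e2
      simp only [e2, if_true]
      simp only [adj] at e2' e1
      rcases e2' with ⟨rfl, rfl⟩ | ⟨rfl, rfl⟩
      · simp
      · by_cases hh : xa = a
        · subst hh; simp at x1; omega
        · omega
    · simp [e2]

theorem sl_le (d c : Cell) : (sl d c).1.1 ≤ c.1 ∧ (sl d c).1.1 + (sl d c).1.2 ≤ c.1 + c.2 := by
  by_cases e : adj d c
  · have e' := e
    simp only [sl, e, if_true]
    simp only [adj] at e'
    omega
  · simp [sl, e]

def ds (l : List Cell) (i : ℕ) : Prop := (l.getD i (0,0)).1 < (l.getD (i+1) (0,0)).1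

theorem slide_ds {M : ℕ} (l : List Cell) : ∀ {s d k}, Ok s → Ad s d → Valid (put s d) l →
    Dk M k s → k + 1 + l.length ≤ M → ∀ i, i + 1 < l.length → (ds (slide d l) i ↔ ds l i) := by
  induction l with
  | nil => intro s d k _ _ _ _ _ i hi; simp at hi
  | cons x l ih =>
    intro s d k h hd hl hk hM i hi
    have hs := sl_ad h hd hl.1
    simp only [List.length_cons] at hM hi
    rw [slide_cons]
    cases i with
    | succ i =>
      have := ih (h.put hs.1) hs.2.1 (hs.2.2 ▸ hl.2) (hk.put hs.1) (by omega) i (by omega)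
      simpa [ds] using this
    | zero =>
      cases l with
      | nil => simp at hi
      | cons y l =>
        rw [slide_cons]
        simp only [ds, List.getD_cons_zero, List.getD_cons_succ]
        refine (sl_des h hd hl.1 hl.2.1 ?_).symm
        rintro ⟨h1, _⟩
        have := dk_nd [d] hk ⟨hd, trivial⟩ (by simp; omega) d (by simp)
        omega

end CD

namespace CD

def rc (l : List Cell) (a : ℕ) : ℕ := l.countP (fun c => decide (c.1 = a))

theorem rc_append (l l' : List Cell) (a : ℕ) : rc (l ++ l') a = rc l a + rc l' a := by
  simp [rc]

theorem rc_cons (c : Cell) (l : List Cell) (a : ℕ) :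
    rc (c :: l) a = rc l a + if c.1 = a then 1 else 0 := by
  simp [rc, List.countP_cons]

theorem puts_R (l : List Cell) : ∀ {s : Sh}, Valid s l → ∀ a, (puts s l).R a = s.R a + rc l a := by
  induction l with
  | nil => intro s _ a; simp [puts, rc]
  | cons c l ih =>
    intro s h a
    have := ih h.2 a
    simp only [puts, List.foldl_cons] at this ⊢
    rw [this, rc_cons]
    have h1 := h.1.1
    simp only [put]
    by_cases e : a = c.1
    · subst e; simp; omega
    · have : ¬ c.1 = a := fun h => e h.symm
      simp [e, this]

theorem valid_ext (l : List Cell) : ∀ {s : Sh} {l' : List Cell}, Valid s l → Valid s l' →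
    l.map Prod.fst = l'.map Prod.fst → l = l' := by
  induction l with
  | nil => intro s l' _ _ h; simpa using h
  | cons c l ih =>
    intro s l' h h' e
    cases l' with
    | nil => simp at e
    | cons c' l' =>
      simp only [List.map_cons, List.cons.injEq] at e
      have : c = c' := Prod.ext e.1 (by rw [← h.1.1, ← h'.1.1, e.1])
      subst this
      rw [ih h.2 h'.2 e.2]

theorem valid_append (l : List Cell) : ∀ {s : Sh} {l' : List Cell},
    Valid s (l ++ l') ↔ Valid s l ∧ Valid (puts s l) l' := by
  induction l with
  | nil => intro s l'; simp [Valid, puts]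
  | cons c l ih =>
    intro s l'
    simp only [List.cons_append, Valid, ih, puts, List.foldl_cons, and_assoc]

theorem puts_append (s : Sh) (l l' : List Cell) : puts s (l ++ l') = puts (puts s l) l' := by
  simp [puts]

theorem valid_rows {s : Sh} (h : Ok s) {M : ℕ} (hs : ∀ a, s.R a = max M a) {l : List Cell}
    (hl : Valid s l) {a : ℕ} (ha : a + 1 ≤ M) : rc l (a+1) ≤ rc l a := by
  have h1 := puts_R l hl a
  have h2 := puts_R l hl (a+1)
  have h3 := Ok.puts (s := s) l h hl
  rw [hs] at h1 h2
  by_contra hh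
  have e1 := h3.mem (a+1) (M + rc l (a+1) - 1) (by omega)
  have e2 := h3.mem a (M + rc l (a+1) - 1) (by omega)
  omega

def wd (n : ℕ) (l : List Cell) : List ℕ := l.map (fun c => n - c.1)

theorem wd_count {n : ℕ} {l : List Cell} (hl : ∀ c ∈ l, c.1 < n) {y : ℕ} (h1 : 0 < y) (h2 : y ≤ n) :
    (wd n l).count y = rc l (n - y) := by
  unfold wd rc
  rw [List.count, List.countP_map]
  apply List.countP_congr
  intro c hc
  have := hl c hc
  simp only [Function.comp, beq_iff_eq, decide_eq_true_eq]
  omega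

theorem wd_count0 {n : ℕ} {l : List Cell} (hl : ∀ c ∈ l, c.1 < n) {y : ℕ} (h1 : y = 0 ∨ n < y) :
    (wd n l).count y = 0 := by
  rw [List.count_eq_zero]
  intro h
  simp only [wd, List.mem_map] at h
  obtain ⟨c, hc, e⟩ := h
  have := hl c hc
  omega

structure SqT (n M : ℕ) (T : List Cell) : Prop where
  v : Valid (dl M) T
  r : ∀ a, rc T a = if a < n then n else 0
  len : T.length = n * n

theorem SqT.lt {n M T} (h : SqT n M T) : ∀ c ∈ T, c.1 < n := by
  intro c hc
  by_contra hh
  have h1 := h.r c.1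
  rw [if_neg hh] at h1
  unfold rc at h1
  rw [List.countP_eq_zero] at h1
  exact h1 c hc (by simp)

theorem dom_of {n M : ℕ} (hM : n ≤ M) {l : List Cell} (hv : Valid (dl M) l) (hl : ∀ c ∈ l, c.1 < n) :
    Dom 0 n (wd n l) := by
  refine ⟨?_, ?_⟩
  · intro x hx
    simp only [wd, List.mem_map] at hx
    obtain ⟨c, hc, e⟩ := hx
    have := hl c hc
    omega
  · intro u v e y hy
    unfold wd at e
    obtain ⟨l1, l2, rfl, rfl, rfl⟩ := List.map_eq_append_iff.1 e
    have hl1 : ∀ c ∈ l1, c.1 < n := fun c hc => hl c (List.mem_append_left _ hc)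
    change (wd n l1).count y ≤ (wd n l1).count (y+1)
    by_cases hy0 : y = 0
    · rw [wd_count0 hl1 (Or.inl hy0)]; omega
    · rw [wd_count hl1 (by omega) (by omega), wd_count hl1 (by omega) (by omega)]
      have := valid_rows (dl_ok M) (M := M) (fun a => rfl) ((valid_append l1).1 hv).1
        (a := n - (y+1)) (by omega)
      rwa [show n - (y+1) + 1 = n - y by omega] at this

theorem pw_valid (s : Sh) (h : Ok s) (w : List ℕ) : Valid s (Pw s w) :=
  (outs_valid w s [] h trivial).1

theorem pw_wd {n M : ℕ} {l : List Cell} (hM : l.length + n ≤ M) (hv : Valid (dl M) l)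
    (hl : ∀ c ∈ l, c.1 < n) : Pw (dl M) (wd n l) = l := by
  apply valid_ext _ (pw_valid _ (dl_ok M) _) hv
  rw [dom_rows _ (dom_of (by omega) hv hl) (by simpa [wd] using hM)]
  unfold wd
  rw [List.map_map]
  apply List.map_congr_left
  intro c hc
  have := hl c hc
  simp only [Function.comp]; omega

theorem SqT.sq {n M T} (hM : n ≤ M) (h : SqT n M T) : Sq 0 n (wd n T) := by
  have hd := dom_of hM h.v h.lt
  have hc : ∀ y, 0 < y → y ≤ 0 + n → (wd n T).count y = n := by
    intro y h1 h2
    rw [wd_count h.lt h1 (by omega), h.r, if_pos (by omega)]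
  refine ⟨fun x hx => by have := hd.1 x hx; omega, hc, fun x hx => (hd.1 x hx).1, ?_⟩
  intro u v e y hy
  by_cases h1 : y < n
  · have e1 := hc y hy (by omega)
    have e2 := hc (y+1) (by omega) (by omega)
    have e3 := hd.2 u v e y h1
    rw [e, List.count_append] at e1 e2
    omega
  · have e2 : (wd n T).count (y+1) = 0 := wd_count0 h.lt (by omega)
    rw [e, List.count_append] at e2
    omega

def prm : List Cell → List Cell
  | [] => []
  | c :: l => slide c l ++ [hole c l]

theorem prm_length (l : List Cell) : (prm l).length = l.length := by
  cases l <;> simp [prm, slide_length]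

theorem prm_valid {s : Sh} (h : Ok s) {l : List Cell} (hl : Valid s l) :
    Valid s (prm l) ∧ puts s (prm l) = puts s l := by
  cases l with
  | nil => exact ⟨trivial, rfl⟩
  | cons c l =>
    have := slide_valid l s c h hl.1 hl.2
    refine ⟨(valid_append _).2 ⟨this.1, this.2.1, trivial⟩, ?_⟩
    simp only [prm, puts_append]
    exact this.2.2

theorem rc_of_puts {s : Sh} {l l' : List Cell} (hl : Valid s l) (hl' : Valid s l')
    (e : puts s l = puts s l') (a : ℕ) : rc l a = rc l' a := by
  have h1 := puts_R l hl a
  have h2 := puts_R l' hl' a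
  rw [e] at h1; omega

theorem SqT.prm {n M T} (h : SqT n M T) : SqT n M (prm T) := by
  have := prm_valid (dl_ok M) h.v
  exact ⟨this.1, fun a => by rw [rc_of_puts this.1 h.v this.2, h.r], by rw [prm_length, h.len]⟩

theorem prm_dropLast (c : Cell) (l : List Cell) : (CD.prm (c :: l)).dropLast = slide c l := by
  simp [CD.prm]

/-- first letter removal on a Pw-list over any base -/
theorem slide_head_dl {M : ℕ} {x : ℕ} {w : List ℕ} (hw : w.length < M) :
    (CD.prm (Pw (dl M) (x :: w))).dropLast = Pw (dl M) w := by
  rw [Pw_cons]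
  have : (dl M).R 0 = M := by simp [dl]
  rw [this, prm_dropLast, slide_first_dl M x w hw]

theorem slide_head_em {x : ℕ} {w : List ℕ} :
    (CD.prm (Pw em (x :: w))).dropLast = Pw em w := by
  rw [Pw_cons]
  have : em.R 0 = 0 := by simp [em]
  rw [this, prm_dropLast, slide_first_em x w]

theorem pw_append (s : Sh) (w w' : List ℕ) :
    Pw s (w ++ w') = Pw s w ++ outs s (state s [] w) w' := outs_append w w' s []

theorem pw_length (s : Sh) (w : List ℕ) : (Pw s w).length = w.length := outs_length w s []

theorem pw_take (s : Sh) (w : List ℕ) (k : ℕ) : (Pw s w).take k = Pw s (w.take k) := by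
  conv_lhs => rw [← List.take_append_drop k w, pw_append]
  by_cases hk : k ≤ w.length
  · rw [List.take_append_of_le_length (by simp [pw_length]; omega), List.take_of_length_le]
    simp [pw_length]
  · rw [List.drop_of_length_le (by omega)]
    simp only [outs, List.append_nil]
    rw [List.take_of_length_le]
    simp [pw_length]

theorem pw_dropLast (s : Sh) (w : List ℕ) : (Pw s w).dropLast = Pw s w.dropLast := by
  rw [List.dropLast_eq_take, List.dropLast_eq_take, pw_take, pw_length]

/-- step 3 -/
theorem SqT.key {n M T} (hM : n * n + n < M) (h : SqT n M T) :
    Pw (dl M) (wd n T).tail = Pw (dl M) (wd n (CD.prm T)).dropLast := by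
  have h2 := h.prm
  rw [← pw_dropLast, pw_wd (by rw [h2.len]; omega) h2.v h2.lt]
  cases hT : wd n T with
  | nil =>
    have : T = [] := by simpa [wd] using hT
    subst this; simp [CD.prm, Pw, outs]
  | cons x w =>
    have h3 := pw_wd (by rw [h.len]; omega) h.v h.lt
    have hl : (wd n T).length = n * n := by rw [← h.len]; simp [wd]
    rw [hT] at h3 hl
    rw [← h3, slide_head_dl (by simp at hl; omega)]
    rfl

end CD

namespace CD

def mid (M j : ℕ) : Sh :=
  ⟨fun a => if a < j then M + 1 else max M a,
   fun b => if b < M then b + 1 else if b = M then j else 0⟩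

theorem mid_zero (M : ℕ) : mid M 0 = dl M := by
  simp [mid, dl]

theorem mid_top (M : ℕ) : mid M (M+1) = dl (M+1) := by
  simp only [mid, dl, Sh.mk.injEq]
  constructor
  · funext a; split <;> omega
  · funext a; split_ifs <;> omega

theorem mid_put {M j : ℕ} (hj : j ≤ M) :
    Ad (mid M j) (j, M) ∧ put (mid M j) (j, M) = mid M (j+1) := by
  refine ⟨⟨by simp [mid]; omega, by simp [mid]⟩, ?_⟩
  simp only [mid, put, Sh.mk.injEq]
  constructor
  · funext a; split_ifs <;> omega
  · funext a; split_ifs <;> omega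

theorem mid_chain {M : ℕ} {U : List Cell} (h : Valid em U ∧ puts em U = dl M) : ∀ j, j ≤ M + 1 →
    ∃ U, Valid em U ∧ puts em U = mid M j := by
  intro j
  induction j with
  | zero => intro _; exact ⟨U, h.1, by rw [h.2, mid_zero]⟩
  | succ j ih =>
    intro hj
    obtain ⟨V, h1, h2⟩ := ih (by omega)
    have := mid_put (M := M) (j := j) (by omega)
    refine ⟨V ++ [(j, M)], (valid_append _).2 ⟨h1, by rw [h2]; exact this.1, trivial⟩, ?_⟩
    rw [puts_append, h2]
    exact this.2

theorem dl_chain (M : ℕ) : ∃ U, Valid em U ∧ puts em U = dl M := by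
  induction M with
  | zero => exact ⟨[], trivial, by simp [puts, em, dl]⟩
  | succ M ih =>
    obtain ⟨U, hU⟩ := ih
    have := mid_chain hU (M+1) le_rfl
    rwa [mid_top] at this

def rect (U l : List Cell) : List Cell := U.foldr slide l

theorem rect_Pw (U : List Cell) : ∀ {s : Sh} (w : List ℕ), Ok s → Valid s U →
    rect U (Pw (puts s U) w) = Pw s w := by
  induction U with
  | nil => intros; rfl
  | cons c U ih =>
    intro s w h hU
    simp only [rect, List.foldr_cons, puts, List.foldl_cons]
    have := ih w (h.put hU.1) hU.2
    simp only [rect, puts] at this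
    rw [this]
    exact slide_Pw h hU.1 w

theorem pw_em_congr {M : ℕ} {u v : List ℕ} (h : Pw (dl M) u = Pw (dl M) v) : Pw em u = Pw em v := by
  obtain ⟨U, h1, h2⟩ := dl_chain M
  rw [← rect_Pw U u em_ok h1, ← rect_Pw U v em_ok h1, h2, h]

theorem last_ext {s : Sh} {l l' : List Cell} (h : Valid s l) (h' : Valid s l')
    (hd : l.dropLast = l'.dropLast) (hl : l.length = l'.length) (hr : ∀ a, rc l a = rc l' a) :
    l = l' := by
  rcases List.eq_nil_or_concat l with rfl | ⟨L, x, rfl⟩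
  · simp at hl; exact (List.eq_nil_of_length_eq_zero hl.symm).symm
  · rcases List.eq_nil_or_concat l' with rfl | ⟨L', y, rfl⟩
    · simp at hl
    · simp only [List.concat_eq_append, List.dropLast_concat] at *
      subst hd
      apply valid_ext _ h h'
      have := hr x.1
      rw [rc_append, rc_append, rc_cons, rc_cons] at this
      by_cases e : y.1 = x.1
      · simp [e]
      · simp [e] at this

def HH (n : ℕ) (T : List Cell) : List Cell := Pw em (wd n T)

theorem HH_length (n : ℕ) (T : List Cell) : (HH n T).length = T.length := by
  simp [HH, pw_length, wd]

theorem HH_prm {n M T} (hM : n * n + n < M) (h : SqT n M T) : HH n (prm T) = prm (HH n T) := by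
  have hv : Valid em (HH n T) := pw_valid em em_ok _
  have hp := prm_valid em_ok hv
  apply last_ext (pw_valid em em_ok _) hp.1
  · unfold HH
    rw [pw_dropLast, ← pw_em_congr (h.key hM)]
    cases hT : wd n T with
    | nil => simp [prm, Pw, outs]
    | cons x w => rw [slide_head_em]; rfl
  · rw [prm_length, HH_length]; simp [pw_length, wd, prm_length]
  · intro a
    rw [rc_of_puts hp.1 hv hp.2]
    exact (sq_rows a (h.prm.sq (by omega))).trans (sq_rows a (h.sq (by omega))).symm

theorem SqT.iter {n M T} (h : SqT n M T) (k : ℕ) : SqT n M (CD.prm^[k] T) := by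
  induction k with
  | zero => exact h
  | succ k ih => rw [Function.iterate_succ_apply']; exact ih.prm

theorem HH_iter {n M T} (hM : n * n + n < M) (h : SqT n M T) (k : ℕ) :
    HH n (prm^[k] T) = prm^[k] (HH n T) := by
  induction k with
  | zero => rfl
  | succ k ih =>
    rw [Function.iterate_succ_apply', Function.iterate_succ_apply', HH_prm hM (h.iter k), ih]

theorem pw_drop_congr {M : ℕ} (k : ℕ) : ∀ {u v : List ℕ}, u.length ≤ M → v.length ≤ M →
    Pw (dl M) u = Pw (dl M) v → Pw (dl M) (u.drop k) = Pw (dl M) (v.drop k) := by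
  induction k with
  | zero => intro u v _ _ h; exact h
  | succ k ih =>
    intro u v hu hv h
    have hl : u.length = v.length := by rw [← pw_length (dl M) u, h, pw_length]
    cases u with
    | nil => cases v with
      | nil => rfl
      | cons => simp at hl
    | cons x u => cases v with
      | nil => simp at hl
      | cons y v =>
        simp only [List.length_cons] at hu hv
        simp only [List.drop_succ_cons]
        apply ih (by omega) (by omega)
        rw [← slide_head_dl (x := x) (w := u) (by omega), ← slide_head_dl (x := y) (w := v) (by omega), h]

theorem iter_take {n M : ℕ} (hM : n * n + n < M) (k : ℕ) : ∀ {T}, SqT n M T → k ≤ n * n →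
    (prm^[k] T).take (n * n - k) = Pw (dl M) ((wd n T).drop k) := by
  induction k with
  | zero =>
    intro T h _
    rw [List.drop_zero, pw_wd (by rw [h.len]; omega) h.v h.lt, List.take_of_length_le]
    · rfl
    · simp [h.len]
  | succ k ih =>
    intro T h hk
    have h1 := ih h.prm (by omega)
    have hlen : (wd n T).length = n * n := by simp [wd, h.len]
    have hlen' : (wd n (prm T)).length = n * n := by simp [wd, h.prm.len]
    rw [Function.iterate_succ_apply]
    have h2 : (prm^[k] (prm T)).take (n * n - (k+1)) =
      ((prm^[k] (prm T)).take (n * n - k)).take (n*n - (k+1)) := by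
      rw [List.take_take]; congr 1; omega
    rw [h2, h1, pw_take]
    have h3 := pw_drop_congr k (by simp [hlen]; omega) (by simp [hlen']; omega) (h.key hM)
    rw [List.dropLast_eq_take, List.drop_take, hlen'] at h3
    rw [show n * n - (k+1) = n * n - 1 - k by omega, ← h3]
    simp [List.drop_tail]

theorem iter_rc {n M : ℕ} (hM : n * n + n < M) {T} (h : SqT n M T) {k : ℕ} (hk : k ≤ n * n)
    {a : ℕ} (ha : a < n) :
    rc ((prm^[k] T).take (n * n - k)) a + rc (T.take k) (n - 1 - a) = n := by
  have hsq := h.sq (by omega)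
  have hlen : (wd n T).length = n * n := by simp [wd, h.len]
  have hlat : Lat 0 ((wd n T).drop k) := by
    refine ⟨fun x hx => hsq.lat.1 x (List.mem_of_mem_drop hx), fun u v e y hy => ?_⟩
    refine hsq.lat.2 ((wd n T).take k ++ u) v ?_ y hy
    rw [List.append_assoc, ← e, List.take_append_drop]
  have h1 := lat_rows (M := M) a hlat (by simp [hlen]; omega)
  rw [← iter_take hM k h hk] at h1
  unfold rc at ⊢
  rw [h1]
  have h2 := hsq.cnt (0 + 1 + a) (by omega) (by omega)
  rw [← List.take_append_drop k (wd n T), List.count_append] at h2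
  have h3 : (wd n T).take k = wd n (T.take k) := by simp [wd, List.map_take]
  rw [h3, wd_count (fun c hc => h.lt c (List.mem_of_mem_take hc)) (by omega) (by omega)] at h2
  unfold rc at h2
  rw [show n - (0 + 1 + a) = n - 1 - a by omega] at h2
  omega

theorem rows_ext (l : List Cell) : ∀ {l' : List Cell}, l.length = l'.length →
    (∀ k a, rc (l.take k) a = rc (l'.take k) a) → l.map Prod.fst = l'.map Prod.fst := by
  induction l with
  | nil => intro l' e _; rw [List.eq_nil_of_length_eq_zero e.symm]
  | cons c l ih =>
    intro l' e h
    cases l' with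
    | nil => simp at e
    | cons c' l' =>
      have h1 := h 1 c.1
      have hh : c'.1 = c.1 := by
        by_contra hh
        simp [rc, hh] at h1
      simp only [List.map_cons, hh]
      congr 1
      apply ih (by simpa using e)
      intro k a
      have := h (k+1) a
      simp only [List.take_succ_cons, rc_cons, hh] at this
      omega

theorem SqT.period {n M T} (hM : n * n + n < M) (h : SqT n M T) : CD.prm^[n * n] T = T := by
  have h' := h.iter (n * n)
  apply valid_ext _ h'.v h.v
  apply rows_ext _ (by rw [h'.len, h.len])
  have key : ∀ k a, k ≤ n * n → rc ((CD.prm^[n * n] T).take k) a = rc (T.take k) a := by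
    intro k a hk
    by_cases ha : a < n
    · have e1 := iter_rc hM h hk (a := n - 1 - a) (by omega)
      have e2 := iter_rc hM (h.iter k) (k := n * n - k) (by omega) ha
      rw [← Function.iterate_add_apply, show n * n - k + k = n * n by omega,
        show n * n - (n * n - k) = k by omega] at e2
      rw [show n - 1 - (n - 1 - a) = a by omega] at e1
      omega
    · have z : ∀ l : List Cell, (∀ c ∈ l, c.1 < n) → rc l a = 0 := by
        intro l hl
        unfold rc
        rw [List.countP_eq_zero]
        intro c hc
        have := hl c hc
        simp; omega
      rw [z _ (fun c hc => h'.lt c (List.mem_of_mem_take hc)),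
        z _ (fun c hc => h.lt c (List.mem_of_mem_take hc))]
  intro k a
  by_cases hk : k ≤ n * n
  · exact key k a hk
  · have e := key (n*n) a le_rfl
    rw [List.take_of_length_le (by rw [h'.len]), List.take_of_length_le (by rw [h.len])] at e
    rw [List.take_of_length_le (by rw [h'.len]; omega), List.take_of_length_le (by rw [h.len]; omega), e]

end CD

namespace CD

theorem prm_ds {n M T} (hM : n * n + n < M) (h : SqT n M T) {i : ℕ} (hi : i + 2 < n * n) :
    ds (prm T) i ↔ ds T (i+1) := by
  have hl := h.len
  have hv := h.v
  cases T with
  | nil => rw [List.length_nil] at hl; omega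
  | cons c l =>
    simp only [List.length_cons] at hl
    have := slide_ds (M := M) l (dl_ok M) hv.1 hv.2 (dk_dl M) (by omega) i (by omega)
    have e : ds (c :: l) (i+1) ↔ ds l i := by simp [ds]
    rw [e, ← this]
    unfold ds prm
    rw [List.getD_append _ _ _ _ (by rw [slide_length]; omega),
      List.getD_append _ _ _ _ (by rw [slide_length]; omega)]

theorem iter_ds {n M : ℕ} (hM : n * n + n < M) (j : ℕ) : ∀ {T}, SqT n M T → ∀ {i},
    i + j + 1 < n * n → (ds (prm^[j] T) i ↔ ds T (i+j)) := by
  induction j with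
  | zero => intros; rfl
  | succ j ih =>
    intro T h i hi
    rw [Function.iterate_succ_apply, ih h.prm (by omega), prm_ds hM h (by omega)]
    rfl

theorem rect_valid (U : List Cell) : ∀ {s : Sh} {l : List Cell}, Ok s → Valid s U →
    Valid (puts s U) l → Valid s (rect U l) := by
  induction U with
  | nil => intro s l _ _ h; exact h
  | cons c U ih =>
    intro s l h hU hl
    exact (slide_valid _ s c h hU.1 (ih (h.put hU.1) hU.2 hl)).1

theorem last_two {n : ℕ} (U : List Cell) : ∀ {s : Sh} {l : List Cell} {x y : Cell}, Ok s →
    Valid s U → Valid (puts s U) (l ++ [x, y]) → y.1 < n →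
    ∃ l' x' y', rect U (l ++ [x, y]) = l' ++ [x', y'] ∧ y'.1 ≤ y.1 ∧
      (2 * n ≤ y'.1 + y'.2 + 2 → (x.1 < y.1 ↔ x'.1 < y'.1)) := by
  induction U with
  | nil => intro s l x y _ _ _ _; exact ⟨l, x, y, rfl, le_rfl, fun _ => Iff.rfl⟩
  | cons c U ih =>
    intro s l x y h hU hl hy
    have hok := h.put hU.1
    obtain ⟨l', x', y', e, h1, h2⟩ := ih hok hU.2 hl hy
    have hv := rect_valid U hok hU.2 hl
    rw [e, valid_append] at hv
    have hsv := slide_valid l' s c h hU.1 hv.1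
    obtain ⟨g1, g2, g3⟩ := hsv
    have g0 := Ok.puts (s := s) _ h g1
    obtain ⟨hx, hy', -⟩ := hv.2
    rw [← g3] at hx hy'
    generalize puts s (slide c l') = t at *
    refine ⟨slide c l', (sl (hole c l') x').1, (sl (sl (hole c l') x').2 y').1, ?_, ?_, ?_⟩
    · change slide c (rect U (l ++ [x, y])) = _
      rw [e, slide_append, slide_cons, slide_cons]; rfl
    · exact (sl_le _ _).1.trans h1
    · intro hh
      have hle := (sl_le (sl (hole c l') x').2 y').2
      rw [h2 (by omega)]
      refine sl_des g0 g2 hx hy' ?_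
      rintro ⟨ha, hb⟩
      generalize hole c l' = d at *
      obtain ⟨a, b⟩ := d
      simp only at ha
      subst ha
      subst hb
      have q1 := g0.mem a (a+1) (by omega)
      have r1 := g2.1
      have r2 := hx.1
      have r3 := hx.2
      have r4 := hy'.2
      obtain ⟨xa, xb⟩ := x'
      simp only [put] at r1 r2 r3 r4 q1
      have hxx : xa = a ∧ xb = a + 1 := by
        split_ifs at r4 r2 r3 <;> omega
      obtain ⟨rfl, rfl⟩ := hxx
      simp [sl, adj] at hh
      omega

structure Db (n : ℕ) (S : List Cell) : Prop where
  v : Valid em S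
  r : ∀ a, rc S a = 2 * n - 1 - 2 * a
  len : S.length = n * n

theorem HH_db {n M T} (hM : n * n + n < M) (h : SqT n M T) : Db n (HH n T) :=
  ⟨pw_valid em em_ok _, fun a => sq_rows a (h.sq (by omega)), by rw [HH_length, h.len]⟩

theorem Db.prm {n S} (h : Db n S) : Db n (prm S) := by
  have := prm_valid em_ok h.v
  exact ⟨this.1, fun a => by rw [rc_of_puts this.1 h.v this.2, h.r], by rw [prm_length, h.len]⟩

theorem Db.last {n l y} (h : Db n (l ++ [y])) : y.1 + y.2 + 2 = 2 * n ∧ y.1 < n := by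
  have hv := (valid_append l).1 h.v
  have h1 := puts_R _ h.v y.1
  rw [h.r, puts_append] at h1
  simp only [puts, List.foldl_cons, List.foldl_nil, put, if_true, em] at h1
  have h2 := h.r y.1
  rw [rc_append, rc_cons] at h2
  simp at h2
  have h3 := Ad.le (Ok.puts (s := em) _ em_ok hv.1) hv.2.1
  omega

theorem exists_last_two {l : List Cell} (h : 2 ≤ l.length) : ∃ m x y, l = m ++ [x, y] := by
  rcases List.eq_nil_or_concat l with rfl | ⟨L, y, rfl⟩
  · simp at h
  · rcases List.eq_nil_or_concat L with rfl | ⟨m, x, rfl⟩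
    · simp at h
    · exact ⟨m, x, y, by simp⟩

theorem ds_last (m : List Cell) (x y : Cell) : ds (m ++ [x, y]) ((m ++ [x,y]).length - 2) ↔ x.1 < y.1 := by
  simp [ds]

theorem HH_ds {n M T} (hn : 2 ≤ n) (hM : n * n + n < M) (h : SqT n M T) :
    ds T (n * n - 2) ↔ ds (HH n T) (n * n - 2) := by
  have hN : 2 ≤ n * n := by nlinarith
  obtain ⟨m, x, y, rfl⟩ := exists_last_two (l := T) (by rw [h.len]; exact hN)
  obtain ⟨U, h1, h2⟩ := dl_chain M
  have hr : HH n (m ++ [x, y]) = rect U (m ++ [x, y]) := by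
    unfold HH
    rw [← rect_Pw U _ em_ok h1, h2, pw_wd (by rw [h.len]; omega) h.v h.lt]
  have hv := h.v
  rw [← h2] at hv
  obtain ⟨l', x', y', e, e1, e2⟩ := last_two (n := n) U em_ok h1 hv (h.lt y (by simp))
  have hdb := HH_db hM h
  rw [hr, e] at hdb ⊢
  have hd' : Db n ((l' ++ [x']) ++ [y']) := by simpa using hdb
  have e3 := e2 (by have := hd'.last.1; omega)
  have a1 := ds_last m x y
  have a2 := ds_last l' x' y'
  rw [h.len] at a1
  rw [hdb.len] at a2
  rw [a1, a2, e3]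

def lr (n : ℕ) (S : List Cell) : ℕ := (S.getD (n * n - 1) (0,0)).1

theorem Db.second {n S} (hn : 2 ≤ n) (h : Db n S) :
    ((CD.prm S).getD (n * n - 2) (0,0)).1 = lr n S := by
  have hN : 2 ≤ n * n := by nlinarith
  have hlen := h.len
  cases S with
  | nil => simp at hlen; omega
  | cons c l =>
    rcases List.eq_nil_or_concat l with rfl | ⟨m, z, rfl⟩
    · simp at hlen; omega
    · simp only [List.concat_eq_append] at *
      simp only [List.length_cons, List.length_append, List.length_nil] at hlen
      have e1 : lr n (c :: (m ++ [z])) = z.1 := by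
        unfold lr
        rw [show n * n - 1 = m.length + 1 by omega]
        simp
      have hh : CD.prm (c :: (m ++ [z])) = slide c m ++ [(sl (hole c m) z).1, (sl (hole c m) z).2] := by
        simp only [CD.prm, slide_append, hole_append]
        simp [slide_cons, slide, hole, sl]
        split_ifs <;> rfl
      have e2 : ((CD.prm (c :: (m ++ [z]))).getD (n * n - 2) (0,0)) = (sl (hole c m) z).1 := by
        rw [hh, show n * n - 2 = (slide c m).length by rw [slide_length]; omega]
        simp
      rw [e1, e2]
      have hdb' : Db n ((c :: m) ++ [z]) := h
      have hz := hdb'.last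
      obtain ⟨hc, hv⟩ := h.v
      rw [valid_append] at hv
      have hsv := slide_valid m em c em_ok hc hv.1
      by_cases ha : adj (hole c m) z
      · simp only [sl, ha, if_true]
        rcases ha with ha | ha
        · exact ha.1.symm
        · exfalso
          have hR := puts_R _ h.v (hole c m).1
          rw [h.r] at hR
          have : puts em (c :: (m ++ [z])) = put (put (puts em (slide c m)) (hole c m)) z := by
            rw [hsv.2.2]; simp [puts]
          rw [this] at hR
          simp only [put, em] at hR
          rw [if_neg (by omega)] at hR
          simp at hR
          omega
      · simp [sl, ha]

theorem lr_lt {n S} (hn : 0 < n) (h : Db n S) : lr n S < n := by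
  rcases List.eq_nil_or_concat S with rfl | ⟨m, z, rfl⟩
  · simp [lr]; omega
  · simp only [List.concat_eq_append] at *
    have e1 : lr n (m ++ [z]) = z.1 := by
      unfold lr
      have := h.len
      simp at this
      rw [show n * n - 1 = m.length by omega]
      simp
    rw [e1]; exact h.last.2

theorem ds_lr {n M T} (hn : 2 ≤ n) (hM : n * n + n < M) (h : SqT n M T) (i : ℕ) :
    ds (prm^[i+1] T) (n * n - 2) ↔ lr n (prm^[i] (HH n T)) < lr n (prm^[i+1] (HH n T)) := by
  have hN : 2 ≤ n * n := by nlinarith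
  rw [HH_ds hn hM (h.iter (i+1)), HH_iter hM h, ← HH_iter hM h i]
  have h1 := (HH_db hM (h.iter i)).second hn
  unfold ds
  rw [← h1, HH_iter hM h, Function.iterate_succ_apply', show n * n - 2 + 1 = n * n - 1 by omega]
  rfl

theorem main_pos {n M T} (hn : 2 ≤ n) (hM : n * n + n < M) (h : SqT n M T) {i : ℕ} (h1 : 1 ≤ i)
    (h2 : i < n * n) :
    ds T (i - 1) ↔ lr n (prm^[i] (HH n T)) < lr n (prm^[i+1] (HH n T)) := by
  rw [← ds_lr hn hM h]
  have := iter_ds hM (n * n - i - 1) (h.iter (i+1)) (i := i - 1) (by omega)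
  rw [← Function.iterate_add_apply, show n * n - i - 1 + (i+1) = n * n by omega, h.period hM,
    show i - 1 + (n * n - i - 1) = n * n - 2 by omega] at this
  exact this

theorem main_zero {n M T} (hn : 2 ≤ n) (hM : n * n + n < M) (h : SqT n M T) :
    ds (prm T) (n * n - 2) ↔ lr n (prm^[n * n] (HH n T)) < lr n (prm^[1] (HH n T)) := by
  rw [← HH_iter hM h, h.period hM]
  exact ds_lr hn hM h 0

end CD

namespace CD

def fil : ℕ → List Cell → Cell → ℕ
  | _, [], _ => 0
  | k, x :: l, q => if q = x then k else fil (k+1) l q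

theorem fil_notmem (l : List Cell) : ∀ {k q}, q ∉ l → fil k l q = 0 := by
  induction l with
  | nil => intros; rfl
  | cons x l ih =>
    intro k q h
    simp only [List.mem_cons, not_or] at h
    simp [fil, h.1, ih h.2]

theorem fil_append (A : List Cell) : ∀ {k q} (B : List Cell), q ∉ A →
    fil k (A ++ B) q = fil (k + A.length) B q := by
  induction A with
  | nil => intros; rfl
  | cons x l ih =>
    intro k q B h
    simp only [List.mem_cons, not_or] at h
    simp only [List.cons_append, fil, h.1, if_false, ih B h.2, List.length_cons]
    congr 1; omega

theorem fil_ge (l : List Cell) : ∀ {k q}, fil k l q = 0 ∨ k ≤ fil k l q := by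
  induction l with
  | nil => intro k q; left; rfl
  | cons x l ih =>
    intro k q
    simp only [fil]
    split
    · right; exact le_rfl
    · rcases ih (k := k+1) (q := q) with h | h
      · left; exact h
      · right; omega

theorem fil_sub (l : List Cell) : ∀ {k q}, fil (k+1) l q - 1 = fil k l q := by
  induction l with
  | nil => intro k q; rfl
  | cons x l ih =>
    intro k q
    simp only [fil]
    split
    · rfl
    · exact ih

theorem fil_swap (A : List Cell) {c d : Cell} (B : List Cell) {q : Cell} (h1 : q ≠ c) (h2 : q ≠ d) :
    ∀ {k}, fil k (A ++ c :: B) q = fil k (A ++ d :: B) q := by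
  induction A with
  | nil => intro k; simp [fil, h1, h2]
  | cons x A ih =>
    intro k
    simp only [List.cons_append, fil]
    split
    · rfl
    · exact ih

theorem fil_at (A : List Cell) {c : Cell} (B : List Cell) (h : c ∉ A) {k} :
    fil k (A ++ c :: B) c = k + A.length := by
  rw [fil_append A _ h]; simp [fil]

theorem fil_some (l : List Cell) : ∀ {k q v}, fil k l q = v → v ≠ 0 →
    k ≤ v ∧ l[v - k]? = some q := by
  induction l with
  | nil => intro k q v h h'; exact absurd h.symm h'
  | cons x l ih =>
    intro k q v h h'
    simp only [fil] at h
    split at h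
    · rename_i e; subst e; subst h; simp
    · obtain ⟨h1, h2⟩ := ih h h'
      refine ⟨by omega, ?_⟩
      rw [show v - k = (v - (k+1)) + 1 by omega]
      simpa using h2

theorem fil_get (l : List Cell) (hl : l.Nodup) {i : ℕ} {q : Cell} (h : l[i]? = some q) {k : ℕ} :
    fil k l q = k + i := by
  obtain ⟨hi, hq⟩ := List.getElem?_eq_some_iff.1 h
  have e : l = l.take i ++ q :: l.drop (i+1) := by
    rw [← hq, List.getElem_cons_drop, List.take_append_drop]
  have hn : q ∉ l.take i := by
    intro hm
    rw [e] at hl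
    exact (List.disjoint_of_nodup_append hl) hm (by simp)
  conv_lhs => rw [e]
  rw [fil_at _ _ hn, List.length_take]
  congr 1; omega

theorem rowOf_fil {l : List Cell} (hl : l.Nodup) {v : ℕ} (h1 : 1 ≤ v) (h2 : v ≤ l.length) :
    rowOf (fil 1 l) v = (l.getD (v-1) (0,0)).1 := by
  have hg : l[v-1]? = some (l.getD (v-1) (0,0)) := by
    rw [List.getD_eq_getElem _ _ (by omega)]
    exact List.getElem?_eq_getElem _
  have : {a | ∃ b, fil 1 l (a, b) = v} = {(l.getD (v-1) (0,0)).1} := by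
    ext a
    simp only [Set.mem_ofPred_eq, Set.mem_singleton_iff]
    constructor
    · rintro ⟨b, hb⟩
      have := (fil_some l hb (by omega)).2
      rw [hg] at this
      have := Option.some.inj this
      rw [this]
    · rintro rfl
      refine ⟨(l.getD (v-1) (0,0)).2, ?_⟩
      have := fil_get l hl hg (k := 1)
      rw [Prod.mk.eta, this]; omega
  unfold rowOf
  rw [this, csInf_singleton]

def OO (l : List Cell) : Prop := l.Pairwise (fun x y => x ≠ y ∧ ¬ adj y x)

theorem OO.nodup {l} (h : OO l) : l.Nodup := h.imp (fun h => h.1)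

theorem OO.at {A : List Cell} {d : Cell} {B : List Cell} (h : OO (A ++ d :: B)) :
    (∀ x ∈ A, x ≠ d ∧ ¬ adj d x) ∧ (∀ y ∈ B, d ≠ y ∧ ¬ adj y d) := by
  unfold OO at h
  rw [List.pairwise_append] at h
  refine ⟨fun x hx => h.2.2 x hx d (by simp), ?_⟩
  have := h.2.1
  rw [List.pairwise_cons] at this
  exact this.1

theorem OO.swap {A : List Cell} {d c : Cell} {B : List Cell} (h : OO (A ++ d :: c :: B))
    (ha : ¬ adj d c) : OO (A ++ c :: d :: B) := by
  unfold OO at *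
  simp only [List.pairwise_append, List.pairwise_cons, List.mem_cons] at *
  obtain ⟨h1, ⟨h2, h3, h4⟩, h5⟩ := h
  refine ⟨h1, ⟨?_, fun y hy => h2 y (Or.inr hy), h4⟩, ?_⟩
  · rintro y (rfl | hy)
    · exact ⟨(h2 c (Or.inl rfl)).1.symm, ha⟩
    · exact h3 y hy
  · rintro x hx y (rfl | rfl | hy)
    · exact h5 x hx _ (Or.inr (Or.inl rfl))
    · exact h5 x hx _ (Or.inl rfl)
    · exact h5 x hx y (Or.inr (Or.inr hy))

theorem jdt_fil (rest : List Cell) : ∀ (fuel : ℕ) (dn : List Cell) (d : Cell), rest.length ≤ fuel →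
    OO (dn ++ d :: rest) →
    jdtSlide fuel (fil 1 (dn ++ rest)) d = (fil 1 (dn ++ slide d rest), hole d rest) ∧
    OO (dn ++ slide d rest ++ [hole d rest]) := by
  induction rest with
  | nil =>
    intro fuel dn d _ h
    refine ⟨?_, by simpa [slide, hole] using h⟩
    simp only [List.append_nil, slide, hole]
    cases fuel with
    | zero => rfl
    | succ fuel =>
      have h1 := h.at.1
      have e1 : fil 1 dn (d.1, d.2+1) = 0 := fil_notmem _ (fun hm => (h1 _ hm).2 (Or.inl ⟨rfl, rfl⟩))
      have e2 : fil 1 dn (d.1+1, d.2) = 0 := fil_notmem _ (fun hm => (h1 _ hm).2 (Or.inr ⟨rfl, rfl⟩))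
      simp [jdtSlide, e1, e2]
  | cons c rest ih =>
    intro fuel dn d hf h
    simp only [List.length_cons] at hf
    by_cases ha : adj d c
    · obtain ⟨fuel, rfl⟩ : ∃ m, fuel = m + 1 := ⟨fuel - 1, by omega⟩
      have h1 := h.at
      have h2 : OO ((dn ++ [d]) ++ c :: rest) := by simpa using h
      have h3 := h2.at
      have ih' := ih fuel (dn ++ [d]) c (by omega) h2
      simp only [slide, hole, ha, if_true]
      simp only [List.append_assoc, List.singleton_append] at ih'
      refine ⟨?_, by simpa using ih'.2⟩
      rw [← ih'.1]
      have hc : c ∉ dn := fun hm => (h3.1 c (by simp [hm])).1 rfl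
      have hd : d ∉ dn := fun hm => (h1.1 d hm).1 rfl
      have hcd : d ≠ c := (h1.2 c (by simp)).1
      have hcr : c ∉ rest := fun hm => (h3.2 c hm).1 rfl
      have ec : fil 1 (dn ++ c :: rest) c = 1 + dn.length := fil_at _ _ hc
      have eo : ∀ q, adj d q → q ≠ c → fil 1 (dn ++ c :: rest) q = 0 ∨
          1 + dn.length < fil 1 (dn ++ c :: rest) q := by
        intro q hq hqc
        have hqd : q ∉ dn := fun hm => (h1.1 q hm).2 hq
        rw [fil_append _ _ hqd]
        simp only [fil, if_neg hqc]
        rcases fil_ge rest (k := 1 + dn.length + 1) (q := q) with e | e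
        · left; exact e
        · right; omega
      have upd : Function.update (Function.update (fil 1 (dn ++ c :: rest)) c 0) d
          (fil 1 (dn ++ c :: rest) c) = fil 1 (dn ++ d :: rest) := by
        funext q
        by_cases hqd : q = d
        · subst hqd
          rw [Function.update_self, ec, fil_at _ _ hd]
        · rw [Function.update_of_ne hqd]
          by_cases hqc : q = c
          · subst hqc
            rw [Function.update_self, fil_notmem]
            simp [hc, hqd, hcr]
          · rw [Function.update_of_ne hqc]
            exact fil_swap _ _ hqc hqd
      rw [jdtSlide]
      rcases ha with ⟨a1, a2⟩ | ⟨a1, a2⟩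
      · have e : c = (d.1, d.2+1) := Prod.ext a1 a2
        have := eo (d.1+1, d.2) (Or.inr ⟨rfl, rfl⟩) (by rw [e]; intro hh; simp at hh)
        rw [← e, ec]
        rw [if_neg (by omega), if_pos (by omega)]
        rw [← ec, upd]
      · have e : c = (d.1+1, d.2) := Prod.ext a1 a2
        have := eo (d.1, d.2+1) (Or.inl ⟨rfl, rfl⟩) (by rw [e]; intro hh; simp at hh)
        rw [← e, ec]
        rw [if_neg (by omega), if_neg (by omega)]
        rw [← ec, upd]
    · have h2 := h.swap ha
      have ih' := ih fuel (dn ++ [c]) d (by omega) (by simpa using h2)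
      simp only [slide, hole, ha, if_false]
      simpa using ih'

theorem promote_fil {l : List Cell} (h : OO l) (h0 : l.head? = some (0,0)) :
    promote l.length (fil 1 l) = fil 1 (prm l) ∧ OO (prm l) := by
  cases l with
  | nil => simp at h0
  | cons c l =>
    simp only [List.head?_cons, Option.some.injEq] at h0
    subst h0
    have hj := jdt_fil l (l.length+1) [] (0,0) (by omega) h
    simp only [List.nil_append] at hj
    refine ⟨?_, hj.2⟩
    have hn : ((0,0) : Cell) ∉ l := (List.nodup_cons.1 h.nodup).1
    have e : (fun c => fil 1 ((0,0) :: l) c - 1) = fil 1 l := by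
      funext q
      by_cases hq : q = (0,0)
      · subst hq; rw [fil_notmem l hn]; simp [fil]
      · simp only [fil, if_neg hq]; exact fil_sub l
    unfold promote
    simp only [List.length_cons]
    rw [e, hj.1]
    simp only [prm]
    have hh : hole (0,0) l ∉ slide (0,0) l := by
      intro hm
      have := hj.2.nodup
      rw [List.nodup_append] at this
      exact this.2.2 _ hm _ (by simp) rfl
    funext q
    by_cases hq : q = hole (0,0) l
    · subst hq
      rw [Function.update_self, fil_at _ _ hh, slide_length]; omega
    · rw [Function.update_of_ne hq]
      by_cases hm : q ∈ slide (0,0) l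
      · obtain ⟨i, hi⟩ := List.getElem?_of_mem hm
        rw [fil_get _ (List.nodup_append.1 hj.2.nodup).1 hi,
          fil_get _ hj.2.nodup (i := i) (by
            rw [List.getElem?_append_left (by
              have := List.getElem?_eq_some_iff.1 hi; exact this.1)]; exact hi)]
      · rw [fil_notmem _ hm, fil_notmem]
        simp [hm, hq]

theorem valid_out (l : List Cell) : ∀ {s : Sh}, Ok s → Valid s l →
    ∀ y ∈ l, y.1 ≤ y.2 ∧ s.R y.1 ≤ y.2 := by
  induction l with
  | nil => simp
  | cons c l ih =>
    intro s h hl y hy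
    rcases List.mem_cons.1 hy with rfl | hy
    · exact ⟨Ad.le h hl.1, hl.1.1.le⟩
    · have := ih (h.put hl.1) hl.2 y hy
      refine ⟨this.1, ?_⟩
      have h2 := this.2
      have h3 := hl.1.1
      simp only [put] at h2
      split at h2
      · rename_i e; rw [e]; omega
      · exact h2

theorem valid_OO (l : List Cell) : ∀ {s : Sh}, Ok s → Valid s l → OO l := by
  induction l with
  | nil => intros; exact List.Pairwise.nil
  | cons c l ih =>
    intro s h hl
    have hok := h.put hl.1
    refine List.Pairwise.cons (fun y hy => ?_) (ih hok hl.2)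
    have h1 := valid_out l hok hl.2 y hy
    have hR : (put s c).R c.1 = c.2 + 1 := by simp [put]
    refine ⟨?_, ?_⟩
    · rintro rfl; omega
    · rintro (⟨e1, e2⟩ | ⟨e1, e2⟩)
      · rw [← e1] at h1; omega
      · have hle := Ad.le h hl.1
        have := hok.anti (a := y.1) (a' := c.1) (b := c.2) (by omega) hle (by omega)
        omega

theorem em_head {l : List Cell} (h : Valid em l) (hne : l ≠ []) : l.head? = some (0,0) := by
  cases l with
  | nil => exact absurd rfl hne
  | cons c l =>
    have h1 := h.1.1
    have h2 := h.1.2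
    simp only [em] at h1 h2
    simp only [List.head?_cons]
    congr 1
    exact Prod.ext h2.symm (by rw [← h1]; exact h2.symm)

theorem promote_iter {N : ℕ} (hN : 0 < N) {S : List Cell} (h : Valid em S) (hl : S.length = N) (k : ℕ) :
    (promote N)^[k] (fil 1 S) = fil 1 (prm^[k] S) ∧ Valid em (prm^[k] S) ∧ (prm^[k] S).length = N := by
  induction k with
  | zero => exact ⟨rfl, h, hl⟩
  | succ k ih =>
    obtain ⟨h1, h2, h3⟩ := ih
    simp only [Function.iterate_succ_apply', h1]
    refine ⟨?_, (prm_valid em_ok h2).1, by rw [prm_length, h3]⟩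
    have := (promote_fil (valid_OO _ em_ok h2) (em_head h2 (by
      intro e; rw [e] at h3; simp at h3; omega))).1
    rwa [h3] at this

end CD

namespace CD

theorem mem_put {s : Sh} {c : Cell} (hc : Ad s c) (q : Cell) :
    q.2 < (put s c).R q.1 ↔ (q.2 < s.R q.1 ∨ q = c) := by
  obtain ⟨h1, h2⟩ := hc
  obtain ⟨a, b⟩ := q
  obtain ⟨ca, cb⟩ := c
  simp only [put, Prod.mk.injEq] at *
  split
  · subst_vars; omega
  · rename_i e; simp [e]

theorem valid_of (l : List Cell) : ∀ {s : Sh}, Ok s →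
    (∀ u c v, l = u ++ c :: v → c.1 < c.2 ∧ ¬ c.2 < s.R c.1 ∧ c ∉ u ∧
      ((c.2 - 1 < s.R c.1) ∨ (c.1, c.2 - 1) ∈ u) ∧
      (c.1 = 0 ∨ c.2 < s.R (c.1 - 1) ∨ (c.1 - 1, c.2) ∈ u)) → Valid s l := by
  induction l with
  | nil => intros; trivial
  | cons d l ih =>
    intro s h H
    have had : Ad s d := by
      obtain ⟨h1, h2, -, h4, h5⟩ := H [] d l rfl
      simp only [List.not_mem_nil, or_false] at h4 h5
      have m1 := h.mem d.1 d.2 (by omega)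
      have m2 := h.mem (d.1 - 1) d.2 (by omega)
      refine ⟨by omega, ?_⟩
      omega
    refine ⟨had, ih (h.put had) ?_⟩
    intro u c v e
    obtain ⟨h1, h2, h3, h4, h5⟩ := H (d :: u) c v (by simp [e])
    simp only [List.mem_cons, not_or] at h3 h4 h5
    have k1 := mem_put had c
    have k2 := mem_put had (c.1, c.2 - 1)
    have k3 := mem_put had (c.1 - 1, c.2)
    simp only at k2 k3
    refine ⟨h1, ?_, h3.2, ?_, ?_⟩
    · rw [k1]; rintro (h | h)
      · exact h2 h
      · exact h3.1 h
    · rw [k2]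
      rcases h4 with h | h | h
      · exact Or.inl (Or.inl h)
      · exact Or.inl (Or.inr h)
      · exact Or.inr h
    · rw [k3]
      rcases h5 with h | h | h | h
      · exact Or.inl h
      · exact Or.inr (Or.inl (Or.inl h))
      · exact Or.inr (Or.inl (Or.inr h))
      · exact Or.inr (Or.inr h)

def tr (M : ℕ) (c : Cell) : Cell := (c.1, c.2 + M)

theorem tr_adj (M : ℕ) (c d : Cell) : adj (tr M c) (tr M d) ↔ adj c d := by
  simp only [adj, tr]; omega

theorem tr_slide (M : ℕ) (l : List Cell) : ∀ d,
    slide (tr M d) (l.map (tr M)) = (slide d l).map (tr M) ∧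
    hole (tr M d) (l.map (tr M)) = tr M (hole d l) := by
  induction l with
  | nil => intro d; exact ⟨rfl, rfl⟩
  | cons c l ih =>
    intro d
    simp only [List.map_cons, slide, hole, tr_adj]
    split
    · simp [ih c]
    · simp [ih d]

theorem tr_prm (M : ℕ) (l : List Cell) : prm (l.map (tr M)) = (prm l).map (tr M) := by
  cases l with
  | nil => rfl
  | cons c l =>
    have := tr_slide M l c
    simp [prm, this.1, this.2]

theorem sq_cell (n : ℕ) (c : Cell) : strCell (sqShape n) c ↔ c.1 < n ∧ c.2 < n := by
  unfold strCell sqShape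
  by_cases h : c.1 < n
  · rw [List.getD_eq_getElem _ _ (by simpa using h)]; simp [h]
  · rw [List.getD_eq_default _ _ (by simp; omega)]; simp [h]

theorem std_list {n : ℕ} {f : Cell → ℕ} (hf : IsStdFilling (strCell (sqShape n)) (n ^ 2) f)
    {M : ℕ} (hM : n < M) :
    ∃ T0 : List Cell, f = fil 1 T0 ∧ T0.length = n ^ 2 ∧ SqT n M (T0.map (tr M)) := by
  obtain ⟨f1, f2, f3, f4, f5, f6⟩ := hf
  simp only [sq_cell] at *
  choose g hg using fun i : Fin (n ^ 2) => f4 (i.1 + 1) (by omega) (by omega)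
  set T0 := List.ofFn g with hT0
  have hlen : T0.length = n ^ 2 := by simp [hT0]
  have hget : ∀ c : Cell, c.1 < n → c.2 < n → T0[f c - 1]? = some c := by
    intro c h1 h2
    have h3 := f2 c ⟨h1, h2⟩
    have hlt : f c - 1 < n ^ 2 := by omega
    rw [List.getElem?_eq_getElem (by omega)]
    simp only [hT0, List.getElem_ofFn]
    congr 1
    apply f3 _ _ (hg _).1 ⟨h1, h2⟩
    rw [(hg _).2]; simp only; omega
  have hidx : ∀ i c, T0[i]? = some c → (c.1 < n ∧ c.2 < n) ∧ f c = i + 1 := by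
    intro i c h
    obtain ⟨hi, e⟩ := List.getElem?_eq_some_iff.1 h
    simp only [hT0, List.getElem_ofFn] at e
    rw [← e]
    exact hg _
  have hnd : T0.Nodup := by
    rw [hT0, List.nodup_ofFn]
    intro i j e
    have h1 := (hg i).2
    have h2 := (hg j).2
    rw [e] at h1
    ext; omega
  have hmem : ∀ c, c ∈ T0 ↔ c.1 < n ∧ c.2 < n := by
    intro c
    constructor
    · intro h
      obtain ⟨i, hi⟩ := List.getElem?_of_mem h
      exact (hidx i c hi).1
    · intro h
      exact List.mem_of_getElem? (hget c h.1 h.2)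
  refine ⟨T0, ?_, hlen, ?_, ?_, ?_⟩
  · funext c
    by_cases hc : c.1 < n ∧ c.2 < n
    · rw [fil_get T0 hnd (hget c hc.1 hc.2)]
      have := f2 c hc; omega
    · rw [f1 c hc, fil_notmem]
      rw [hmem]; exact hc
  · apply valid_of _ (dl_ok M)
    intro u c' v e
    obtain ⟨u0, v1, e0, rfl, e1⟩ := List.map_eq_append_iff.1 e
    obtain ⟨c, v0, rfl, rfl, rfl⟩ := List.map_eq_cons_iff.1 e1
    have hi : T0[u0.length]? = some c := by rw [e0]; simp
    obtain ⟨⟨c1, c2⟩, hfc⟩ := hidx _ _ hi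
    have hin : ∀ q : Cell, q.1 < n → q.2 < n → f q < f c → tr M q ∈ u0.map (tr M) := by
      intro q h1 h2 h3
      apply List.mem_map_of_mem
      have := hget q h1 h2
      have h4 := f2 q ⟨h1, h2⟩
      rw [e0, List.getElem?_append_left (by omega)] at this
      exact List.mem_of_getElem? this
    obtain ⟨a, b⟩ := c
    simp only at c1 c2
    simp only [tr, dl]
    refine ⟨by omega, by omega, ?_, ?_, ?_⟩
    · intro hm
      rw [List.mem_map] at hm
      obtain ⟨q, hq, e⟩ := hm
      have : q = (a, b) := by
        simp only [tr, Prod.mk.injEq] at e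
        exact Prod.ext e.1 (by simp only; omega)
      subst this
      rw [e0] at hnd
      exact (List.disjoint_of_nodup_append hnd) hq (by simp)
    · by_cases hb : b = 0
      · left; omega
      · right
        have h5 := f5 a (b-1) ⟨by omega, by omega⟩ ⟨by omega, by omega⟩
        rw [show b - 1 + 1 = b by omega] at h5
        have := hin (a, b-1) (by simp only; omega) (by simp only; omega) h5
        simp only [tr] at this
        rwa [show b - 1 + M = b + M - 1 by omega] at this
    · by_cases ha : a = 0
      · left; exact ha
      · right; right
        have h5 := f6 (a-1) b ⟨by omega, by omega⟩ ⟨by omega, by omega⟩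
        rw [show a - 1 + 1 = a by omega] at h5
        exact hin (a-1, b) (by simp only; omega) (by simp only; omega) h5
  · intro a
    have e1 : rc (T0.map (tr M)) a = (T0.toFinset.filter (fun c => c.1 = a)).card := by
      unfold rc
      rw [List.countP_map, List.countP_eq_length_filter, ← List.toFinset_card_of_nodup (hnd.filter _)]
      congr 1
      ext c
      simp only [tr, Function.comp, List.mem_toFinset, List.mem_filter, Finset.mem_filter]
      exact and_congr_right fun _ => decide_eq_true_iff
    rw [e1]
    split
    · have : T0.toFinset.filter (fun c => c.1 = a) = (Finset.range n).image (fun b => (a, b)) := by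
        ext ⟨x, y⟩
        simp only [Finset.mem_filter, List.mem_toFinset, hmem, Finset.mem_image, Finset.mem_range,
          Prod.mk.injEq]
        constructor
        · rintro ⟨⟨_, h⟩, rfl⟩; exact ⟨y, h, rfl, rfl⟩
        · rintro ⟨b, h, rfl, rfl⟩; exact ⟨⟨by assumption, h⟩, rfl⟩
      rw [this, Finset.card_image_of_injective _ (fun x y h => by simpa using h), Finset.card_range]
    · rw [Finset.card_eq_zero, Finset.filter_eq_empty_iff]
      intro c hc
      rw [List.mem_toFinset, hmem] at hc
      omega
  · rw [List.length_map, hlen, pow_two]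

end CD

namespace CD

theorem padSet_length (l : List ℕ) {j v : ℕ} (h : j ≤ l.length) :
    (padSet l j v).length = if j = l.length then l.length + 1 else l.length := by
  unfold padSet
  split_ifs
  · omega
  · simp
  · simp; omega
  · omega

theorem padSet_getD (l : List ℕ) {j v i : ℕ} (h : j ≤ l.length) :
    (padSet l j v).getD i 0 = if i = j then v else l.getD i 0 := by
  unfold padSet
  split_ifs with h1 h2 h2
  · subst h2; simp [h1]
  · simp [List.getD_eq_getElem?_getD, List.getElem?_set, Ne.symm h2]
  · subst h2
    have : i = l.length := by omega
    subst this; simp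
  · have : j = l.length := by omega
    subst this
    simp only [Nat.sub_self, List.replicate_zero, List.append_nil]
    simp only [List.getD_eq_getElem?_getD]
    by_cases hi : i < l.length
    · rw [List.getElem?_append_left hi]
    · rw [List.getElem?_eq_none (by simp; omega), List.getElem?_eq_none (by omega)]

theorem row_set (T : List (List ℕ)) {r : ℕ} (h : r < T.length) (row : List ℕ) (r' : ℕ) :
    (T.set r row).getD r' [] = if r' = r then row else T.getD r' [] := by
  simp only [List.getD_eq_getElem?_getD, List.getElem?_set]
  by_cases e : r = r'
  · subst e; simp [h]
  · simp [e, Ne.symm e]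

theorem tsize_set (T : List (List ℕ)) : ∀ {r : ℕ}, r < T.length → ∀ (row : List ℕ),
    tsize (T.set r row) + (T.getD r []).length = tsize T + row.length := by
  induction T with
  | nil => intro r h; simp at h
  | cons t T ih =>
    intro r h row
    cases r with
    | zero => simp [tsize]; omega
    | succ r =>
      have := ih (r := r) (by simpa using h) row
      simp only [tsize, List.set_cons_succ, List.map_cons, List.sum_cons, List.getD_cons_succ] at *
      omega

theorem getD_pad (T : List (List ℕ)) (k r : ℕ) :
    (T ++ List.replicate k ([] : List ℕ)).getD r [] = T.getD r [] := by
  simp only [List.getD_eq_getElem?_getD]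
  by_cases h : r < T.length
  · rw [List.getElem?_append_left h]
  · rw [List.getElem?_append_right (by omega), List.getElem?_eq_none (l := T) (by omega)]
    rw [List.getElem?_replicate]; split <;> rfl

theorem tsize_pad (T : List (List ℕ)) (k : ℕ) :
    tsize (T ++ List.replicate k ([] : List ℕ)) = tsize T := by
  simp [tsize]

theorem row_setBox (T : List (List ℕ)) (r j v r' : ℕ) :
    (setBox T r j v).getD r' [] = if r' = r then padSet (T.getD r []) j v else T.getD r' [] := by
  unfold setBox
  split
  · rename_i h; simp only; rw [row_set _ h]
  · rename_i h; simp only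
    rw [row_set _ (by simp; omega), getD_pad, getD_pad]

theorem tsize_setBox (T : List (List ℕ)) (r j v : ℕ) :
    tsize (setBox T r j v) + (T.getD r []).length = tsize T + (padSet (T.getD r []) j v).length := by
  unfold setBox
  split
  · rename_i h; simp only; rw [tsize_set _ h]
  · rename_i h; simp only
    have := tsize_set (T ++ List.replicate (r + 1 - T.length) []) (r := r) (by simp; omega)
      (padSet ((T ++ List.replicate (r + 1 - T.length) []).getD r []) j v)
    rw [getD_pad, tsize_pad] at this
    rw [getD_pad]; exact this

def Upd (P P' : List (List ℕ)) (c : ℕ × ℕ) (v : ℕ) : Prop :=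
  ∀ r, P'.getD r [] = if r = c.1 then padSet (P.getD c.1 []) (c.2 - c.1) v else P.getD r []

theorem upd_setBox (P : List (List ℕ)) (c : ℕ × ℕ) (v : ℕ) : Upd P (setBox P c.1 (c.2 - c.1) v) c v :=
  fun r => row_setBox P c.1 (c.2 - c.1) v r

theorem Upd.entry {P P' : List (List ℕ)} {c : ℕ × ℕ} {v : ℕ} (h : Upd P P' c v) (hc : c.1 ≤ c.2)
    (hl : c.2 - c.1 ≤ (P.getD c.1 []).length) {a b : ℕ} (hab : a ≤ b) :
    sEntry P' a b = if (a, b) = c then v else sEntry P a b := by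
  obtain ⟨x, y⟩ := c
  simp only at hc hl
  unfold sEntry
  rw [h a]
  simp only [Prod.mk.injEq]
  by_cases e : a = x
  · subst e
    rw [if_pos rfl, padSet_getD _ hl]
    by_cases e2 : b = y
    · subst e2; simp
    · rw [if_neg (by omega), if_neg (by omega)]
  · rw [if_neg e, if_neg (by tauto)]

theorem findIdx_hit {row : List ℕ} {v j : ℕ} (hj : j < row.length) (h1 : ∀ i < j, row.getD i 0 ≤ v)
    (h2 : v < row.getD j 0) : row.findIdx? (fun z => decide (v < z)) = some j := by
  rw [List.findIdx?_eq_some_iff_getElem]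
  refine ⟨hj, ?_, ?_⟩
  · rw [List.getD_eq_getElem _ _ hj] at h2; simpa using h2
  · intro i hi
    have := h1 i hi
    rw [List.getD_eq_getElem _ _ (by omega)] at this
    simpa using this

theorem findIdx_miss {row : List ℕ} {v : ℕ} (h1 : ∀ i < row.length, row.getD i 0 ≤ v) :
    row.findIdx? (fun z => decide (v < z)) = none := by
  rw [List.findIdx?_eq_none_iff]
  intro z hz
  obtain ⟨i, hi, rfl⟩ := List.getElem_of_mem hz
  have := h1 i hi
  rw [List.getD_eq_getElem _ _ hi] at this
  simpa using this

theorem range_find_hit {m j : ℕ} {p : ℕ → Bool} (hj : j < m) (h1 : ∀ i < j, p i = false)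
    (h2 : p j = true) : (List.range m).find? p = some j := by
  rw [List.find?_range_eq_some]
  exact ⟨h2, by simpa using hj, fun i hi => by simp [h1 i hi]⟩

theorem range_findIdx {m j : ℕ} {p : ℕ → Bool} (hj : j < m) (h1 : ∀ i < j, p i = false)
    (h2 : p j = true) : (List.range m).findIdx p = j := by
  rw [List.findIdx_eq (by simpa using hj)]
  refine ⟨by simpa using h2, fun i hi => by simpa using h1 i hi⟩

/-- location hypotheses -/
def Loc (P : List (List ℕ)) (m : Bool) (c : ℕ × ℕ) (v : ℕ) : Prop :=
  c.1 ≤ c.2 ∧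
  (m = true → ∀ b, c.1 ≤ b → b < c.2 → sEntry P c.1 b ≤ v) ∧
  (m = false → ∀ a, a < c.1 → c.2 - a < (P.getD a []).length ∧ sEntry P a c.2 ≤ v)

theorem step_term {P : List (List ℕ)} {m : Bool} {c : ℕ × ℕ} {v : ℕ} (h : Loc P m c v)
    (hl : (P.getD c.1 []).length = c.2 - c.1)
    (hb : ∀ a, c.1 ≤ a → a ≤ c.2 → (P.getD a []).length ≤ c.2 - a) (fuel : ℕ) :
    mixedIns (fuel+1) P m (if m = true then c.1 else c.2) v = (setBox P c.1 (c.2 - c.1) v, c) := by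
  obtain ⟨a, b⟩ := c
  obtain ⟨h0, h1, h2⟩ := h
  simp only at *
  cases m with
  | true =>
    simp only [if_true, mixedIns]
    rw [findIdx_miss]
    · simp only [hl]
      rw [show a + (b - a) = b by omega]
    · intro i hi
      have := h1 rfl (a + i) (by omega) (by omega)
      unfold sEntry at this
      rwa [show a + i - a = i by omega] at this
  | false =>
    simp only [if_false, mixedIns, Bool.false_eq_true]
    have e : (List.range (b+1)).find? (fun r =>
        decide (b - r < (P.getD r []).length) && decide (v < sEntry P r b)) = none := by
      rw [List.find?_eq_none]
      intro r hr
      rw [List.mem_range] at hr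
      simp only [Bool.and_eq_true, decide_eq_true_eq]
      by_cases hra : r < a
      · have := (h2 rfl r hra).2; omega
      · have := hb r (by omega) (by omega); omega
    rw [e]
    simp only
    have e2 : (List.range (b+1)).findIdx (fun r => decide ((P.getD r []).length ≤ b - r)) = a := by
      apply range_findIdx (by omega)
      · intro i hi; have := (h2 rfl i hi).1; simp only [decide_eq_false_iff_not]; omega
      · simp only [decide_eq_true_eq]; omega
    rw [e2]

theorem step_bump {P : List (List ℕ)} {m : Bool} {c : ℕ × ℕ} {v : ℕ} (h : Loc P m c v)
    (hl : c.2 - c.1 < (P.getD c.1 []).length) (hz : v < sEntry P c.1 c.2) (fuel : ℕ) {z' : ℕ}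
    (hz' : z' = if c.1 = c.2 ∧ sEntry P c.1 c.2 % 2 = 0 then sEntry P c.1 c.2 - 1
      else sEntry P c.1 c.2) :
    ∃ P', Upd P P' c v ∧ tsize P' = tsize P ∧
    mixedIns (fuel+1) P m (if m = true then c.1 else c.2) v =
      if z' % 2 = 0 then mixedIns fuel P' true (c.1 + 1) z' else mixedIns fuel P' false (c.2 + 1) z' := by
  obtain ⟨a, b⟩ := c
  obtain ⟨h0, h1, h2⟩ := h
  simp only at *
  have ha : a < P.length := by
    by_contra hh
    rw [List.getD_eq_default _ _ (by omega)] at hl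
    simp at hl
  have hps : padSet (P.getD a []) (b - a) v = (P.getD a []).set (b - a) v := by
    unfold padSet; rw [if_pos hl]
  cases m with
  | true =>
    refine ⟨P.set a ((P.getD a []).set (b - a) v), ?_, ?_, ?_⟩
    · intro r
      rw [row_set _ ha, hps]
    · have := tsize_set P ha ((P.getD a []).set (b - a) v)
      rw [List.length_set] at this; omega
    · simp only [if_true, mixedIns]
      rw [findIdx_hit hl]
      · simp only
        have e1 : (P.getD a []).getD (b - a) 0 = sEntry P a b := rfl
        have e2 : (b - a = 0) ↔ a = b := by omega
        rw [e1]
        simp only [e2]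
        rw [← hz', show a + (b - a) + 1 = b + 1 by omega]
      · intro i hi
        have := h1 rfl (a + i) (by omega) (by omega)
        unfold sEntry at this
        rwa [show a + i - a = i by omega] at this
      · exact hz
  | false =>
    refine ⟨setBox P a (b - a) v, upd_setBox P (a, b) v, ?_, ?_⟩
    · have := tsize_setBox P a (b - a) v
      rw [hps, List.length_set] at this; omega
    · simp only [if_false, mixedIns, Bool.false_eq_true]
      have e : (List.range (b+1)).find? (fun r =>
          decide (b - r < (P.getD r []).length) && decide (v < sEntry P r b)) = some a := by
        apply range_find_hit (by omega)
        · intro i hi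
          have := (h2 rfl i hi).2
          simp only [Bool.and_eq_false_iff, decide_eq_false_iff_not]
          right; omega
        · simp only [Bool.and_eq_true, decide_eq_true_eq]; exact ⟨hl, hz⟩
      rw [e]
      simp only
      rw [← hz']

end CD

namespace CD

/-! Shifted mixed insertion on tableaux simulates the label dynamics. -/

def val (l : Lab) : ℕ := if l.m = true then 2 * l.v else 2 * l.v - 1

def CC (a l : Lab) : Prop :=
  a.v ≤ l.v ∧ ((l.m = false ∨ l.p.1 = l.p.2) → a.v = l.v → a.m = false)

def RR (l l' : Lab) : Prop :=
  CC l l' ∧ (l.v = l'.v → ((l.m = true ∧ l.p.1 ≠ l.p.2) → l'.p.1 ≠ l.p.1 + 1) ∧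
    (¬ (l.m = true ∧ l.p.1 ≠ l.p.2) → l'.m = false → l'.p.2 ≠ l.p.2 + 1))

theorem RB.rr {l l' : Lab} (h : RB l l') (h1 : l.p.1 ≤ l.p.2) (h2 : l'.p.1 ≤ l'.p.2) : RR l l' := by
  obtain ⟨v, ⟨a, b⟩, m⟩ := l
  obtain ⟨v', ⟨a', b'⟩, m'⟩ := l'
  unfold RB Bx at h
  unfold RR CC
  simp only at *
  rcases h with h | ⟨h, ⟨rfl, rfl, h3, h4⟩ | ⟨rfl, rfl, h3, h4⟩ | ⟨rfl, rfl⟩⟩ <;> simp <;> omega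

/-- entry of label present in tableau -/
def En (P : List (List ℕ)) (l : Lab) : Prop := sEntry P l.p.1 l.p.2 = val l

structure Inv (P : List (List ℕ)) (A : List Lab) (s : Sh) (l0 : Lab) (L : List Lab) : Prop where
  ok : Ok s
  ad : Ad s l0.p
  lv : Valid s (L.map Lab.p)
  shp : ∀ r, (P.getD r []).length = (puts s (L.map Lab.p)).R r - r
  enA : ∀ l ∈ A, En P l
  enL : ∀ l ∈ L, En P l
  cov : ∀ a b, a ≤ b → b < s.R a → ∃ l ∈ A, l.p = (a, b)
  ins : ∀ l ∈ A, l.p.1 ≤ l.p.2 ∧ l.p.2 < s.R l.p.1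
  rowc : l0.m = true → ∀ a ∈ A, a.p.1 = l0.p.1 → val a ≤ val l0
  colc : l0.m = false → ∀ a ∈ A, a.p.2 = l0.p.2 → val a ≤ val l0
  hit : ∀ l ∈ L, l.p = l0.p → val l0 < val l
  rr : L.Pairwise RR
  cA : ∀ a ∈ A, ∀ l ∈ L, CC a l
  c0 : ∀ l ∈ L, CC l0 l
  pos : ∀ l ∈ L, 1 ≤ l.v

theorem Inv.loc {P A s l0 L} (h : Inv P A s l0 L) : Loc P l0.m l0.p (val l0) := by
  have hle := Ad.le h.ok h.ad
  refine ⟨hle, fun hm b h1 h2 => ?_, fun hm a h1 => ?_⟩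
  · obtain ⟨l, hl, hp⟩ := h.cov l0.p.1 b h1 (by rw [h.ad.1]; exact h2)
    have := h.enA l hl
    unfold En at this
    rw [hp] at this
    simp only at this
    rw [this]
    exact h.rowc hm l hl (by rw [hp])
  · have h3 : l0.p.2 < s.R a := (h.ok.mem a l0.p.2 (by omega)).2 (by rw [h.ad.2]; exact h1)
    refine ⟨?_, ?_⟩
    · rw [h.shp, puts_R _ h.lv]; omega
    · obtain ⟨l, hl, hp⟩ := h.cov a l0.p.2 (by omega) h3
      have := h.enA l hl
      unfold En at this
      rw [hp] at this
      simp only at this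
      rw [this]
      exact h.colc hm l hl (by rw [hp])

def Res (P : List (List ℕ)) (A : List Lab) (s : Sh) (l0 : Lab) (L : List Lab)
    (res : List (List ℕ) × (ℕ × ℕ)) : Prop :=
  res.2 = (push s l0.p L).2 ∧
  (∀ r, (res.1.getD r []).length = (put (puts s (L.map Lab.p)) (push s l0.p L).2).R r - r) ∧
  (∀ l ∈ A, En res.1 l) ∧ En res.1 l0 ∧ (∀ l ∈ (push s l0.p L).1, En res.1 l) ∧
  tsize res.1 = tsize P + 1

theorem pair_ne_of_ins {l : Lab} {c : Cell} {s : Sh} (h : l.p.2 < s.R l.p.1) (hc : Ad s c) :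
    l.p ≠ c := by
  rintro rfl
  have := hc.1
  omega

theorem Inv.skip {P A s l0 l L} (h : Inv P A s l0 (l :: L)) (hne : l0.p ≠ l.p) :
    Inv P (A ++ [l]) (put s l.p) l0 L := by
  have hl : Ad s l.p := h.lv.1
  have hd := ad_ne h.ad hl hne
  have hle := Ad.le h.ok hl
  have hrr := List.pairwise_cons.1 h.rr
  refine ⟨h.ok.put hl, ad_put h.ad hl hne, h.lv.2, h.shp, ?_, fun x hx => h.enL x (by simp [hx]),
    ?_, ?_, ?_, ?_, fun x hx => h.hit x (by simp [hx]), hrr.2, ?_, fun x hx => h.c0 x (by simp [hx]),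
    fun x hx => h.pos x (by simp [hx])⟩
  · intro x hx
    rcases List.mem_append.1 hx with hx | hx
    · exact h.enA x hx
    · simp at hx; subst hx; exact h.enL _ (by simp)
  · intro a b hab hb
    by_cases e : (a, b) = l.p
    · exact ⟨l, by simp, e.symm⟩
    · have : b < s.R a := by
        simp only [put] at hb
        split at hb
        · rename_i e1
          rw [e1, hl.1]
          have : b ≠ l.p.2 := fun e2 => e (Prod.ext e1 e2)
          omega
        · exact hb
      obtain ⟨x, hx, hp⟩ := h.cov a b hab this
      exact ⟨x, by simp [hx], hp⟩
  · intro x hx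
    rcases List.mem_append.1 hx with hx | hx
    · refine ⟨(h.ins x hx).1, ?_⟩
      have := (h.ins x hx).2
      simp only [put]; split
      · rename_i e; rw [e, hl.1] at this; omega
      · exact this
    · simp at hx; subst hx; exact ⟨hle, by simp [put]⟩
  · intro hm x hx hxp
    rcases List.mem_append.1 hx with hx | hx
    · exact h.rowc hm x hx hxp
    · simp at hx; subst hx; exact absurd hxp.symm hd.1
  · intro hm x hx hxp
    rcases List.mem_append.1 hx with hx | hx
    · exact h.colc hm x hx hxp
    · simp at hx; subst hx; exact absurd hxp.symm hd.2
  · intro x hx y hy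
    rcases List.mem_append.1 hx with hx | hx
    · exact h.cA x hx y (by simp [hy])
    · simp at hx; subst hx; exact (hrr.1 y hy).1

theorem val_le (l : Lab) : val l ≤ 2 * l.v := by unfold val; split <;> omega

theorem val_prim {a l : Lab} (h : CC a l) (hl : l.m = false ∨ l.p.1 = l.p.2) :
    val a ≤ 2 * l.v - 1 := by
  have := h.2 hl
  have h1 := h.1
  unfold val
  split
  · rename_i hm
    have : a.v ≠ l.v := fun e => by simp [this e] at hm
    omega
  · omega

theorem Inv.bump {P P' A s l0 l L} (h : Inv P A s l0 (l :: L)) (he : l0.p = l.p)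
    (hu : Upd P P' l0.p (val l0)) :
    Inv P' (A ++ [l0]) (put s l0.p)
      ⟨l.v, (nxt (put s l0.p) l.p l.m).1, (nxt (put s l0.p) l.p l.m).2⟩ L := by
  have hl : Ad s l.p := h.lv.1
  have hle := Ad.le h.ok h.ad
  have hrr := List.pairwise_cons.1 h.rr
  have hok' := h.ok.put h.ad
  have hlv' : Valid (put s l0.p) (L.map Lab.p) := by rw [he]; exact h.lv.2
  have hR : (put s l0.p).R l0.p.1 = l0.p.2 + 1 := put_R_self s l0.p
  have hlen : l0.p.2 - l0.p.1 < (P.getD l0.p.1 []).length := by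
    rw [h.shp, show puts s ((l :: L).map Lab.p) = puts (put s l0.p) (L.map Lab.p) by rw [he]; rfl,
      puts_R _ hlv', hR]
    omega
  have hent : ∀ {x : Lab}, x.p.1 ≤ x.p.2 → x.p ≠ l0.p → En P x → En P' x := by
    intro x h1 h2 h3
    unfold En at *
    rw [hu.entry hle (by omega) h1, if_neg (by simpa using h2), h3]
  have hout := valid_out _ hok' hlv'
  refine ⟨hok', ?_, hlv', ?_, ?_, ?_, ?_, ?_, ?_, ?_, ?_, hrr.2, ?_, ?_, fun x hx => h.pos x (by simp [hx])⟩
  · simp only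
    rw [← he]
    exact nxt_ad h.ok h.ad l.m
  · intro r
    rw [hu r]
    have := h.shp r
    rw [show puts s ((l :: L).map Lab.p) = puts (put s l0.p) (L.map Lab.p) by rw [he]; rfl] at this
    rw [← this]
    split
    · rename_i e
      rw [padSet_length _ (by omega), if_neg (by omega), e]
    · rfl
  · intro x hx
    rcases List.mem_append.1 hx with hx | hx
    · have := h.ins x hx
      exact hent this.1 (pair_ne_of_ins this.2 h.ad) (h.enA x hx)
    · simp at hx; subst hx
      unfold En
      rw [hu.entry hle (by omega) hle, if_pos rfl]
  · intro x hx
    have := hout x.p (List.mem_map_of_mem hx)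
    refine hent this.1 ?_ (h.enL x (by simp [hx]))
    intro e
    rw [e, hR] at this
    omega
  · intro a b hab hb
    by_cases e : (a, b) = l0.p
    · exact ⟨l0, by simp, e.symm⟩
    · have : b < s.R a := by
        simp only [put] at hb
        split at hb
        · rename_i e1
          rw [e1, h.ad.1]
          have : b ≠ l0.p.2 := fun e2 => e (Prod.ext e1 e2)
          omega
        · exact hb
      obtain ⟨x, hx, hp⟩ := h.cov a b hab this
      exact ⟨x, by simp [hx], hp⟩
  · intro x hx
    rcases List.mem_append.1 hx with hx | hx
    · refine ⟨(h.ins x hx).1, ?_⟩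
      have := (h.ins x hx).2
      simp only [put]; split
      · rename_i e; rw [e, h.ad.1] at this; omega
      · exact this
    · simp at hx; subst hx; exact ⟨hle, by simp [put]⟩
  · simp only
    intro hm x hx _
    have : CC x l := by
      rcases List.mem_append.1 hx with hx | hx
      · exact h.cA x hx l (by simp)
      · simp at hx; subst hx; exact h.c0 l (by simp)
    have h1 := val_le x
    have h2 := this.1
    simp only [val, hm, if_true]
    unfold val at h1
    omega
  · simp only
    intro hm x hx _
    have : CC x l := by
      rcases List.mem_append.1 hx with hx | hx
      · exact h.cA x hx l (by simp)
      · simp at hx; subst hx; exact h.c0 l (by simp)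
    have hl' : l.m = false ∨ l.p.1 = l.p.2 := by
      unfold nxt at hm
      split at hm
      · simp at hm
      · rename_i hh
        by_cases e : l.m = true
        · right; by_contra e2; exact hh ⟨e, e2⟩
        · left; simpa using e
    have := val_prim this hl'
    conv_rhs => unfold val
    simpa [hm] using this
  · intro x hx hxp
    have h1 := hrr.1 x hx
    have hp := h.pos x (by simp [hx])
    rcases Nat.lt_or_ge l.v x.v with hlt | hge
    · have := val_le ⟨l.v, (nxt (put s l0.p) l.p l.m).1, (nxt (put s l0.p) l.p l.m).2⟩
      simp only at this
      have : 2 * x.v - 1 ≤ val x := by unfold val; split <;> omega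
      omega
    · have hv : l.v = x.v := le_antisymm h1.1.1 hge
      have h2 := h1.2 hv
      simp only at hxp
      by_cases hc : l.m = true ∧ l.p.1 ≠ l.p.2
      · have := h2.1 hc
        unfold nxt at hxp
        rw [if_pos hc] at hxp
        rw [hxp] at this
        simp at this
      · have h3 := h2.2 hc
        unfold nxt at hxp
        rw [if_neg hc] at hxp
        rw [hxp] at h3
        have hm : x.m = true := by
          by_contra e
          exact h3 (by simpa using e) rfl
        unfold nxt
        rw [if_neg hc]
        simp [val, hm]
        omega
  · intro x hx y hy
    rcases List.mem_append.1 hx with hx | hx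
    · exact h.cA x hx y (by simp [hy])
    · simp at hx; subst hx; exact h.c0 y (by simp [hy])
  · intro y hy
    have h1 := (hrr.1 y hy).1
    refine ⟨h1.1, fun h2 h3 => ?_⟩
    have h4 := h1.2 h2 h3
    simp only
    unfold nxt
    rw [if_neg (by simp [h4])]

theorem sim (L : List Lab) : ∀ {fuel P A s l0}, L.length < fuel → Inv P A s l0 L →
    Res P A s l0 L (mixedIns fuel P l0.m (if l0.m = true then l0.p.1 else l0.p.2) (val l0)) := by
  induction L with
  | nil =>
    intro fuel P A s l0 hf h
    obtain ⟨fuel, rfl⟩ := Nat.exists_eq_succ_of_ne_zero (show fuel ≠ 0 by simp at hf; omega)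
    have hle := Ad.le h.ok h.ad
    have hsh : ∀ r, (P.getD r []).length = s.R r - r := h.shp
    have hl : (P.getD l0.p.1 []).length = l0.p.2 - l0.p.1 := by rw [hsh, h.ad.1]
    rw [step_term h.loc hl (fun a h1 h2 => by
      rw [hsh]
      have := h.ok.mem a l0.p.2 h2
      rw [h.ad.2] at this
      omega)]
    have hu := upd_setBox P l0.p (val l0)
    refine ⟨rfl, fun r => ?_, fun x hx => ?_, ?_, by simp [push], ?_⟩
    · simp only
      rw [hu r]
      simp only [puts, List.map_nil, List.foldl_nil, push, put]
      split
      · rename_i e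
        rw [padSet_length _ (by omega), if_pos hl.symm, hl]; omega
      · exact hsh r
    · have := h.ins x hx
      have h3 := h.enA x hx
      unfold En at *
      rw [hu.entry hle (by omega) this.1, if_neg (by simpa using pair_ne_of_ins this.2 h.ad), h3]
    · unfold En
      rw [hu.entry hle (by omega) hle, if_pos rfl]
    · have := tsize_setBox P l0.p.1 (l0.p.2 - l0.p.1) (val l0)
      rw [padSet_length _ (by omega), if_pos hl.symm] at this
      simp only; omega
  | cons l L ih =>
    intro fuel P A s l0 hf h
    by_cases he : l0.p = l.p
    · obtain ⟨fuel, rfl⟩ := Nat.exists_eq_succ_of_ne_zero (show fuel ≠ 0 by omega)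
      have hle := Ad.le h.ok h.ad
      have hlv' : Valid (put s l0.p) (L.map Lab.p) := by rw [he]; exact h.lv.2
      have hR : (put s l0.p).R l0.p.1 = l0.p.2 + 1 := put_R_self s l0.p
      have hlen : l0.p.2 - l0.p.1 < (P.getD l0.p.1 []).length := by
        rw [h.shp, show puts s ((l :: L).map Lab.p) = puts (put s l0.p) (L.map Lab.p) by rw [he]; rfl,
          puts_R _ hlv', hR]
        omega
      have hen : sEntry P l0.p.1 l0.p.2 = val l := by rw [he]; exact h.enL l (by simp)
      obtain ⟨P', hu, hts, hmi⟩ := step_bump h.loc hlen (by rw [hen]; exact h.hit l (by simp) he.symm)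
        fuel rfl
      have hI := h.bump he hu
      have := ih (fuel := fuel) (by simp at hf; omega) hI
      have hpos := h.pos l (by simp)
      rw [hen] at hmi
      have key : (mixedIns (fuel + 1) P l0.m (if l0.m = true then l0.p.1 else l0.p.2) (val l0)) =
          mixedIns fuel P' (nxt (put s l0.p) l.p l.m).2
            (if (nxt (put s l0.p) l.p l.m).2 = true then (nxt (put s l0.p) l.p l.m).1.1
              else (nxt (put s l0.p) l.p l.m).1.2)
            (val ⟨l.v, (nxt (put s l0.p) l.p l.m).1, (nxt (put s l0.p) l.p l.m).2⟩) := by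
        rw [hmi, he]
        unfold nxt
        by_cases hc : l.m = true ∧ l.p.1 ≠ l.p.2
        · rw [if_pos hc]
          simp [val, hc.1, hc.2]
        · rw [if_neg hc]
          by_cases hm : l.m = true
          · have hd : l.p.1 = l.p.2 := by by_contra e; exact hc ⟨hm, e⟩
            simp only [val, hm, hd, if_true]
            have : (2 * l.v) % 2 = 0 := by omega
            have h2 : (2 * l.v - 1) % 2 ≠ 0 := by omega
            simp [this, h2]
          · have hm' : l.m = false := by simpa using hm
            have h2 : (2 * l.v - 1) % 2 ≠ 0 := by omega
            simp [val, hm', h2]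
      rw [Nat.succ_eq_add_one, key]
      obtain ⟨r1, r2, r3, r4, r5, r6⟩ := this
      simp only at r1 r2 r3 r4 r5 r6
      have hpush : push s l0.p (l :: L) = (⟨l.v, (nxt (put s l0.p) l.p l.m).1, (nxt (put s l0.p) l.p l.m).2⟩ ::
        (push (put s l0.p) (nxt (put s l0.p) l.p l.m).1 L).1,
        (push (put s l0.p) (nxt (put s l0.p) l.p l.m).1 L).2) := by
        simp only [push]
        rw [if_pos he, ← he]
      refine ⟨?_, ?_, fun x hx => r3 x (by simp [hx]), r3 _ (by simp), ?_, ?_⟩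
      · rw [hpush]; exact r1
      · rw [hpush, show puts s ((l :: L).map Lab.p) = puts (put s l0.p) (L.map Lab.p) by rw [he]; rfl]
        exact r2
      · rw [hpush]
        intro x hx
        rcases List.mem_cons.1 hx with rfl | hx
        · exact r4
        · exact r5 x hx
      · rw [r6, hts]
    · obtain ⟨r1, r2, r3, r4, r5, r6⟩ := ih (fuel := fuel) (by simp at hf; omega) (h.skip he)
      have hpush : push s l0.p (l :: L) =
          (l :: (push (put s l.p) l0.p L).1, (push (put s l.p) l0.p L).2) := by
        simp only [push]
        rw [if_neg he]
      refine ⟨?_, ?_, fun x hx => r3 x (by simp [hx]), r4, ?_, r6⟩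
      · rw [hpush]; exact r1
      · rw [hpush]; exact r2
      · rw [hpush]
        intro x hx
        rcases List.mem_cons.1 hx with rfl | hx
        · exact r3 _ (by simp)
        · exact r5 x hx

end CD

namespace CD

structure WInv (P : List (List ℕ)) (A : List Lab) (s : Sh) (x : ℕ) (L : List Lab) : Prop where
  ok : Ok s
  lv : Valid s (L.map Lab.p)
  shp : ∀ r, (P.getD r []).length = (puts s (L.map Lab.p)).R r - r
  enA : ∀ l ∈ A, En P l
  enL : ∀ l ∈ L, En P l
  cov : ∀ a b, a ≤ b → b < s.R a → ∃ l ∈ A, l.p = (a, b)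
  ins : ∀ l ∈ A, l.p.1 ≤ l.p.2 ∧ l.p.2 < s.R l.p.1
  le : ∀ a ∈ A, a.v ≤ x
  rr : L.Pairwise RR
  cA : ∀ a ∈ A, ∀ l ∈ L, CC a l
  pos : ∀ l ∈ L, 1 ≤ l.v

theorem WInv.inv {P A s x L} (h : WInv P A s x L) (hx : ∀ l ∈ L, x < l.v) :
    Inv P A s ⟨x, (0, s.R 0), true⟩ L := by
  refine ⟨h.ok, ad_zero h.ok, h.lv, h.shp, h.enA, h.enL, h.cov, h.ins, fun _ a ha _ => ?_,
    fun hm => by simp at hm, fun l hl _ => ?_, h.rr, h.cA, fun l hl => ?_, h.pos⟩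
  · have := val_le a
    have := h.le a ha
    have : val ⟨x, (0, s.R 0), true⟩ = 2 * x := by simp [val]
    omega
  · have : 2 * l.v - 1 ≤ val l := by unfold val; split <;> omega
    have := hx l hl
    have : val ⟨x, (0, s.R 0), true⟩ = 2 * x := by simp [val]
    omega
  · have := hx l hl
    exact ⟨this.le, fun _ e => by simp at e; omega⟩

theorem WInv.skip {P A s x l L} (h : WInv P A s x (l :: L)) (hx : l.v ≤ x) :
    WInv P (A ++ [l]) (put s l.p) x L := by
  have hl : Ad s l.p := h.lv.1
  have hle := Ad.le h.ok hl
  have hrr := List.pairwise_cons.1 h.rr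
  refine ⟨h.ok.put hl, h.lv.2, h.shp, ?_, fun x hx => h.enL x (by simp [hx]),
    ?_, ?_, ?_, hrr.2, ?_, fun x hx => h.pos x (by simp [hx])⟩
  · intro x hx
    rcases List.mem_append.1 hx with hx | hx
    · exact h.enA x hx
    · simp at hx; subst hx; exact h.enL _ (by simp)
  · intro a b hab hb
    by_cases e : (a, b) = l.p
    · exact ⟨l, by simp, e.symm⟩
    · have : b < s.R a := by
        simp only [put] at hb
        split at hb
        · rename_i e1
          rw [e1, hl.1]
          have : b ≠ l.p.2 := fun e2 => e (Prod.ext e1 e2)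
          omega
        · exact hb
      obtain ⟨x, hx, hp⟩ := h.cov a b hab this
      exact ⟨x, by simp [hx], hp⟩
  · intro x hx
    rcases List.mem_append.1 hx with hx | hx
    · refine ⟨(h.ins x hx).1, ?_⟩
      have := (h.ins x hx).2
      simp only [put]; split
      · rename_i e; rw [e, hl.1] at this; omega
      · exact this
    · simp at hx; subst hx; exact ⟨hle, by simp [put]⟩
  · intro a ha
    rcases List.mem_append.1 ha with ha | ha
    · exact h.le a ha
    · simp at ha; subst ha; exact hx
  · intro x hx y hy
    rcases List.mem_append.1 hx with hx | hx
    · exact h.cA x hx y (by simp [hy])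
    · simp at hx; subst hx; exact (hrr.1 y hy).1

def ResW (P : List (List ℕ)) (A : List Lab) (s : Sh) (x : ℕ) (L : List Lab)
    (res : List (List ℕ) × (ℕ × ℕ)) : Prop :=
  res.2 = (stepW s x L).2 ∧
  (∀ r, (res.1.getD r []).length = (put (puts s (L.map Lab.p)) (stepW s x L).2).R r - r) ∧
  (∀ l ∈ A, En res.1 l) ∧ (∀ l ∈ (stepW s x L).1, En res.1 l) ∧
  tsize res.1 = tsize P + 1

theorem simW (L : List Lab) : ∀ {fuel P A s x}, L.length < fuel → WInv P A s x L →
    ResW P A s x L (mixedIns fuel P true 0 (2 * x)) := by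
  induction L with
  | nil =>
    intro fuel P A s x hf h
    obtain ⟨r1, r2, r3, r4, r5, r6⟩ := sim [] hf (h.inv (by simp))
    simp only [val, if_true] at r1 r2 r3 r4 r5 r6
    refine ⟨r1, r2, r3, ?_, r6⟩
    intro l hl
    simp [stepW] at hl
    subst hl; exact r4
  | cons l L ih =>
    intro fuel P A s x hf h
    by_cases hx : l.v ≤ x
    · obtain ⟨r1, r2, r3, r4, r5⟩ := ih (fuel := fuel) (by simp at hf; omega) (h.skip hx)
      have hs : stepW s x (l :: L) = (l :: (stepW (put s l.p) x L).1, (stepW (put s l.p) x L).2) := by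
        simp only [stepW]; rw [if_pos hx]
      refine ⟨by rw [hs]; exact r1, by rw [hs]; exact r2, fun y hy => r3 y (by simp [hy]), ?_, r5⟩
      rw [hs]
      intro y hy
      rcases List.mem_cons.1 hy with rfl | hy
      · exact r3 _ (by simp)
      · exact r4 y hy
    · have hrr := List.pairwise_cons.1 h.rr
      obtain ⟨r1, r2, r3, r4, r5, r6⟩ := sim _ hf (h.inv (by
        intro y hy
        rcases List.mem_cons.1 hy with rfl | hy
        · omega
        · have := (hrr.1 y hy).1.1; omega))
      simp only [val, if_true] at r1 r2 r3 r4 r5 r6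
      have hs : stepW s x (l :: L) = (⟨x, (0, s.R 0), true⟩ :: (push s (0, s.R 0) (l :: L)).1,
          (push s (0, s.R 0) (l :: L)).2) := by
        simp only [stepW]; rw [if_neg hx]
      refine ⟨by rw [hs]; exact r1, by rw [hs]; exact r2, r3, ?_, r6⟩
      rw [hs]
      intro y hy
      rcases List.mem_cons.1 hy with rfl | hy
      · exact r4
      · exact r5 y hy

theorem fil_snoc_ne (l : List Cell) {c q : Cell} (h : q ≠ c) : ∀ {k}, fil k (l ++ [c]) q = fil k l q := by
  induction l with
  | nil => intro k; simp [fil, h]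
  | cons y l ih => intro k; simp [fil, ih]

theorem mixed_fold (w : List ℕ) : (∀ x ∈ w, 1 ≤ x) →
    (∀ r, ((mixedPQ w).1.getD r []).length = (puts em ((state em [] w).map Lab.p)).R r - r) ∧
    (∀ l ∈ state em [] w, En (mixedPQ w).1 l) ∧ tsize (mixedPQ w).1 = w.length ∧
    tsize (mixedPQ w).2 = w.length ∧
    (∀ r, ((mixedPQ w).2.getD r []).length = (puts em ((state em [] w).map Lab.p)).R r - r) ∧
    toFunShifted (mixedPQ w).2 = fil 1 (Pw em w) := by
  induction w using List.reverseRecOn with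
  | nil =>
    intro _
    refine ⟨fun r => ?_, by simp [state], rfl, rfl, fun r => ?_, ?_⟩
    · simp [mixedPQ, state, puts, em]
    · simp [mixedPQ, state, puts, em]
    · funext q; simp [mixedPQ, toFunShifted, Pw, outs, fil]
  | append_singleton w x ih =>
    intro hpos
    obtain ⟨h1, h2, h3, h4, h5, h6⟩ := ih (fun y hy => hpos y (by simp [hy]))
    have hlv := state_lv em_ok w
    have hout := valid_out _ em_ok hlv
    have hW : WInv (mixedPQ w).1 [] em x (state em [] w) := by
      refine ⟨em_ok, hlv, h1, by simp, h2, fun a b hab hb => by simp [em] at hb; omega, by simp,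
        by simp, ?_, by simp, ?_⟩
      · have := List.isChain_iff_pairwise.1 (state_chain em_ok w)
        refine this.imp_of_mem (fun {a b} ha hb hab => ?_)
        exact hab.rr (hout a.p (List.mem_map_of_mem ha)).1 (hout b.p (List.mem_map_of_mem hb)).1
      · intro l hl
        have : l.v ∈ w := state_mem.1 (List.mem_map_of_mem hl)
        exact hpos _ (by simp [this])
    have hlen := state_len w em []
    obtain ⟨r1, r2, -, r4, r5⟩ := simW _ (fuel := tsize (mixedPQ w).1 + 2)
      (by rw [hlen, h3]; simp) hW
    have hst := stepW_valid x _ em em_ok hlv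
    have hc := hst.2.1
    set c := (stepW em x (state em [] w)).2 with hcdef
    have hokp := Ok.puts (s := em) _ em_ok hlv
    have hle := Ad.le hokp hc
    have hcR : ((mixedPQ w).2.getD c.1 []).length = c.2 - c.1 := by rw [h5, hc.1]
    have e : mixedPQ (w ++ [x]) = ((mixedInsLetter (mixedPQ w).1 x).1,
        setBox (mixedPQ w).2 c.1 (c.2 - c.1) (w.length + 1)) := by
      have hr : (mixedInsLetter (mixedPQ w).1 x).2 = c := r1
      rw [← hr, ← h4]
      simp only [mixedPQ, List.foldl_append, List.foldl_cons, List.foldl_nil]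
    have hpw : Pw em (w ++ [x]) = Pw em w ++ [c] := by rw [pw_append]; rfl
    rw [e, state_snoc, hst.2.2, hpw]
    have hu := upd_setBox (mixedPQ w).2 c (w.length + 1)
    refine ⟨r2, r4, ?_, ?_, ?_, ?_⟩
    · have : tsize (mixedInsLetter (mixedPQ w).1 x).1 = _ := r5
      simp [this, h3]
    · have := tsize_setBox (mixedPQ w).2 c.1 (c.2 - c.1) (w.length + 1)
      rw [padSet_length _ (by omega), if_pos hcR.symm] at this
      simp; omega
    · intro r
      simp only
      rw [hu r]
      simp only [put]
      split
      · rw [padSet_length _ (by omega), if_pos hcR.symm, hcR]; omega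
      · exact h5 r
    · funext q
      have hnd := (valid_OO _ em_ok (pw_valid em em_ok (w ++ [x]))).nodup
      rw [hpw] at hnd
      have hnm : c ∉ Pw em w := by
        intro hm
        exact (List.nodup_append.1 hnd).2.2 c hm c (by simp) rfl
      have h6q := congrFun h6 q
      obtain ⟨a, b⟩ := q
      unfold toFunShifted at h6q ⊢
      simp only at h6q ⊢
      by_cases hab : a ≤ b
      · rw [if_pos hab] at h6q ⊢
        have := hu.entry hle (by omega) hab
        unfold sEntry at this
        rw [this]
        split
        · rename_i hh
          rw [hh, fil_at _ _ hnm, pw_length]; omega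
        · rename_i hh
          rw [fil_snoc_ne _ hh, ← h6q]
      · rw [if_neg hab] at h6q ⊢
        rw [fil_snoc_ne _ (by intro hh; rw [← hh] at hle; exact hab hle), ← h6q]

end CD

namespace CD

theorem getD_tr (M : ℕ) (l : List Cell) (i : ℕ) :
    ((l.map (tr M)).getD i (0,0)).1 = (l.getD i (0,0)).1 := by
  simp only [List.getD_eq_getElem?_getD, List.getElem?_map]
  cases l[i]? <;> rfl

theorem OO_tr {M : ℕ} {l : List Cell} (h : OO (l.map (tr M))) : OO l := by
  unfold OO at *
  rw [List.pairwise_map] at h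
  exact h.imp (fun {a b} hab => ⟨fun e => hab.1 (by rw [e]), fun e => hab.2 ((tr_adj M _ _).2 e)⟩)

theorem head_tr {M : ℕ} {l : List Cell} (h : Valid (dl M) (l.map (tr M))) (hne : l ≠ []) :
    l.head? = some (0,0) := by
  cases l with
  | nil => exact absurd rfl hne
  | cons c l =>
    obtain ⟨a, b⟩ := c
    have h1 := h.1.1
    have h2 := h.1.2
    simp only [dl, tr] at h1 h2
    rw [if_neg (by omega)] at h2
    simp only [List.head?_cons]
    congr 1
    ext <;> simp <;> omega

theorem final_sets (n : ℕ) (hn : 0 < n) (f : (ℕ × ℕ) → ℕ)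
    (hf : IsStdFilling (strCell (sqShape n)) (n ^ 2) f) :
    tabCycDes (n ^ 2) f =
      wordCycDes ((phiWord n hn (haimanH n f)).map (fun i => n - (i : ℕ))) := by
  obtain ⟨T0, rfl, hlen0, h⟩ := std_list (M := n * n + n + 1) hf (by nlinarith)
  set M := n * n + n + 1 with hMd
  have hM : n * n + n < M := by omega
  set T := T0.map (tr M) with hT
  have hN : 1 ≤ n * n := by nlinarith
  have hN2 : n ^ 2 = n * n := pow_two n
  have hlen0' : T0.length = n * n := by rw [hlen0, hN2]
  have hoo : OO T0 := OO_tr (valid_OO _ (dl_ok M) h.v)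
  have hhd : T0.head? = some (0,0) := head_tr h.v (by rintro rfl; simp at hlen0'; omega)
  have hpr := promote_fil hoo hhd
  rw [hlen0'] at hpr
  have hrow : ∀ v, 1 ≤ v → v ≤ n * n → rowOf (fil 1 T0) v = (T.getD (v-1) (0,0)).1 := by
    intro v h1 h2
    rw [rowOf_fil hoo.nodup h1 (by omega), hT, getD_tr]
  have hrowp : ∀ v, 1 ≤ v → v ≤ n * n →
      rowOf (promote (n * n) (fil 1 T0)) v = ((prm T).getD (v-1) (0,0)).1 := by
    intro v h1 h2
    rw [hpr.1, rowOf_fil hpr.2.nodup h1 (by rw [prm_length]; omega), hT, tr_prm, getD_tr]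
  have hw : sqWordOf n (fil 1 T0) = wd n T := by
    apply List.ext_getElem
    · simp [sqWordOf, wd, h.len, hN2]
    · intro i h1 h2
      have hi : i < T.length := by simpa [wd] using h2
      have hi' : i < n * n := by rw [← h.len]; exact hi
      simp only [sqWordOf, wd, List.getElem_map, List.getElem_range]
      rw [hrow _ (by omega) (by omega), Nat.add_sub_cancel, List.getD_eq_getElem _ _ hi]
  have hH : haimanH n (fil 1 T0) = fil 1 (HH n T) := by
    unfold haimanH mixedQ HH
    rw [hw]
    refine (mixed_fold (wd n T) ?_).2.2.2.2.2
    intro x hx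
    simp only [wd, List.mem_map] at hx
    obtain ⟨c, hc, rfl⟩ := hx
    have := h.lt c hc
    omega
  have hdb : ∀ k, Db n (prm^[k] (HH n T)) := fun k => by
    rw [← HH_iter hM h]; exact HH_db hM (h.iter k)
  have hHl : (HH n T).length = n * n := by rw [HH_length, h.len]
  have hlt : ∀ k, lr n (prm^[k] (HH n T)) < n := fun k => lr_lt hn (hdb k)
  have hphi : (phiWord n hn (haimanH n (fil 1 T0))).map (fun i => n - (i : ℕ)) =
      (List.range (n * n)).map (fun i => n - lr n (prm^[i+1] (HH n T))) := by
    rw [hH]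
    unfold phiWord
    have hb : ∀ l : List (Fin n), (l >>= fun a => pure (a : ℕ)) = l.map (Fin.val (n := n)) := by
      intro l
      induction l with
      | nil => rfl
      | cons a l ih => simpa using ih
    rw [hb, List.map_map, List.map_map, ← hN2]
    apply List.map_congr_left
    intro i _
    obtain ⟨e1, e2, e3⟩ := promote_iter (N := n * n) hN (S := HH n T) (hdb 0).v hHl (i+1)
    simp only [Function.comp]
    rw [hN2]
    have e1' : (promote (n * n))^[i + 1] (fil 1 (HH n T)) = fil 1 (prm^[i+1] (HH n T)) := e1
    rw [e1', rowOf_fil (valid_OO _ em_ok e2).nodup hN e3.ge]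
    congr 1
    exact Nat.mod_eq_of_lt (hlt (i+1))
  rw [hphi]
  have hget : ∀ i, i < n * n → ((List.range (n * n)).map
      (fun i => n - lr n (prm^[i+1] (HH n T)))).getD i 0 = n - lr n (prm^[i+1] (HH n T)) := by
    intro i hi
    rw [List.getD_eq_getElem _ _ (by simpa using hi)]
    simp
  unfold tabCycDes wordCycDes
  rw [hN2]
  congr 1
  · ext i
    simp only [Set.mem_ofPred_eq, List.length_map, List.length_range]
    refine and_congr_right (fun h1 => and_congr_right (fun h2 => ?_))
    have hn2 : 2 ≤ n := by
      by_contra hc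
      have : n = 1 := by omega
      subst this; omega
    rw [hrow _ h1 (by omega), hrow _ (by omega) (by omega), hget _ h2, hget _ (by omega),
      Nat.sub_add_cancel h1]
    have := main_pos hn2 hM h h1 h2
    unfold ds at this
    rw [Nat.sub_add_cancel h1] at this
    rw [Nat.add_sub_cancel, this]
    have := hlt i
    have := hlt (i+1)
    omega
  · ext i
    simp only [Set.mem_ofPred_eq, List.length_map, List.length_range]
    refine and_congr_right (fun _ => ?_)
    rw [hget _ (by omega), hget _ (by omega)]
    by_cases hn2 : 2 ≤ n
    · have h4 : 2 * 2 ≤ n * n := Nat.mul_le_mul hn2 hn2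
      have := main_zero hn2 hM h
      unfold ds at this
      rw [hrowp _ (by omega) (by omega), hrowp _ (by omega) (by omega),
        show n * n - 1 - 1 = n * n - 2 by omega, Nat.sub_add_cancel hN]
      rw [show n * n - 2 + 1 = n * n - 1 by omega] at this
      rw [this]
      have := hlt (n * n)
      have := hlt 1
      simp only [Nat.zero_add]
      omega
    · have hn1 : n = 1 := by omega
      have h0 : ((prm T).getD (n * n - 1) (0,0)).1 < n := by
        have hl := h.prm.len
        rw [List.getD_eq_getElem _ _ (by omega)]
        exact h.prm.lt _ (List.getElem_mem _)
      rw [hrowp (n * n) hN le_rfl]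
      subst hn1
      simp only [Nat.mul_one, Nat.sub_self, lt_self_iff_false, iff_false] at h0 ⊢
      omega

end CD

/-- (Petersen–Serrano, Lemma 5.1.)  Let `Ψ = Φ ∘ H` be the composition of Haiman's
bijection `H : SYT(n × n) → SYT'(2n-1, 2n-3, …, 1)` with the promotion-sequence bijection
`Φ`.  Then for every standard `n × n` square Young tableau `T`, the cyclic descent set of
`T` equals the cyclic descent set of the word `Ψ(T)` (read through its subscripts
`i ↦ n - i`); in particular `maj(T) = maj(Ψ(T))`. -/
theorem cyclic_descents_preserved_by_Psi
    (n : ℕ) (hn : 0 < n) (f : (ℕ × ℕ) → ℕ)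
    (hf : IsStdFilling (strCell (sqShape n)) (n ^ 2) f) :
    tabCycDes (n ^ 2) f =
      wordCycDes ((phiWord n hn (haimanH n f)).map (fun i => n - (i : ℕ))) ∧
    ∑ᶠ i ∈ tabCycDes (n ^ 2) f, i =
      ∑ᶠ i ∈ wordCycDes ((phiWord n hn (haimanH n f)).map (fun i => n - (i : ℕ))), i := by
  have h := CD.final_sets n hn f hf
  exact ⟨h, by rw [h]⟩
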